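/- arXiv:2309.02806 — 2 statements merged into one kernel-verified Lean document; each statement's English description precedes it below -/
import Mathlib

section
/- Assume c(x,y) = k(|y−x|) with k : [0,∞) → [0,∞) continuous, increasing, k(0) = 0 and k(r) → ∞ as r → ∞. Then for every m > 0 the maximisers of ℰ(m) are exactly the characteristic functions of balls of volume m (equivalently, the maximisers of ℰ_set(m) are the balls of volume m). Moreover, every minimiser γ of Υ(χ_{B_1}) has second marginal γ_y = χ_{A}·Leb, where A = B_{2^{1/d}} ∖ B_1 is the annulus with |A| = |B_1| surrounding the unit ball. -/
open MeasureTheory ENNReal Filter Set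

noncomputable section

/-- Euclidean space `ℝ^d`. -/
abbrev Rd (d : ℕ) : Type := EuclideanSpace ℝ (Fin d)

/-- The measure `f · Leb` on `ℝ^d`. -/
def fMeas {d : ℕ} (f : Rd d → ℝ) : Measure (Rd d) :=
  MeasureTheory.volume.withDensity fun x => ENNReal.ofReal (f x)

/-- The set `Π_f` of admissible exterior transport plans: first marginal `f · Leb`,
second marginal `≤ (1 - f) · Leb`. -/
def ExtPlans {d : ℕ} (f : Rd d → ℝ) : Set (Measure (Rd d × Rd d)) :=
  {γ | γ.map Prod.fst = fMeas f ∧ γ.map Prod.snd ≤ fMeas fun x => 1 - f x}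

/-- The transport cost `∫ c dγ` of a plan `γ`. -/
def planCost {d : ℕ} (c : Rd d → Rd d → ℝ) (γ : Measure (Rd d × Rd d)) : ℝ≥0∞ :=
  ∫⁻ p, ENNReal.ofReal (c p.1 p.2) ∂γ

/-- The functional `Υ(f) = inf { ∫ c dγ : γ ∈ Π_f }`. -/
def Ups {d : ℕ} (c : Rd d → Rd d → ℝ) (f : Rd d → ℝ) : ℝ≥0∞ :=
  ⨅ γ ∈ ExtPlans f, planCost c γ

/-- `f ∈ L¹(ℝ^d, [0,1])`. -/
def InUnit {d : ℕ} (f : Rd d → ℝ) : Prop :=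
  Integrable f MeasureTheory.volume ∧ ∀ x, 0 ≤ f x ∧ f x ≤ 1

/-- `f ∈ L¹_m`: in `L¹(ℝ^d,[0,1])` with `∫ f ≤ m`. -/
def MemL1m {d : ℕ} (m : ℝ) (f : Rd d → ℝ) : Prop := InUnit f ∧ (∫ x, f x) ≤ m

/-- The energy `ℰ(m) = sup { Υ(f) : f ∈ L¹(ℝ^d,[0,1]), ∫ f = m }`. -/
def Energy {d : ℕ} (c : Rd d → Rd d → ℝ) (m : ℝ) : ℝ≥0∞ :=
  ⨆ f ∈ {f : Rd d → ℝ | InUnit f ∧ (∫ x, f x) = m}, Ups c f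

/-- Hypothesis (H1): `k` continuous, `k 0 = 0`, `k → ∞` at infinity. -/
def H1 {d : ℕ} (k : Rd d → ℝ) : Prop :=
  Continuous k ∧ k 0 = 0 ∧ Tendsto k (Bornology.cobounded (Rd d)) atTop

/-- Hypothesis (H2). -/
def H2 {d : ℕ} (k : Rd d → ℝ) : Prop :=
  ∀ x : Rd d, x ≠ 0 →
    0 < Filter.limsup
      (fun r : ℝ =>
        MeasureTheory.volume (Metric.ball x r ∩ {y | k y < k x}) / ENNReal.ofReal (r ^ d))
      (nhdsWithin 0 (Set.Ioi 0))

/-- Hypothesis (H3): `r ↦ k (r σ)` increasing on `[0, ∞)` for every unit direction `σ`. -/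
def H3 {d : ℕ} (k : Rd d → ℝ) : Prop :=
  ∀ σ : Rd d, ‖σ‖ = 1 → StrictMonoOn (fun r : ℝ => k (r • σ)) (Set.Ici 0)

/-- Translation-invariant cost `c(x,y) = k(y - x)`. -/
def transCost {d : ℕ} (k : Rd d → ℝ) : Rd d → Rd d → ℝ := fun x y => k (y - x)

/-- The support of a measure: points all of whose open neighbourhoods have positive measure. -/
def msupport {α : Type*} [TopologicalSpace α] [MeasurableSpace α] (μ : Measure α) : Set α :=
  {x | ∀ U : Set α, IsOpen U → x ∈ U → 0 < μ U}

/-- The radial cost `c(x,y) = k(|y - x|)`. -/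
def radCost {d : ℕ} (k : ℝ → ℝ) : Rd d → Rd d → ℝ := fun x y => k ‖y - x‖

/-- The distribution function of a density on the line. -/
def primIic (F : ℝ → ℝ) (t : ℝ) : ℝ := ∫ x in Iic t, F x

section primIic
variable {F : ℝ → ℝ}

lemma primIic_sub (hF : Integrable F) (a b : ℝ) :
    primIic F b - primIic F a = ∫ x in a..b, F x :=
  intervalIntegral.integral_Iic_sub_Iic hF.integrableOn hF.integrableOn

lemma primIic_eq (hF : Integrable F) (a : ℝ) :
    primIic F = fun b => primIic F a + ∫ x in a..b, F x := by
  funext b; rw [← primIic_sub hF]; ring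

lemma continuous_primIic (hF : Integrable F) : Continuous (primIic F) := by
  rw [primIic_eq hF 0]
  exact continuous_const.add
    (intervalIntegral.continuous_primitive (fun a b => hF.intervalIntegrable) 0)

lemma monotone_primIic (hF : Integrable F) (h0 : ∀ t, 0 ≤ F t) : Monotone (primIic F) := by
  intro a b hab
  have := primIic_sub hF a b
  have h2 : 0 ≤ ∫ x in a..b, F x := intervalIntegral.integral_nonneg hab (fun t _ => h0 t)
  linarith

lemma primIic_tendsto_atTop (hF : Integrable F) :
    Tendsto (primIic F) atTop (nhds (∫ x, F x)) := by
  have := tendsto_setIntegral_of_monotone (μ := volume) (f := F) (s := fun t : ℝ => Iic t)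
    (fun _ => measurableSet_Iic) (fun a b h => Iic_subset_Iic.2 h) hF.integrableOn
  rw [iUnion_Iic, setIntegral_univ] at this
  exact this

lemma primIic_ae_hasDerivAt (hF : Integrable F) : ∀ᵐ t, HasDerivAt (primIic F) (F t) t := by
  filter_upwards [LocallyIntegrable.ae_hasDerivAt_integral hF.locallyIntegrable] with t ht
  rw [primIic_eq hF 0]
  exact (ht 0).const_add _

lemma primIic_ae_eq_zero (hF : Integrable F) (h0 : ∀ t, 0 ≤ F t) {a b : ℝ} (hab : a ≤ b)
    (h : primIic F a = primIic F b) : ∀ᵐ t, t ∈ Ioc a b → F t = 0 := by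
  have h1 := primIic_sub hF a b
  rw [h, sub_self, intervalIntegral.integral_of_le hab] at h1
  have := (setIntegral_eq_zero_iff_of_nonneg_ae (ae_of_all _ h0) hF.integrableOn).1 h1.symm
  rwa [EventuallyEq, ae_restrict_iff' measurableSet_Ioc] at this

lemma primIic_nonneg (h0 : ∀ t, 0 ≤ F t) (t : ℝ) : 0 ≤ primIic F t :=
  setIntegral_nonneg measurableSet_Iic fun t _ => h0 t

lemma primIic_le (hF : Integrable F) (h0 : ∀ t, 0 ≤ F t) (t : ℝ) : primIic F t ≤ ∫ x, F x :=
  setIntegral_le_integral hF (ae_of_all _ h0)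

/-- A density vanishes almost everywhere outside the set where its distribution function is
strictly between the extreme values. -/
lemma primIic_ae_eq_zero_of_notMem (hF : Integrable F) (h0 : ∀ t, 0 ≤ F t) (h1 : ∫ x, F x = 1) :
    ∀ᵐ t, ¬ (primIic F t ∈ Ioo 0 1) → F t = 0 := by
  have key : ∀ᵐ t, ∀ p q : ℚ, (p : ℝ) ≤ q → primIic F p = primIic F q → t ∈ Ioc (p : ℝ) q →
      F t = 0 := by
    rw [ae_all_iff]; intro p
    rw [ae_all_iff]; intro q
    by_cases hpq : (p : ℝ) ≤ q
    · by_cases he : primIic F p = primIic F q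
      · filter_upwards [primIic_ae_eq_zero hF h0 hpq he] with t ht _ _ using ht
      · filter_upwards with t _ h using absurd h he
    · filter_upwards with t h using absurd h hpq
  have mono := monotone_primIic hF h0
  -- endpoints of the two level sets carry no mass
  have hnull : ∀ᵐ t, ¬ (IsGreatest {t | primIic F t = 0} t) ∧
      ¬ (IsLeast {t | primIic F t = 1} t) := by
    have a1 : ({t | IsGreatest {t | primIic F t = 0} t}).Subsingleton :=
      fun x hx y hy => hx.unique hy
    have a2 : ({t | IsLeast {t | primIic F t = 1} t}).Subsingleton :=
      fun x hx y hy => hx.unique hy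
    have b1 := measure_eq_zero_iff_ae_notMem.1 (a1.finite.measure_zero (volume : Measure ℝ))
    have b2 := measure_eq_zero_iff_ae_notMem.1 (a2.finite.measure_zero (volume : Measure ℝ))
    filter_upwards [b1, b2] with t h1 h2 using ⟨h1, h2⟩
  filter_upwards [key, hnull] with t ht hn hmem
  have hle := primIic_le hF h0 t
  rw [h1] at hle
  rcases (primIic_nonneg h0 t).eq_or_lt with h | h
  · -- not greatest
    have : ∃ t', primIic F t' = 0 ∧ t < t' := by
      by_contra hc
      push Not at hc
      exact hn.1 ⟨h.symm, fun y hy => hc y hy⟩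
    obtain ⟨t', ht', htt⟩ := this
    obtain ⟨q, hq1, hq2⟩ := exists_rat_btwn htt
    obtain ⟨p, hp1⟩ := exists_rat_lt t
    have e : ∀ x, x ≤ t' → primIic F x = 0 := fun x hx =>
      le_antisymm (ht' ▸ mono hx) (primIic_nonneg h0 x)
    exact ht p q (by linarith) (by rw [e p (by linarith), e q (by linarith)]) ⟨hp1, hq1.le⟩
  · have h1t : primIic F t = 1 := le_antisymm hle (not_lt.1 fun h' => hmem ⟨h, h'⟩)
    have : ∃ t', primIic F t' = 1 ∧ t' < t := by
      by_contra hc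
      push Not at hc
      exact hn.2 ⟨h1t, fun y hy => hc y hy⟩
    obtain ⟨t', ht', htt⟩ := this
    obtain ⟨p, hp1, hp2⟩ := exists_rat_btwn htt
    obtain ⟨q, hq1⟩ := exists_rat_gt t
    have e : ∀ x, t' ≤ x → primIic F x = 1 := fun x hx =>
      le_antisymm (h1 ▸ primIic_le hF h0 x) (ht' ▸ mono hx)
    exact ht p q (by linarith) (by rw [e p (by linarith), e q (by linarith)]) ⟨hp2, hq1.le⟩

end primIic

lemma exists_inverse_primIic {G : ℝ → ℝ} {s : ℝ} (hGc : ContinuousOn G (Ioo (-s) s)) (hG : Integrable G)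
    (hpos : ∀ t ∈ Ioo (-s) s, 0 < G t) (hzero : ∀ t, t ∉ Ioo (-s) s → G t = 0)
    (h1 : ∫ t, G t = 1) :
    ∃ Y : ℝ → ℝ, (∀ v ∈ Ioo (0 : ℝ) 1, Y v ∈ Ioo (-s) s ∧ primIic G (Y v) = v ∧
      HasDerivAt Y (G (Y v))⁻¹ v) ∧ StrictMonoOn Y (Ioo 0 1) := by
  have h0 : ∀ t, 0 ≤ G t := fun t => by
    by_cases h : t ∈ Ioo (-s) s
    · exact (hpos t h).le
    · exact (hzero t h).ge
  have hder : ∀ t ∈ Ioo (-s) s, HasDerivAt (primIic G) (G t) t := fun t ht => by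
    rw [primIic_eq hG 0]
    exact (intervalIntegral.integral_hasDerivAt_right hG.intervalIntegrable
      hG.aestronglyMeasurable.stronglyMeasurableAtFilter
      (hGc.continuousAt (Ioo_mem_nhds ht.1 ht.2))).const_add _
  have hlow : ∀ t ≤ -s, primIic G t = 0 := fun t ht => by
    rw [primIic, setIntegral_eq_zero_of_forall_eq_zero]
    intro x hx
    exact hzero x fun h => by have := h.1; have := mem_Iic.1 hx; linarith
  have hhigh : ∀ t ≥ s, primIic G t = 1 := fun t ht => by
    rw [primIic, setIntegral_eq_integral_of_forall_compl_eq_zero, h1]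
    intro x hx
    exact hzero x fun h => by have := h.2; have := not_le.1 (mt mem_Iic.2 hx); linarith
  have hcont := continuous_primIic hG
  have hmono := monotone_primIic hG h0
  have hsm : StrictMonoOn (primIic G) (Ioo (-s) s) := by
    apply strictMonoOn_of_deriv_pos (convex_Ioo _ _) hcont.continuousOn
    intro x hx
    rw [interior_Ioo] at hx
    rw [(hder x hx).deriv]; exact hpos x hx
  have hmem : ∀ τ ∈ Ioo (-s) s, primIic G τ ∈ Ioo (0 : ℝ) 1 := fun τ hτ => by
    constructor
    · have h := hsm (a := (-s + τ) / 2) (b := τ) ⟨by linarith [hτ.1], by linarith [hτ.1, hτ.2]⟩ hτ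
        (by linarith [hτ.1])
      exact (primIic_nonneg h0 _).trans_lt h
    · have h := hsm (b := (s + τ) / 2) (a := τ) hτ ⟨by linarith [hτ.1, hτ.2], by linarith [hτ.2]⟩
        (by linarith [hτ.2])
      exact h.trans_le (h1 ▸ primIic_le hG h0 _)
  have hex : ∀ v : ℝ, ∃ τ, v ∈ Ioo (0 : ℝ) 1 → τ ∈ Ioo (-s) s ∧ primIic G τ = v := fun v => by
    by_cases hv : v ∈ Ioo (0 : ℝ) 1
    · obtain ⟨τ, hτ⟩ := mem_range_of_exists_le_of_exists_ge (c := v) hcont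
        ⟨-s, by rw [hlow _ le_rfl]; exact hv.1.le⟩ ⟨s, by rw [hhigh _ le_rfl]; exact hv.2.le⟩
      refine ⟨τ, fun _ => ⟨⟨?_, ?_⟩, hτ⟩⟩
      · by_contra h; rw [hlow τ (not_lt.1 h)] at hτ; exact hv.1.ne hτ
      · by_contra h; rw [hhigh τ (not_lt.1 h)] at hτ; exact hv.2.ne hτ.symm
    · exact ⟨0, fun h => absurd h hv⟩
  choose Y hY using hex
  have hYm : StrictMonoOn Y (Ioo 0 1) := by
    intro v hv w hw hvw
    by_contra h
    have := hmono (not_lt.1 h)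
    rw [(hY v hv).2, (hY w hw).2] at this
    linarith
  have hYinv : ∀ τ ∈ Ioo (-s) s, Y (primIic G τ) = τ := fun τ hτ =>
    hsm.injOn (hY _ (hmem τ hτ)).1 hτ (hY _ (hmem τ hτ)).2
  refine ⟨Y, fun v hv => ⟨(hY v hv).1, (hY v hv).2, ?_⟩, hYm⟩
  refine HasDerivAt.of_local_left_inverse ?_ (hder _ (hY v hv).1) (hpos _ (hY v hv).1).ne' ?_
  · apply hYm.continuousAt_of_image_mem_nhds (Ioo_mem_nhds hv.1 hv.2)
    have : Ioo (-s) s ⊆ Y '' Ioo 0 1 := fun τ hτ => ⟨_, hmem τ hτ, hYinv τ hτ⟩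
    exact mem_of_superset (Ioo_mem_nhds (hY v hv).1.1 (hY v hv).1.2) this
  · filter_upwards [Ioo_mem_nhds hv.1 hv.2] with w hw using (hY w hw).2

lemma weighted_ineq {f g l : ℝ} (hf : 0 ≤ f) (hg : 0 < g) (hl0 : 0 < l) (hl1 : l < 1) :
    f ≤ (1 - l + l * (f / g)) * (f ^ (1 - l) * g ^ l) ∧
    ((1 - l + l * (f / g)) * (f ^ (1 - l) * g ^ l) = f → 0 < f → f = g) := by
  rcases hf.eq_or_lt with h | h
  · subst h
    rw [Real.zero_rpow (by linarith)]
    simp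
  have hq : 0 < f / g := div_pos h hg
  have e : f = (f / g) ^ l * (f ^ (1 - l) * g ^ l) := by
    rw [Real.div_rpow h.le hg.le]
    have : g ^ l ≠ 0 := (Real.rpow_pos_of_pos hg l).ne'
    field_simp
    rw [← Real.rpow_add h]
    simp
  have hp : 0 < f ^ (1 - l) * g ^ l := mul_pos (Real.rpow_pos_of_pos h _) (Real.rpow_pos_of_pos hg _)
  have key : f / g ≠ 1 → (f / g) ^ l < 1 - l + l * (f / g) := fun hne => by
    have := rpow_one_add_lt_one_add_mul_self (s := f / g - 1) (by linarith) (sub_ne_zero.2 hne)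
      hl0 hl1
    rw [add_sub_cancel] at this
    linarith
  by_cases h1 : f / g = 1
  · have : f = g := by field_simp at h1; exact h1
    refine ⟨?_, fun _ _ => this⟩
    conv_lhs => rw [e]
    rw [h1]; simp
  · have := mul_lt_mul_of_pos_right (key h1) hp
    rw [← e] at this
    exact ⟨this.le, fun h => absurd h (ne_of_gt this)⟩

/-- One-dimensional Prékopa–Leindler inequality against a compactly supported continuous density,
with the equality case. -/
theorem prekopa_leindler_line {F G : ℝ → ℝ} {H : ℝ → ℝ≥0∞} {s l : ℝ}
    (hFi : Integrable F) (hF0 : ∀ t, 0 ≤ F t) (hF1 : ∫ t, F t = 1)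
    (hGc : ContinuousOn G (Ioo (-s) s)) (hGm : Measurable G) (hGi : Integrable G)
    (hpos : ∀ t ∈ Ioo (-s) s, 0 < G t) (hzero : ∀ t, t ∉ Ioo (-s) s → G t = 0)
    (hG1 : ∫ t, G t = 1) (hH : Measurable H) (hl0 : 0 < l) (hl1 : l < 1)
    (hFGH : ∀ t τ, ENNReal.ofReal (F t ^ (1 - l) * G τ ^ l) ≤ H ((1 - l) * t + l * τ)) :
    1 ≤ ∫⁻ t, H t ∧ (∫⁻ t, H t ≤ 1 → ∃ c, ∀ᵐ t, F t ≤ G (t - c)) := by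
  obtain ⟨Y, hY, hYm⟩ := exists_inverse_primIic hGc hGi hpos hzero hG1
  have hcont := continuous_primIic hFi
  have hmono := monotone_primIic hFi hF0
  set Φ := primIic F with hΦ
  set J := Φ ⁻¹' Ioo 0 1 with hJ
  have hJo : IsOpen J := isOpen_Ioo.preimage hcont
  set S := fun t => Y (Φ t) with hS
  set z := fun t => (1 - l) * t + l * S t with hz
  have hSm : MonotoneOn S J := fun a ha b hb hab => by
    rcases (hmono hab).eq_or_lt with h | h
    · simp only [hS, h, le_refl]
    · exact (hYm ha hb h).le
  have hzm : StrictMonoOn z J := fun a ha b hb hab => by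
    have := hSm ha hb hab.le
    simp only [hz]
    nlinarith
  obtain ⟨N, hNs, hNm, hN0⟩ : ∃ N, {t | ¬ HasDerivAt Φ (F t) t} ⊆ N ∧ MeasurableSet N ∧
      volume N = 0 := by
    have := primIic_ae_hasDerivAt hFi
    rw [ae_iff] at this
    exact exists_measurable_superset_of_null this
  set A := J ∩ Nᶜ with hA
  have hAm : MeasurableSet A := hJo.measurableSet.inter hNm.compl
  have hAJ : A =ᵐ[volume] J := by
    have : ∀ᵐ t, t ∉ N := measure_eq_zero_iff_ae_notMem.1 hN0
    filter_upwards [this] with t ht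
    apply propext
    exact ⟨fun h => h.1, fun h => ⟨h, ht⟩⟩
  have hGpos : ∀ t ∈ J, 0 < G (S t) := fun t ht => hpos _ (hY _ ht).1
  set z' := fun t => (1 - l) + l * (F t / G (S t)) with hz'
  have hder : ∀ t ∈ A, HasDerivAt z (z' t) t := fun t ht => by
    have h1 : HasDerivAt Φ (F t) t := by
      by_contra h; exact ht.2 (hNs h)
    have h2 : HasDerivAt S ((G (S t))⁻¹ * F t) t := (hY _ ht.1).2.2.comp t h1
    have h3 := ((hasDerivAt_id t).const_mul (1 - l)).add (h2.const_mul l)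
    refine h3.congr_deriv ?_
    simp only [hz']
    ring
  have hz'0 : ∀ t ∈ J, 0 < z' t := fun t ht => by
    have := div_nonneg (hF0 t) (hGpos t ht).le
    simp only [hz']; nlinarith
  have hcv := lintegral_image_eq_lintegral_abs_deriv_mul hAm
    (fun t ht => (hder t ht).hasDerivWithinAt) (hzm.injOn.mono inter_subset_left) H
  have hpt : ∀ t ∈ A, ENNReal.ofReal (z' t * (F t ^ (1 - l) * G (S t) ^ l)) ≤
      ENNReal.ofReal |z' t| * H (z t) := fun t ht => by
    rw [abs_of_pos (hz'0 t ht.1), ENNReal.ofReal_mul (hz'0 t ht.1).le]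
    gcongr
    exact hFGH t (S t)
  have hpt2 : ∀ t ∈ A, ENNReal.ofReal (F t) ≤ ENNReal.ofReal |z' t| * H (z t) := fun t ht =>
    (ENNReal.ofReal_le_ofReal (weighted_ineq (hF0 t) (hGpos t ht.1) hl0 hl1).1).trans (hpt t ht)
  have hoff := primIic_ae_eq_zero_of_notMem hFi hF0 hF1
  have hFA : ∫⁻ t in A, ENNReal.ofReal (F t) = 1 := by
    rw [setLIntegral_congr hAJ, ← lintegral_indicator hJo.measurableSet]
    have : (J.indicator fun t => ENNReal.ofReal (F t)) =ᵐ[volume] fun t => ENNReal.ofReal (F t) := by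
      filter_upwards [hoff] with t ht
      by_cases h : t ∈ J
      · rw [indicator_of_mem h]
      · rw [indicator_of_notMem h, ht h, ENNReal.ofReal_zero]
    rw [lintegral_congr_ae this, ← ofReal_integral_eq_lintegral_ofReal hFi (ae_of_all _ hF0), hF1,
      ENNReal.ofReal_one]
  have hle1 : 1 ≤ ∫⁻ t in A, ENNReal.ofReal |z' t| * H (z t) := by
    rw [← hFA]; exact setLIntegral_mono' hAm hpt2
  have hle2 : ∫⁻ t in A, ENNReal.ofReal |z' t| * H (z t) ≤ ∫⁻ t, H t := by
    rw [← hcv]; exact setLIntegral_le_lintegral _ _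
  refine ⟨hle1.trans hle2, fun hH1 => ?_⟩
  have hScont : ContinuousOn S J := fun t ht =>
    ((hY _ ht).2.2.continuousAt.comp hcont.continuousAt).continuousWithinAt
  -- almost everywhere equality of the integrands
  have heq : ∀ᵐ t, t ∈ A → ENNReal.ofReal (F t) = ENNReal.ofReal |z' t| * H (z t) := by
    rw [← ae_restrict_iff' hAm]
    refine ae_eq_of_ae_le_of_lintegral_le ((ae_restrict_iff' hAm).2 (ae_of_all _ hpt2))
      (by rw [hFA]; exact one_ne_top) ?_ (by rw [hFA]; exact hle2.trans hH1)
    have hSA : AEMeasurable S (volume.restrict A) :=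
      (hScont.mono inter_subset_left).aemeasurable hAm
    have hz'A : AEMeasurable z' (volume.restrict A) :=
      ((hFi.aemeasurable.restrict.div (hGm.comp_aemeasurable hSA)).const_mul l).const_add
        (1 - l)
    have hzA : AEMeasurable z (volume.restrict A) :=
      (measurable_id.aemeasurable.const_mul _).add (hSA.const_mul _)
    exact (ENNReal.measurable_ofReal.comp_aemeasurable (hz'A.norm)).mul (hH.comp_aemeasurable hzA)
  have heq2 : ∀ᵐ t, t ∈ J → (0 < F t ∧ F t = G (S t)) ∨ (F t = 0 ∧ H (z t) = 0) := by
    filter_upwards [heq, hAJ.mem_iff] with t ht hJt htJ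
    have htA := hJt.2 htJ
    have h := ht htA
    rcases (hF0 t).eq_or_lt with h0 | h0
    · right
      refine ⟨h0.symm, ?_⟩
      rw [← h0, ENNReal.ofReal_zero, eq_comm, mul_eq_zero, ENNReal.ofReal_eq_zero] at h
      rcases h with h | h
      · have := hz'0 t htJ
        exact absurd h (not_le.2 (abs_pos.2 this.ne'))
      · exact h
    · left
      refine ⟨h0, (weighted_ineq h0.le (hGpos t htJ) hl0 hl1).2 (le_antisymm ?_ ?_) h0⟩
      · have := hpt t htA
        rw [← h] at this
        exact (ENNReal.ofReal_le_ofReal_iff h0.le).1 this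
      · exact (weighted_ineq h0.le (hGpos t htJ) hl0 hl1).1
  have hgap : ∀ t ∈ J, H (z t) = 0 → ∀ t', |t' - t| < l / (1 - l) * (s - |S t|) → F t' = 0 := by
    intro t ht hHz t' ht'
    have hl : 0 < 1 - l := by linarith
    set τ := S t - (1 - l) / l * (t' - t) with hτ
    have h1 : |τ - S t| < s - |S t| := by
      have : τ - S t = - ((1 - l) / l * (t' - t)) := by rw [hτ]; ring
      rw [this, abs_neg, abs_mul, abs_of_pos (by positivity)]
      calc (1 - l) / l * |t' - t| < (1 - l) / l * (l / (1 - l) * (s - |S t|)) := by gcongr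
        _ = s - |S t| := by field_simp
    have h2 : τ ∈ Ioo (-s) s := by
      rw [mem_Ioo, ← abs_lt]
      have := abs_sub_abs_le_abs_sub τ (S t)
      linarith
    have h3 := hFGH t' τ
    have h4 : (1 - l) * t' + l * τ = z t := by
      simp only [hτ, hz]; field_simp; ring
    rw [h4, hHz, nonpos_iff_eq_zero, ENNReal.ofReal_eq_zero] at h3
    have h5 : 0 < G τ ^ l := Real.rpow_pos_of_pos (hpos _ h2) _
    by_contra hne
    have h6 : 0 < F t' ^ (1 - l) := Real.rpow_pos_of_pos ((hF0 t').lt_of_ne' hne) _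
    exact absurd h3 (not_le.2 (mul_pos h6 h5))
  have hgapΦ : ∀ a b, a ≤ b → (∀ t ∈ Ioo a b, F t = 0) → Φ a = Φ b := by
    intro a b hab h
    have h1 := primIic_sub hFi a b
    rw [intervalIntegral.integral_of_le hab, setIntegral_congr_set Ioo_ae_eq_Ioc.symm,
      setIntegral_eq_zero_of_forall_eq_zero h] at h1
    linarith
  -- the second alternative never happens
  have hno : ∀ t ∈ J, ¬ (H (z t) = 0) := by
    intro t ht hHt
    set δ := l / (1 - l) * (s - |S t|) with hδ
    have hδ0 : 0 < δ := by
      have := abs_lt.2 ⟨(hY _ ht).1.1, (hY _ ht).1.2⟩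
      have h2 : 0 < 1 - l := by linarith
      have h3 : 0 < s - |S t| := by simp only [hS]; linarith
      positivity
    set L := {x | Φ x = Φ t} with hL
    have hLc : IsClosed L := isClosed_eq hcont continuous_const
    have hLb : BddAbove L := by
      have := (primIic_tendsto_atTop hFi).eventually (lt_mem_nhds (hF1 ▸ ht.2))
      obtain ⟨M, hM⟩ := this.exists
      refine ⟨M, fun x hx => ?_⟩
      by_contra h
      have := hmono (not_le.1 h).le
      rw [show Φ x = Φ t from hx] at this
      exact absurd this (not_le.2 hM)
    set b := sSup L with hb
    have hbL : b ∈ L := hLc.csSup_mem ⟨t, rfl⟩ hLb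
    have htb : t + δ ≤ b := by
      refine le_csSup hLb (Eq.symm (hgapΦ t (t + δ) (by linarith) fun y hy => ?_))
      refine hgap t ht hHt y ?_
      rw [abs_lt]; constructor <;> linarith [hy.1, hy.2]
    have hconst : ∀ x ∈ Icc t b, Φ x = Φ t := fun x hx =>
      le_antisymm (hbL ▸ hmono hx.2) (hmono hx.1)
    have hzero := primIic_ae_eq_zero hFi hF0 (show t ≤ b by linarith) (show Φ t = Φ b from hbL.symm)
    have hex : ∃ x ∈ Ioo (b - δ) b, t < x ∧ H (z x) = 0 := by
      have hpos : volume (Ioo (b - δ) b) ≠ 0 := by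
        simp [hδ0]
      by_contra hc
      push Not at hc
      apply hpos
      rw [measure_eq_zero_iff_ae_notMem]
      filter_upwards [hzero, heq2] with x hx hx2 hxm
      have htx : t < x := by linarith [hxm.1]
      have h1 : F x = 0 := hx ⟨htx, hxm.2.le⟩
      have h2 : x ∈ J := by
        have := hconst x ⟨htx.le, hxm.2.le⟩
        rw [hJ, mem_preimage, this]; exact ht
      rcases hx2 h2 with h3 | h3
      · linarith
      · exact hc x hxm htx h3.2
    obtain ⟨x, hxm, htx, hHx⟩ := hex
    have hΦx := hconst x ⟨htx.le, hxm.2.le⟩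
    have hxJ : x ∈ J := by rw [hJ, mem_preimage, hΦx]; exact ht
    have hSx : S x = S t := by simp only [hS, hΦx]
    have h1 := hgap x hxJ hHx
    rw [hSx] at h1
    have h2 := hgapΦ x (x + δ) (by linarith) fun y hy => h1 y (by
      rw [abs_lt]; constructor <;> linarith [hy.1, hy.2])
    have h3 : x + δ ≤ b := le_csSup hLb (show Φ (x + δ) = Φ t by rw [← h2, hΦx])
    linarith [hxm.1]
  have hFG : ∀ᵐ t, t ∈ J → F t = G (S t) := by
    filter_upwards [heq2] with t ht htJ
    rcases ht htJ with h | h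
    · exact h.2
    · exact absurd h.2 (hno t htJ)
  have hJc : OrdConnected J := by
    constructor
    intro a ha b hb x hx
    exact ⟨ha.1.trans_le (hmono hx.1), (hmono hx.2).trans_lt hb.2⟩
  have hΦder : ∀ t ∈ J, HasDerivAt Φ (G (S t)) t := by
    intro t ht
    have hK : F =ᵐ[volume] J.indicator fun t => G (S t) := by
      filter_upwards [hoff, hFG] with x h1 h2
      by_cases h : x ∈ J
      · rw [h2 h, indicator_of_mem h]
      · rw [h1 h, indicator_of_notMem h]
    have hKi := hFi.congr hK
    have hΦK : Φ = primIic (J.indicator fun t => G (S t)) := by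
      funext x
      exact integral_congr_ae (ae_restrict_of_ae hK)
    rw [hΦK, primIic_eq hKi 0]
    have hev : (J.indicator fun t => G (S t)) =ᶠ[nhds t] fun t => G (S t) := by
      filter_upwards [hJo.mem_nhds ht] with x hx using indicator_of_mem hx _
    have hKc : ContinuousAt (J.indicator fun t => G (S t)) t :=
      (ContinuousAt.comp (f := S) (g := G)
        (hGc.continuousAt (Ioo_mem_nhds (hY _ ht).1.1 (hY _ ht).1.2))
        (hScont.continuousAt (hJo.mem_nhds ht))).congr hev.symm
    have := (intervalIntegral.integral_hasDerivAt_right (hKi.intervalIntegrable (a := 0) (b := t))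
      hKi.aestronglyMeasurable.stronglyMeasurableAtFilter hKc).const_add
        (primIic (J.indicator fun t => G (S t)) 0)
    rwa [indicator_of_mem ht] at this
  have hSder : ∀ t ∈ J, HasDerivAt S 1 t := fun t ht => by
    refine ((hY _ ht).2.2.comp t (hΦder t ht)).congr_deriv ?_
    exact inv_mul_cancel₀ (hGpos t ht).ne'
  have hc : ∃ c, ∀ t ∈ J, S t = t - c := by
    rcases J.eq_empty_or_nonempty with h | ⟨t0, ht0⟩
    · exact ⟨0, by simp [h]⟩
    refine ⟨t0 - S t0, fun t ht => ?_⟩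
    have hd : ∀ t ∈ J, HasDerivAt (fun t => S t - t) 0 t := fun t ht => by
      have := (hSder t ht).sub (hasDerivAt_id t)
      rw [sub_self] at this
      exact this
    have := hJo.is_const_of_deriv_eq_zero hJc.isPreconnected
      (fun t ht => (hd t ht).differentiableAt.differentiableWithinAt)
      (fun t ht => (hd t ht).deriv) ht ht0
    linarith
  obtain ⟨c, hc⟩ := hc
  refine ⟨c, ?_⟩
  have hG0 : ∀ t, 0 ≤ G t := fun t => by
    by_cases h : t ∈ Ioo (-s) s
    · exact (hpos t h).le
    · exact (hzero t h).ge
  filter_upwards [hoff, hFG] with t h1 h2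
  by_cases h : t ∈ J
  · rw [h2 h, hc t h]
  · rw [h1 h]; exact hG0 _

/-- The slice of a subset of `ℝ^(n+1)` at height `t` of the `i`-th coordinate. -/
def slice {n : ℕ} (i : Fin (n + 1)) (E : Set (Fin (n + 1) → ℝ)) (t : ℝ) : Set (Fin n → ℝ) :=
  {y | i.insertNth t y ∈ E}

/-- The open ball of squared radius `q` in coordinates. -/
def sqBall (n : ℕ) (q : ℝ) : Set (Fin n → ℝ) := {x | ∑ i, x i ^ 2 < q}

section slice
variable {n : ℕ} (i : Fin (n + 1)) {E : Set (Fin (n + 1) → ℝ)}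

lemma measurable_insertNth :
    Measurable fun p : ℝ × (Fin n → ℝ) => (i.insertNth p.1 p.2 : Fin (n + 1) → ℝ) :=
  (MeasurableEquiv.piFinSuccAbove (fun _ => ℝ) i).symm.measurable

lemma measurableSet_slice (hE : MeasurableSet E) (t : ℝ) : MeasurableSet (slice i E t) :=
  (measurable_insertNth i).comp measurable_prodMk_left hE

lemma measurable_volume_slice (hE : MeasurableSet E) : Measurable fun t => volume (slice i E t) :=
  measurable_measure_prodMk_left (measurable_insertNth i hE)

lemma setLIntegral_coord (hE : MeasurableSet E) {φ : ℝ → ℝ≥0∞} (hφ : Measurable φ) :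
    ∫⁻ x in E, φ (x i) = ∫⁻ t, φ t * volume (slice i E t) := by
  have hmp := (volume_preserving_piFinSuccAbove (fun _ : Fin (n + 1) => ℝ) i).symm
  rw [← lintegral_indicator hE, ← hmp.lintegral_comp_emb (MeasurableEquiv.measurableEmbedding _),
    Measure.volume_eq_prod, lintegral_prod]
  · refine lintegral_congr fun t => ?_
    have : ∀ y : Fin n → ℝ, E.indicator (fun x => φ (x i))
        ((MeasurableEquiv.piFinSuccAbove (fun _ => ℝ) i).symm (t, y)) =
        (slice i E t).indicator (fun _ => φ t) y := fun y => by
      have e : (MeasurableEquiv.piFinSuccAbove (fun _ => ℝ) i).symm (t, y) =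
        (i.insertNth t y : Fin (n + 1) → ℝ) := rfl
      rw [e]
      by_cases h : (i.insertNth t y : Fin (n + 1) → ℝ) ∈ E
      · rw [indicator_of_mem h, indicator_of_mem (show y ∈ slice i E t from h)]
        simp
      · rw [indicator_of_notMem h, indicator_of_notMem (show y ∉ slice i E t from h)]
    simp_rw [this]
    rw [lintegral_indicator (measurableSet_slice i hE t), setLIntegral_const]
  · exact (((hφ.comp (measurable_pi_apply i)).indicator hE).comp
      (MeasurableEquiv.measurable _)).aemeasurable

lemma volume_eq_lintegral_slice (hE : MeasurableSet E) :
    volume E = ∫⁻ t, volume (slice i E t) := by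
  simpa using setLIntegral_coord i hE (φ := fun _ => 1) measurable_const

lemma slice_sqBall (q t : ℝ) : slice i (sqBall (n + 1) q) t = sqBall n (q - t ^ 2) := by
  ext y
  simp only [slice, sqBall, mem_ofPred_eq, Fin.sum_univ_succAbove _ i, Fin.insertNth_apply_same,
    Fin.insertNth_apply_succAbove]
  constructor <;> intro h <;> linarith

end slice

section sqBall
variable (n : ℕ)

lemma isOpen_sqBall (q : ℝ) : IsOpen (sqBall n q) :=
  isOpen_lt (by fun_prop) continuous_const

lemma sqBall_eq_empty {q : ℝ} (hq : q ≤ 0) : sqBall n q = ∅ := by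
  ext x
  simp only [sqBall, mem_ofPred_eq, mem_empty_iff_false, iff_false, not_lt]
  exact hq.trans (Finset.sum_nonneg fun i _ => sq_nonneg _)

lemma zero_mem_sqBall {q : ℝ} (hq : 0 < q) : (0 : Fin n → ℝ) ∈ sqBall n q := by
  simp [sqBall, hq]

lemma volume_sqBall_pos {q : ℝ} (hq : 0 < q) : 0 < volume (sqBall n q) :=
  (isOpen_sqBall n q).measure_pos _ ⟨0, zero_mem_sqBall n hq⟩

lemma volume_sqBall_lt_top (q : ℝ) : volume (sqBall n q) < ∞ := by
  refine Bornology.IsBounded.measure_lt_top ?_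
  refine (Metric.isBounded_closedBall (x := (0 : Fin n → ℝ)) (r := |q| + 1)).subset fun x hx => ?_
  rw [mem_closedBall_zero_iff, pi_norm_le_iff_of_nonneg (by positivity)]
  intro i
  have h1 : x i ^ 2 ≤ ∑ j, x j ^ 2 :=
    Finset.single_le_sum (f := fun j => x j ^ 2) (fun j _ => sq_nonneg _) (Finset.mem_univ i)
  have h2 : ∑ j, x j ^ 2 < q := hx
  rw [Real.norm_eq_abs]
  nlinarith [sq_abs (x i), le_abs_self q, abs_nonneg (x i), sq_nonneg (|x i| - 1)]

open Pointwise in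
lemma sqBall_eq_smul {q : ℝ} (hq : 0 < q) : sqBall n q = √q • sqBall n 1 := by
  have h := Real.sqrt_pos.2 hq
  ext x
  rw [mem_smul_set_iff_inv_smul_mem₀ h.ne']
  simp only [sqBall, mem_ofPred_eq, Pi.smul_apply, smul_eq_mul, mul_pow, ← Finset.mul_sum, inv_pow,
    Real.sq_sqrt hq.le]
  rw [inv_mul_lt_iff₀ hq, mul_one]

open Pointwise in
lemma volumeReal_sqBall {q : ℝ} (hq : 0 < q) :
    volume.real (sqBall n q) = √q ^ n * volume.real (sqBall n 1) := by
  rw [sqBall_eq_smul n hq, measureReal_def, Measure.addHaar_smul, ENNReal.toReal_mul,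
    ENNReal.toReal_ofReal (abs_nonneg _), Module.finrank_fin_fun, abs_of_nonneg (by positivity)]
  rfl

lemma volumeReal_sqBall_pos {q : ℝ} (hq : 0 < q) : 0 < volume.real (sqBall n q) :=
  ENNReal.toReal_pos (volume_sqBall_pos n hq).ne' (volume_sqBall_lt_top n q).ne

end sqBall

/-- Multiplicative Brunn–Minkowski inequality against a ball, as a property of the dimension. -/
def BrunnMinkowskiBall (n : ℕ) : Prop :=
  ∀ (l q : ℝ) (E C : Set (Fin n → ℝ)), 0 < l → l < 1 → 0 < q → MeasurableSet E → MeasurableSet C →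
    volume E ≠ ∞ → (∀ x ∈ E, ∀ y ∈ sqBall n q, (1 - l) • x + l • y ∈ C) →
    ENNReal.ofReal (volume.real E ^ (1 - l) * volume.real (sqBall n q) ^ l) ≤ volume C

lemma brunnMinkowskiBall_zero : BrunnMinkowskiBall 0 := by
  intro l q E C hl0 hl1 hq hE hC hEf hsub
  rcases E.eq_empty_or_nonempty with h | ⟨x, hx⟩
  · rw [h, measureReal_empty, Real.zero_rpow (by linarith)]; simp
  · have hC' : C = univ := by
      have := hsub x hx 0 (zero_mem_sqBall 0 hq)
      ext y
      rw [Subsingleton.elim y]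
      simpa using this
    have hle : ∀ A : Set (Fin 0 → ℝ), volume.real A ≤ 1 := fun A => by
      have : IsProbabilityMeasure (volume : Measure (Fin 0 → ℝ)) := by
        rw [Measure.volume_pi_eq_dirac]; infer_instance
      exact measureReal_le_one
    rw [hC', Measure.volume_pi_eq_dirac, measure_univ, ← ENNReal.ofReal_one]
    apply ENNReal.ofReal_le_ofReal
    rw [← one_mul (1 : ℝ)]
    rw [← Measure.volume_pi_eq_dirac]
    gcongr
    · exact Real.rpow_le_one measureReal_nonneg (hle E) (by linarith)
    · exact Real.rpow_le_one measureReal_nonneg (hle _) hl0.le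

lemma brunnMinkowskiBall_succ {n : ℕ} (hn : BrunnMinkowskiBall n) (i : Fin (n + 1))
    {l s : ℝ} {E C : Set (Fin (n + 1) → ℝ)} (hl0 : 0 < l) (hl1 : l < 1) (hs : 0 < s)
    (hE : MeasurableSet E) (hC : MeasurableSet C) (hE0 : 0 < volume.real E)
    (hsub : ∀ x ∈ E, ∀ y ∈ sqBall (n + 1) (s ^ 2), (1 - l) • x + l • y ∈ C) :
    ENNReal.ofReal (volume.real E ^ (1 - l) * volume.real (sqBall (n + 1) (s ^ 2)) ^ l) ≤ volume C ∧
    (volume C ≤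
        ENNReal.ofReal (volume.real E ^ (1 - l) * volume.real (sqBall (n + 1) (s ^ 2)) ^ l) →
      ∃ c, ∀ᵐ t, volume.real (slice i E t) / volume.real E ≤
        volume.real (sqBall n (s ^ 2 - (t - c) ^ 2)) / volume.real (sqBall (n + 1) (s ^ 2))) := by
  set α := volume.real E with hα
  set β := volume.real (sqBall (n + 1) (s ^ 2)) with hβ
  have hβ0 : 0 < β := volumeReal_sqBall_pos _ (by positivity)
  have hEf : volume E ≠ ∞ := fun h => by
    rw [hα, measureReal_def, h, ENNReal.toReal_top] at hE0; exact lt_irrefl _ hE0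
  set F : ℝ → ℝ := fun t => volume.real (slice i E t) / α with hF
  set G : ℝ → ℝ := fun t => volume.real (sqBall n (s ^ 2 - t ^ 2)) / β with hG
  set K := α ^ (1 - l) * β ^ l with hK
  have hK0 : 0 < K := mul_pos (Real.rpow_pos_of_pos hE0 _) (Real.rpow_pos_of_pos hβ0 _)
  set H : ℝ → ℝ≥0∞ := fun t => volume (slice i C t) / ENNReal.ofReal K with hH
  have hEs := volume_eq_lintegral_slice i hE
  have hBm := (isOpen_sqBall (n + 1) (s ^ 2)).measurableSet
  have hBs := volume_eq_lintegral_slice i hBm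
  have hBt := (volume_sqBall_lt_top (n + 1) (s ^ 2)).ne
  have hCs := volume_eq_lintegral_slice i hC
  have hEfin : ∀ᵐ t, volume (slice i E t) < ∞ :=
    ae_lt_top (measurable_volume_slice i hE) (hEs ▸ hEf)
  have hFi : Integrable F := by
    apply Integrable.div_const
    exact integrable_toReal_of_lintegral_ne_top (measurable_volume_slice i hE).aemeasurable
      (hEs ▸ hEf)
  have hGeq : ∀ t, G t = volume.real (slice i (sqBall (n + 1) (s ^ 2)) t) / β := fun t => by
    rw [slice_sqBall]
  have hGm : Measurable G := by
    rw [funext hGeq]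
    exact (measurable_volume_slice i hBm).ennreal_toReal.div_const _
  have hGi : Integrable G := by
    rw [funext hGeq]
    apply Integrable.div_const
    exact integrable_toReal_of_lintegral_ne_top (measurable_volume_slice i hBm).aemeasurable
      (hBs ▸ hBt)
  have hF1 : ∫ t, F t = 1 := by
    simp only [hF, measureReal_def]
    rw [integral_div, integral_toReal (measurable_volume_slice i hE).aemeasurable hEfin, ← hEs]
    exact div_self hE0.ne'
  have hG1 : ∫ t, G t = 1 := by
    simp only [hGeq, measureReal_def]
    rw [integral_div, integral_toReal (measurable_volume_slice i hBm).aemeasurable, ← hBs]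
    · exact div_self hβ0.ne'
    · exact ae_lt_top (measurable_volume_slice i hBm) (hBs ▸ hBt)
  have hmemiff : ∀ t, t ∈ Ioo (-s) s ↔ 0 < s ^ 2 - t ^ 2 := fun t => by
    rw [mem_Ioo, ← abs_lt, sub_pos, sq_lt_sq, abs_of_pos hs]
  have hGc : ContinuousOn G (Ioo (-s) s) := by
    have : ContinuousOn (fun t : ℝ => √(s ^ 2 - t ^ 2) ^ n * volume.real (sqBall n 1) / β)
      (Ioo (-s) s) := by fun_prop
    refine this.congr fun t ht => ?_
    simp only [hG]
    rw [volumeReal_sqBall n ((hmemiff t).1 ht)]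
  have hpos : ∀ t ∈ Ioo (-s) s, 0 < G t := fun t ht =>
    div_pos (volumeReal_sqBall_pos n ((hmemiff t).1 ht)) hβ0
  have hzero : ∀ t, t ∉ Ioo (-s) s → G t = 0 := fun t ht => by
    simp only [hG]
    rw [sqBall_eq_empty n (not_lt.1 (mt (hmemiff t).2 ht))]; simp
  have hHm : Measurable H := (measurable_volume_slice i hC).div_const _
  have hHint : ∫⁻ t, H t = volume C / ENNReal.ofReal K := by
    simp only [hH, div_eq_mul_inv]
    rw [lintegral_mul_const _ (measurable_volume_slice i hC), ← hCs]
  have hFGH : ∀ t τ, ENNReal.ofReal (F t ^ (1 - l) * G τ ^ l) ≤ H ((1 - l) * t + l * τ) := by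
    intro t τ
    by_cases hτ : τ ∈ Ioo (-s) s
    swap
    · rw [hzero τ hτ, Real.zero_rpow hl0.ne']; simp
    by_cases hft : volume (slice i E t) = ∞
    · have : F t = 0 := by simp [hF, measureReal_def, hft]
      rw [this, Real.zero_rpow (by linarith)]; simp
    have h1 := hn l (s ^ 2 - τ ^ 2) (slice i E t) (slice i C ((1 - l) * t + l * τ)) hl0 hl1
      ((hmemiff τ).1 hτ) (measurableSet_slice i hE t) (measurableSet_slice i hC _) hft (by
        intro x hx y hy
        have hy' : (i.insertNth τ y : Fin (n + 1) → ℝ) ∈ sqBall (n + 1) (s ^ 2) := by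
          rw [← slice_sqBall i] at hy; exact hy
        have := hsub _ hx _ hy'
        have e : (i.insertNth ((1 - l) * t + l * τ) ((1 - l) • x + l • y) : Fin (n + 1) → ℝ) =
            (1 - l) • (i.insertNth t x : Fin (n + 1) → ℝ) +
              l • (i.insertNth τ y : Fin (n + 1) → ℝ) := by
          funext j
          refine Fin.succAboveCases i ?_ (fun j => ?_) j <;> simp
        show _ ∈ C
        rw [e]; exact this)
    simp only [hH]
    rw [ENNReal.le_div_iff_mul_le (Or.inl (ENNReal.ofReal_pos.2 hK0).ne') (Or.inl ofReal_ne_top),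
      ← ENNReal.ofReal_mul (by positivity)]
    refine le_trans (le_of_eq ?_) h1
    congr 1
    simp only [hF, hG, hK]
    rw [Real.div_rpow measureReal_nonneg hE0.le, Real.div_rpow measureReal_nonneg hβ0.le]
    have := (Real.rpow_pos_of_pos hE0 (1 - l)).ne'
    have := (Real.rpow_pos_of_pos hβ0 l).ne'
    field_simp
  have hF0 : ∀ t, 0 ≤ F t := fun t => div_nonneg measureReal_nonneg hE0.le
  obtain ⟨r1, r2⟩ := prekopa_leindler_line hFi hF0 hF1 hGc hGm hGi hpos hzero hG1 hHm hl0 hl1 hFGH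
  have hKe : ENNReal.ofReal K ≠ 0 := (ENNReal.ofReal_pos.2 hK0).ne'
  constructor
  · rw [hHint, ENNReal.le_div_iff_mul_le (Or.inl hKe) (Or.inl ofReal_ne_top), one_mul] at r1
    exact r1
  · intro h
    apply r2
    rw [hHint]
    exact ENNReal.div_le_of_le_mul (by rwa [one_mul])

theorem brunnMinkowskiBall (n : ℕ) : BrunnMinkowskiBall n := by
  induction n with
  | zero => exact brunnMinkowskiBall_zero
  | succ n ih =>
    intro l q E C hl0 hl1 hq hE hC hEf hsub
    rcases (measureReal_nonneg (μ := volume) (s := E)).eq_or_lt with h | h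
    · rw [← h, Real.zero_rpow (by linarith)]; simp
    · have hq' := Real.sq_sqrt hq.le
      rw [← hq'] at hsub ⊢
      exact (brunnMinkowskiBall_succ ih 0 hl0 hl1 (Real.sqrt_pos.2 hq) hE hC h hsub).1

/-- Uniqueness in the bathtub principle: a sublevel set is the only set of its measure with
minimal integral. -/
lemma ae_eq_of_setLIntegral_le_sublevel {X : Type*} [MeasurableSpace X] {μ : Measure X}
    {h : X → ℝ≥0∞} (hh : Measurable h) {q : ℝ≥0∞} (hq : q ≠ ∞) {E : Set X} (hE : MeasurableSet E)
    (hfin : μ {x | h x < q} ≠ ∞) (hEB : μ E = μ {x | h x < q})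
    (hle : ∫⁻ x in E, h x ∂μ ≤ ∫⁻ x in {x | h x < q}, h x ∂μ) : E =ᵐ[μ] {x | h x < q} := by
  set B := {x | h x < q} with hB
  have hBm : MeasurableSet B := measurableSet_lt hh measurable_const
  have hfinE : μ E ≠ ∞ := hEB ▸ hfin
  have hdiff : μ (E \ B) = μ (B \ E) := by
    have h1 := measure_sdiff_add_inter E hBm (μ := μ)
    have h2 := measure_sdiff_add_inter B hE (μ := μ)
    rw [inter_comm] at h2
    have h3 : μ (E ∩ B) ≠ ∞ := ne_top_of_le_ne_top hfin (measure_mono inter_subset_right)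
    exact (ENNReal.add_left_inj h3).1 (by rw [h1, h2, hEB])
  have hIB : ∫⁻ x in B, h x ∂μ ≠ ∞ := by
    refine ne_top_of_le_ne_top (ENNReal.mul_ne_top hq hfin) ?_
    calc ∫⁻ x in B, h x ∂μ ≤ ∫⁻ x in B, q ∂μ := setLIntegral_mono' hBm fun x hx => le_of_lt hx
      _ = q * μ B := setLIntegral_const _ _
  have hsub : ∫⁻ x in E \ B, h x ∂μ ≤ ∫⁻ x in B \ E, h x ∂μ := by
    have h1 := lintegral_inter_add_sdiff h E hBm (μ := μ)
    have h2 := lintegral_inter_add_sdiff h B hE (μ := μ)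
    rw [inter_comm] at h2
    have h3 : ∫⁻ x in E ∩ B, h x ∂μ ≠ ∞ :=
      ne_top_of_le_ne_top hIB (lintegral_mono_set inter_subset_right)
    rw [← h1, ← h2] at hle
    exact (ENNReal.add_le_add_iff_left h3).1 hle
  have hlow : q * μ (E \ B) ≤ ∫⁻ x in E \ B, h x ∂μ := by
    rw [← setLIntegral_const]
    exact setLIntegral_mono' (hE.diff hBm) fun x hx => not_lt.1 hx.2
  have hzero : μ (B \ E) = 0 := by
    by_contra hne
    have hlt : ∫⁻ x in B \ E, h x ∂μ < ∫⁻ x in B \ E, q ∂μ := by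
      refine setLIntegral_strict_mono (hBm.diff hE) hne measurable_const ?_ ?_
      · exact ne_top_of_le_ne_top hIB (lintegral_mono_set sdiff_subset)
      · exact ae_of_all _ fun x hx => hx.1
    rw [setLIntegral_const, ← hdiff] at hlt
    exact absurd (hlow.trans hsub) (not_le.2 hlt)
  rw [ae_eq_set]
  exact ⟨hdiff.trans hzero, hzero⟩

lemma sum_ofReal_sq {n : ℕ} (x c : Fin n → ℝ) :
    ∑ i, ENNReal.ofReal ((x i - c i) ^ 2) = ENNReal.ofReal (∑ i, (x i - c i) ^ 2) :=
  (ENNReal.ofReal_sum_of_nonneg fun _ _ => sq_nonneg _).symm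

/-- Equality case of the Brunn–Minkowski inequality against a ball, normalised to equal volumes. -/
lemma ae_eq_sqBall_of_volume_le {n : ℕ} {l s : ℝ} {E C : Set (Fin (n + 1) → ℝ)} (hl0 : 0 < l)
    (hl1 : l < 1) (hs : 0 < s) (hE : MeasurableSet E) (hC : MeasurableSet C)
    (hEv : volume E = volume (sqBall (n + 1) (s ^ 2)))
    (hsub : ∀ x ∈ E, ∀ y ∈ sqBall (n + 1) (s ^ 2), (1 - l) • x + l • y ∈ C)
    (hCv : volume C ≤ volume (sqBall (n + 1) (s ^ 2))) :
    ∃ c, (fun x => x + c) ⁻¹' E =ᵐ[volume] sqBall (n + 1) (s ^ 2) := by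
  set B := sqBall (n + 1) (s ^ 2) with hB
  have hBm : MeasurableSet B := (isOpen_sqBall _ _).measurableSet
  have hBt : volume B ≠ ∞ := (volume_sqBall_lt_top _ _).ne
  have hβ : 0 < volume.real B := volumeReal_sqBall_pos _ (by positivity)
  have hEr : volume.real E = volume.real B := by rw [measureReal_def, hEv]; rfl
  have hK : ENNReal.ofReal (volume.real E ^ (1 - l) * volume.real B ^ l) = volume B := by
    rw [hEr, ← Real.rpow_add hβ, sub_add_cancel, Real.rpow_one, ofReal_measureReal hBt]
  have hc : ∀ i, ∃ c, ∀ᵐ t, volume (slice i E t) ≤ volume (slice i B (t - c)) := fun i => by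
    obtain ⟨c, hc⟩ := (brunnMinkowskiBall_succ (brunnMinkowskiBall n) i hl0 hl1 hs hE hC
      (hEr ▸ hβ) hsub).2 (by rw [← hB, hK]; exact hCv)
    refine ⟨c, ?_⟩
    have hEfin : ∀ᵐ t, volume (slice i E t) < ∞ :=
      ae_lt_top (measurable_volume_slice i hE) (by
        rw [← volume_eq_lintegral_slice i hE, hEv]; exact hBt)
    filter_upwards [hc, hEfin] with t ht hfin
    rw [← hB, hEr, div_le_div_iff_of_pos_right hβ] at ht
    rw [hB, slice_sqBall]
    exact (ENNReal.toReal_le_toReal hfin.ne (volume_sqBall_lt_top _ _).ne).1 ht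
  choose c hc using hc
  refine ⟨c, ?_⟩
  have hT : MeasurePreserving (fun x : Fin (n + 1) → ℝ => x + c) volume volume :=
    measurePreserving_add_right volume c
  have hTE : MeasurableSet ((fun x => x + c) ⁻¹' E) := hT.measurable hE
  have hcoord : ∀ i, ∫⁻ x in E, ENNReal.ofReal ((x i - c i) ^ 2) ≤
      ∫⁻ x in B, ENNReal.ofReal ((x i) ^ 2) := fun i => by
    rw [setLIntegral_coord i hE (φ := fun t => ENNReal.ofReal ((t - c i) ^ 2)) (by fun_prop),
      setLIntegral_coord i hBm (φ := fun t => ENNReal.ofReal (t ^ 2)) (by fun_prop),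
      ← lintegral_sub_right_eq_self
        (fun t => ENNReal.ofReal (t ^ 2) * volume (slice i B t)) (c i)]
    refine lintegral_mono_ae ?_
    filter_upwards [hc i] with t ht
    gcongr
  have hsum : ∫⁻ x in E, ENNReal.ofReal (∑ i, (x i - c i) ^ 2) ≤
      ∫⁻ x in B, ENNReal.ofReal (∑ i, x i ^ 2) := by
    have e := fun x : Fin (n + 1) → ℝ => sum_ofReal_sq x 0
    simp only [Pi.zero_apply, sub_zero] at e
    simp_rw [← sum_ofReal_sq, ← e]
    rw [lintegral_finsetSum _ (by fun_prop), lintegral_finsetSum _ (by fun_prop)]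
    exact Finset.sum_le_sum fun i _ => hcoord i
  have hBlev : B = {x | ENNReal.ofReal (∑ i, x i ^ 2) < ENNReal.ofReal (s ^ 2)} := by
    ext x
    simp only [hB, sqBall, mem_ofPred_eq]
    rw [ENNReal.ofReal_lt_ofReal_iff (by positivity)]
  rw [hBlev]
  refine ae_eq_of_setLIntegral_le_sublevel (by fun_prop) ofReal_ne_top hTE ?_ ?_ ?_
  · rw [← hBlev]; exact hBt
  · rw [← hBlev, hT.measure_preimage hE.nullMeasurableSet, hEv]
  · rw [← hBlev]
    refine le_trans (le_of_eq ?_) hsum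
    rw [← hT.setLIntegral_comp_preimage hE (by fun_prop)]
    simp

lemma toLp_preimage_ball_zero (d : ℕ) {r : ℝ} (hr : 0 ≤ r) :
    WithLp.toLp 2 ⁻¹' Metric.ball (0 : EuclideanSpace ℝ (Fin d)) r = sqBall d (r ^ 2) := by
  ext x
  rw [mem_preimage, mem_ball_zero_iff]
  simp only [sqBall, mem_ofPred_eq]
  rw [← abs_of_nonneg hr, ← abs_norm, ← sq_lt_sq, EuclideanSpace.norm_sq_eq]
  simp

/-- Scaling behind the additive form of the Brunn–Minkowski inequality. -/
lemma brunnMinkowski_rescale {d : ℕ} {E C : Set (EuclideanSpace ℝ (Fin d))} {r ρ : ℝ} (hr : 0 < r)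
    (hρ : 0 < ρ) (hE : MeasurableSet E) (hC : MeasurableSet C)
    (hEv : volume (Metric.ball (0 : EuclideanSpace ℝ (Fin d)) r) ≤ volume E)
    (hsub : ∀ x ∈ E, ∀ y, ‖y - x‖ < ρ → y ∈ C) :
    ∃ E' C' : Set (Fin d → ℝ), MeasurableSet E' ∧ MeasurableSet C' ∧
      E' = (fun x => WithLp.toLp 2 ((r / (r + ρ)) • x)) ⁻¹' E ∧
      volume (sqBall d ((r + ρ) ^ 2)) ≤ volume E' ∧ (volume E ≠ ∞ → volume E' ≠ ∞) ∧
      volume C' = volume C ∧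
      ∀ x ∈ E', ∀ y ∈ sqBall d ((r + ρ) ^ 2),
        (1 - ρ / (r + ρ)) • x + (ρ / (r + ρ)) • y ∈ C' := by
  have hs : 0 < r + ρ := by linarith
  have hmp := EuclideanSpace.volume_preserving_symm_measurableEquiv_toLp (Fin d) |>.symm
  have hv : ∀ A : Set (EuclideanSpace ℝ (Fin d)), volume (WithLp.toLp 2 ⁻¹' A) = volume A :=
    fun A => hmp.measure_preimage_equiv A
  have hm : Measurable (WithLp.toLp 2 : (Fin d → ℝ) → EuclideanSpace ℝ (Fin d)) :=
    hmp.measurable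
  have h0 : r / (r + ρ) ≠ 0 := by positivity
  have hvol : ∀ A : Set (EuclideanSpace ℝ (Fin d)),
      volume ((fun x => WithLp.toLp 2 ((r / (r + ρ)) • x)) ⁻¹' A) =
      ENNReal.ofReal |((r / (r + ρ)) ^ d)⁻¹| * volume A := fun A => by
    have : (fun x : Fin d → ℝ => WithLp.toLp 2 ((r / (r + ρ)) • x)) ⁻¹' A =
      (fun x : Fin d → ℝ => (r / (r + ρ)) • x) ⁻¹' (WithLp.toLp 2 ⁻¹' A) := rfl
    rw [this, Measure.addHaar_preimage_smul _ h0, hv, Module.finrank_fin_fun]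
  refine ⟨_, WithLp.toLp 2 ⁻¹' C, ?_, hm hC, rfl, ?_, ?_, hv C, ?_⟩
  · exact (hm.comp (measurable_const_smul _)) hE
  · have : sqBall d ((r + ρ) ^ 2) = (fun x => WithLp.toLp 2 ((r / (r + ρ)) • x)) ⁻¹'
        Metric.ball (0 : EuclideanSpace ℝ (Fin d)) r := by
      rw [← toLp_preimage_ball_zero d hs.le]
      ext x
      simp only [mem_preimage, mem_ball_zero_iff, WithLp.toLp_smul, norm_smul, Real.norm_eq_abs]
      rw [abs_of_pos (by positivity), div_mul_eq_mul_div, div_lt_iff₀ hs, mul_lt_mul_iff_right₀ hr]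
    rw [this, hvol, hvol]
    gcongr
  · intro h
    rw [hvol]
    exact ENNReal.mul_ne_top ofReal_ne_top h
  · intro x hx y hy
    rw [← toLp_preimage_ball_zero d hs.le, mem_preimage, mem_ball_zero_iff] at hy
    refine hsub _ hx _ ?_
    have e : (1 - ρ / (r + ρ)) = r / (r + ρ) := by field_simp; ring
    rw [e]
    show ‖WithLp.toLp 2 ((r / (r + ρ)) • x + (ρ / (r + ρ)) • y) -
      WithLp.toLp 2 ((r / (r + ρ)) • x)‖ < ρ
    rw [WithLp.toLp_add, add_sub_cancel_left, WithLp.toLp_smul, norm_smul,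
      Real.norm_eq_abs, abs_of_pos (by positivity), div_mul_eq_mul_div, div_lt_iff₀ hs]
    gcongr

/-- Brunn–Minkowski inequality for the neighbourhoods of a set. -/
theorem volume_ball_add_le {d : ℕ} {E C : Set (EuclideanSpace ℝ (Fin d))} {r ρ : ℝ} (hr : 0 ≤ r)
    (hρ : 0 < ρ) (hE : MeasurableSet E) (hC : MeasurableSet C) (hne : E.Nonempty)
    (hEv : volume (Metric.ball (0 : EuclideanSpace ℝ (Fin d)) r) ≤ volume E)
    (hsub : ∀ x ∈ E, ∀ y, ‖y - x‖ < ρ → y ∈ C) :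
    volume (Metric.ball (0 : EuclideanSpace ℝ (Fin d)) (r + ρ)) ≤ volume C := by
  rcases hr.eq_or_lt with h | hr
  · obtain ⟨x, hx⟩ := hne
    rw [← h, zero_add, ← Measure.addHaar_ball_center volume x ρ]
    exact measure_mono fun y hy => hsub x hx y (by rwa [← dist_eq_norm])
  by_cases htop : volume E = ∞
  · have : E ⊆ C := fun x hx => hsub x hx x (by simpa using hρ)
    have h := measure_mono (μ := volume) this
    rw [htop, top_le_iff] at h
    rw [h]
    exact le_top
  obtain ⟨E', C', hE', hC', -, hv, hfin, hCv, hs⟩ := brunnMinkowski_rescale hr hρ hE hC hEv hsub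
  have hfin := hfin htop
  have h := brunnMinkowskiBall d (ρ / (r + ρ)) ((r + ρ) ^ 2) E' C' (by positivity)
    (by rw [div_lt_one (by positivity)]; linarith) (by positivity) hE' hC' hfin hs
  rw [hCv] at h
  have hmp := EuclideanSpace.volume_preserving_symm_measurableEquiv_toLp (Fin d) |>.symm
  have e : volume (Metric.ball (0 : EuclideanSpace ℝ (Fin d)) (r + ρ)) =
      volume (sqBall d ((r + ρ) ^ 2)) := by
    rw [← toLp_preimage_ball_zero d (by positivity)]
    exact (hmp.measure_preimage_equiv _).symm
  rw [e]
  refine le_trans ?_ h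
  have hpos := volumeReal_sqBall_pos d (q := (r + ρ) ^ 2) (by positivity)
  have hle : volume.real (sqBall d ((r + ρ) ^ 2)) ≤ volume.real E' :=
    ENNReal.toReal_mono hfin hv
  rw [← ofReal_measureReal (volume_sqBall_lt_top d ((r + ρ) ^ 2)).ne]
  apply ENNReal.ofReal_le_ofReal
  have hl : 0 ≤ 1 - ρ / (r + ρ) := by
    rw [sub_nonneg, div_le_one (by positivity)]; linarith
  calc volume.real (sqBall d ((r + ρ) ^ 2)) = volume.real (sqBall d ((r + ρ) ^ 2)) ^
        (1 - ρ / (r + ρ)) * volume.real (sqBall d ((r + ρ) ^ 2)) ^ (ρ / (r + ρ)) := by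
        rw [← Real.rpow_add hpos, sub_add_cancel, Real.rpow_one]
    _ ≤ _ := by gcongr

/-- Equality case of the Brunn–Minkowski inequality for the neighbourhoods of a set. -/
theorem ae_eq_ball_of_volume_le {d : ℕ} (hd : 1 ≤ d) {E C : Set (EuclideanSpace ℝ (Fin d))}
    {r ρ : ℝ} (hr : 0 < r) (hρ : 0 < ρ) (hE : MeasurableSet E) (hC : MeasurableSet C)
    (hEt : volume E ≠ ∞)
    (hEv : volume (Metric.ball (0 : EuclideanSpace ℝ (Fin d)) r) ≤ volume E)
    (hsub : ∀ x ∈ E, ∀ y, ‖y - x‖ < ρ → y ∈ C)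
    (hCv : volume C ≤ volume (Metric.ball (0 : EuclideanSpace ℝ (Fin d)) (r + ρ))) :
    ∃ z, E =ᵐ[volume] Metric.ball z r := by
  obtain ⟨n, rfl⟩ : ∃ n, d = n + 1 := ⟨d - 1, by omega⟩
  obtain ⟨E', C', hE', hC', hEE', hv, hfin, hCv', hs⟩ := brunnMinkowski_rescale hr hρ hE hC hEv hsub
  have hfin := hfin hEt
  have hl0 : 0 < ρ / (r + ρ) := by positivity
  have hl1 : ρ / (r + ρ) < 1 := by rw [div_lt_one (by positivity)]; linarith
  have h := brunnMinkowskiBall (n + 1) (ρ / (r + ρ)) ((r + ρ) ^ 2) E' C' hl0 hl1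
    (by positivity) hE' hC' hfin hs
  have hmp := EuclideanSpace.volume_preserving_symm_measurableEquiv_toLp (Fin (n + 1)) |>.symm
  have e : volume (Metric.ball (0 : EuclideanSpace ℝ (Fin (n + 1))) (r + ρ)) =
      volume (sqBall (n + 1) ((r + ρ) ^ 2)) := by
    rw [← toLp_preimage_ball_zero (n + 1) (by positivity)]
    exact (hmp.measure_preimage_equiv _).symm
  rw [e, ← hCv'] at hCv
  have hpos := volumeReal_sqBall_pos (n + 1) (q := (r + ρ) ^ 2) (by positivity)
  have hEv' : volume E' = volume (sqBall (n + 1) ((r + ρ) ^ 2)) := by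
    refine le_antisymm ?_ hv
    have h1 := h.trans hCv
    rw [← ofReal_measureReal (volume_sqBall_lt_top (n + 1) ((r + ρ) ^ 2)).ne] at h1
    have h2 := (ENNReal.ofReal_le_ofReal_iff measureReal_nonneg).1 h1
    set β := volume.real (sqBall (n + 1) ((r + ρ) ^ 2)) with hβ
    have h3 : volume.real E' ≤ β := by
      by_contra hlt
      push Not at hlt
      have : β ^ (1 - ρ / (r + ρ)) * β ^ (ρ / (r + ρ)) <
          volume.real E' ^ (1 - ρ / (r + ρ)) * β ^ (ρ / (r + ρ)) := by
        have := Real.rpow_lt_rpow hpos.le hlt (show 0 < 1 - ρ / (r + ρ) by linarith)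
        have := Real.rpow_pos_of_pos hpos (ρ / (r + ρ))
        gcongr
      rw [← Real.rpow_add hpos, sub_add_cancel, Real.rpow_one] at this
      linarith
    exact (ENNReal.toReal_le_toReal hfin (volume_sqBall_lt_top _ _).ne).1 h3
  obtain ⟨c, hc⟩ := ae_eq_sqBall_of_volume_le hl0 hl1 (by positivity) hE' hC' hEv' hs hCv
  -- transport back along the affine change of variables
  have hs0 : 0 < r + ρ := by positivity
  have ht0 : 0 < r / (r + ρ) := by positivity
  refine ⟨WithLp.toLp 2 ((r / (r + ρ)) • c), ?_⟩
  set T : EuclideanSpace ℝ (Fin (n + 1)) → (Fin (n + 1) → ℝ) :=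
    fun x => ((r / (r + ρ))⁻¹) • WithLp.ofLp x - c with hT
  have hq : Measure.QuasiMeasurePreserving T volume volume := by
    have h1 := (EuclideanSpace.volume_preserving_symm_measurableEquiv_toLp
      (Fin (n + 1))).quasiMeasurePreserving
    have h2 : Measure.QuasiMeasurePreserving (fun x : Fin (n + 1) → ℝ => (r / (r + ρ))⁻¹ • x)
        volume volume := by
      refine ⟨measurable_const_smul _, ?_⟩
      rw [Measure.map_addHaar_smul _ (inv_ne_zero ht0.ne')]
      exact Measure.smul_absolutelyContinuous
    have h3 := (measurePreserving_sub_right (volume : Measure (Fin (n + 1) → ℝ))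
      c).quasiMeasurePreserving
    exact h3.comp (h2.comp h1)
  have := hq.preimage_ae_eq hc
  have e1 : T ⁻¹' ((fun x => x + c) ⁻¹' E') = E := by
    rw [hEE']
    ext x
    simp only [mem_preimage, hT, sub_add_cancel, smul_inv_smul₀ ht0.ne']
  have e2 : T ⁻¹' sqBall (n + 1) ((r + ρ) ^ 2) =
      Metric.ball (WithLp.toLp 2 ((r / (r + ρ)) • c)) r := by
    rw [← toLp_preimage_ball_zero (n + 1) hs0.le]
    ext x
    have e : WithLp.toLp 2 (T x) = (r / (r + ρ))⁻¹ • (x - WithLp.toLp 2 ((r / (r + ρ)) • c)) := by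
      rw [smul_sub, WithLp.toLp_smul, inv_smul_smul₀ ht0.ne']
      simp [hT]
    rw [mem_preimage, mem_preimage, e, mem_ball_zero_iff, norm_smul, mem_ball_iff_norm,
      Real.norm_eq_abs, abs_of_pos (by positivity), inv_mul_lt_iff₀ ht0, div_mul_cancel₀ _ hs0.ne']
  rwa [e1, e2] at this

/-- A superlinear functional on a cone with an order unit is dominated by a linear functional
which agrees with it at the order unit. -/
lemma exists_linear_ge_superlinear {E : Type*} [AddCommGroup E] [Module ℝ E] {P : E → Prop}
    {W : E → ℝ} {e : E} (hadd : ∀ z w, P z → P w → P (z + w))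
    (hsmul : ∀ (a : ℝ) z, 0 ≤ a → P z → P (a • z)) (hW0 : ∀ z, P z → 0 ≤ W z)
    (hWadd : ∀ z w, P z → P w → W z + W w ≤ W (z + w))
    (hWsmul : ∀ (a : ℝ) z, 0 ≤ a → P z → W (a • z) = a * W z)
    (he : P e) (hunit : ∀ h, ∃ M : ℝ, 0 ≤ M ∧ P (M • e - h)) :
    ∃ L : E →ₗ[ℝ] ℝ, L e ≤ W e ∧ ∀ z, P z → W z ≤ L z := by
  set A : E → Set ℝ := fun h => {v | ∃ a : ℝ, 0 ≤ a ∧ P (a • e - h) ∧ v = a * W e - W (a • e - h)}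
    with hA
  have hne : ∀ h, (A h).Nonempty := fun h => by
    obtain ⟨M, hM0, hM⟩ := hunit h
    exact ⟨_, M, hM0, hM, rfl⟩
  have hbdd : ∀ h, BddBelow (A h) := fun h => by
    obtain ⟨M, hM0, hM⟩ := hunit (-h)
    refine ⟨-(M * W e), ?_⟩
    rintro _ ⟨a, ha, hP, rfl⟩
    have h1 := hWadd _ _ hP hM
    have h2 : a • e - h + (M • e - -h) = (a + M) • e := by rw [add_smul]; abel
    rw [h2, hWsmul _ _ (by positivity) he] at h1
    have := hW0 _ hM
    linarith
  set N : E → ℝ := fun h => sInf (A h) with hN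
  have hNle : ∀ h (a : ℝ), 0 ≤ a → P (a • e - h) → N h ≤ a * W e - W (a • e - h) :=
    fun h a ha hP => csInf_le (hbdd h) ⟨a, ha, hP, rfl⟩
  have hWz : W 0 = 0 := by simpa using hWsmul 0 e le_rfl he
  have hPz : P 0 := by simpa using hsmul 0 e le_rfl he
  have hNsmul_le : ∀ c : ℝ, 0 < c → ∀ x, N (c • x) ≤ c * N x := by
    intro c hc x
    rw [← div_le_iff₀' hc]
    refine le_csInf (hne x) ?_
    rintro _ ⟨a, ha, hP, rfl⟩
    have e1 : (c * a) • e - c • x = c • (a • e - x) := by rw [smul_sub, mul_smul]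
    have h1 := hNle (c • x) (c * a) (by positivity) (by rw [e1]; exact hsmul _ _ hc.le hP)
    rw [e1, hWsmul _ _ hc.le hP] at h1
    rw [div_le_iff₀' hc]
    linarith
  obtain ⟨L, -, hL⟩ := exists_extension_of_le_sublinear (⊥ : E →ₗ.[ℝ] ℝ) N
    (fun c hc x => by
      refine le_antisymm (hNsmul_le c hc x) ?_
      have := hNsmul_le c⁻¹ (inv_pos.2 hc) (c • x)
      rw [inv_smul_smul₀ hc.ne'] at this
      rwa [← le_inv_mul_iff₀ hc])
    (fun x y => by
      rw [← sub_le_iff_le_add]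
      refine le_csInf (hne x) ?_
      rintro _ ⟨a, ha, hPa, rfl⟩
      rw [sub_le_comm]
      refine le_csInf (hne y) ?_
      rintro _ ⟨b, hb, hPb, rfl⟩
      have e1 : (a + b) • e - (x + y) = (a • e - x) + (b • e - y) := by rw [add_smul]; abel
      have h1 := hNle (x + y) (a + b) (by positivity) (by rw [e1]; exact hadd _ _ hPa hPb)
      rw [e1] at h1
      have := hWadd _ _ hPa hPb
      linarith)
    (fun x => by
      have : (x : E) = 0 := (Submodule.mem_bot ℝ).1 x.2
      rw [this]
      have h0 : (⊥ : E →ₗ.[ℝ] ℝ) x = 0 := by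
        have hx : x = 0 := Subtype.ext this
        rw [hx]; exact LinearPMap.map_zero _
      rw [h0]
      refine le_csInf (hne 0) ?_
      rintro _ ⟨a, ha, hP, rfl⟩
      rw [sub_zero, hWsmul _ _ ha he, sub_self])
  refine ⟨L, ?_, fun z hz => ?_⟩
  · have := (hL e).trans (hNle e 1 zero_le_one (by simpa using hPz))
    simpa [hWz] using this
  · have := (hL (-z)).trans (hNle (-z) 0 le_rfl (by simpa using hz))
    simp only [map_neg, zero_mul, zero_smul, sub_neg_eq_add, zero_add, zero_sub] at this
    linarith

section gain
variable {X : Type*} [MeasurableSpace X]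

/-- Couplings of parts of two measures. -/
def subPlans (μ κ : Measure X) : Set (Measure (X × X)) :=
  {γ | γ.map Prod.fst ≤ μ ∧ γ.map Prod.snd ≤ κ}

/-- The largest total gain of a coupling of parts of two measures. -/
def gain (g : X × X → ℝ≥0∞) (μ κ : Measure X) : ℝ≥0∞ := ⨆ γ ∈ subPlans μ κ, ∫⁻ p, g p ∂γ

variable {g : X × X → ℝ≥0∞} {μ κ μ' κ' : Measure X}

lemma gain_add_le : gain g μ κ + gain g μ' κ' ≤ gain g (μ + μ') (κ + κ') := by
  refine ENNReal.biSup_add_biSup_le ⟨0, by simp [subPlans, Measure.zero_le]⟩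
    ⟨0, by simp [subPlans, Measure.zero_le]⟩ fun γ hγ γ' hγ' => ?_
  rw [← lintegral_add_measure]
  refine le_iSup₂ (f := fun γ (_ : γ ∈ subPlans (μ + μ') (κ + κ')) => ∫⁻ p, g p ∂γ) (γ + γ') ⟨?_, ?_⟩
  · rw [Measure.map_add _ _ measurable_fst]; exact add_le_add hγ.1 hγ'.1
  · rw [Measure.map_add _ _ measurable_snd]; exact add_le_add hγ.2 hγ'.2

lemma mul_gain_le (c : ℝ≥0∞) : c * gain g μ κ ≤ gain g (c • μ) (c • κ) := by
  simp only [gain, ENNReal.mul_iSup]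
  refine iSup₂_le fun γ hγ => ?_
  rw [← smul_eq_mul, ← lintegral_smul_measure]
  refine le_iSup₂ (f := fun γ (_ : γ ∈ subPlans (c • μ) (c • κ)) => ∫⁻ p, g p ∂γ) (c • γ) ⟨?_, ?_⟩
  · rw [Measure.map_smul]; exact Measure.le_iff'.2 fun S => mul_le_mul_right (hγ.1 S) c
  · rw [Measure.map_smul]; exact Measure.le_iff'.2 fun S => mul_le_mul_right (hγ.2 S) c

lemma gain_smul {c : ℝ≥0∞} (hc : c ≠ 0) (hc' : c ≠ ∞) :
    gain g (c • μ) (c • κ) = c * gain g μ κ := by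
  refine le_antisymm ?_ (mul_gain_le c)
  have := mul_gain_le (g := g) (μ := c • μ) (κ := c • κ) c⁻¹
  rw [smul_smul, smul_smul, ENNReal.inv_mul_cancel hc hc', one_smul, one_smul] at this
  calc gain g (c • μ) (c • κ) = c * (c⁻¹ * gain g (c • μ) (c • κ)) := by
        rw [← mul_assoc, ENNReal.mul_inv_cancel hc hc', one_mul]
    _ ≤ _ := by gcongr

lemma gain_le {M : ℝ≥0∞} (hg : ∀ p, g p ≤ M) : gain g μ κ ≤ M * μ univ := by
  refine iSup₂_le fun γ hγ => ?_
  calc ∫⁻ p, g p ∂γ ≤ ∫⁻ p, M ∂γ := lintegral_mono hg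
    _ = M * γ univ := lintegral_const _
    _ ≤ _ := by
      gcongr
      have := hγ.1 univ
      rwa [Measure.map_apply measurable_fst MeasurableSet.univ, preimage_univ] at this

lemma le_gain {γ : Measure (X × X)} (h1 : γ.map Prod.fst ≤ μ) (h2 : γ.map Prod.snd ≤ κ) :
    ∫⁻ p, g p ∂γ ≤ gain g μ κ :=
  le_iSup₂ (f := fun γ (_ : γ ∈ subPlans μ κ) => ∫⁻ p, g p ∂γ) γ ⟨h1, h2⟩

lemma withDensity_ofReal_add {s t : X → ℝ} (hs : ∀ x, 0 ≤ s x) (ht : ∀ x, 0 ≤ t x)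
    (hsm : Measurable s) :
    μ.withDensity (fun x => ENNReal.ofReal (s x + t x)) =
      μ.withDensity (fun x => ENNReal.ofReal (s x)) +
      μ.withDensity (fun x => ENNReal.ofReal (t x)) := by
  rw [← withDensity_add_left hsm.ennreal_ofReal]
  congr 1
  funext x
  exact ENNReal.ofReal_add (hs x) (ht x)

lemma withDensity_ofReal_smul {s : X → ℝ} {a : ℝ} (ha : 0 ≤ a) (hsm : Measurable s) :
    μ.withDensity (fun x => ENNReal.ofReal (a * s x)) =
      ENNReal.ofReal a • μ.withDensity (fun x => ENNReal.ofReal (s x)) := by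
  rw [← withDensity_smul _ hsm.ennreal_ofReal]
  congr 1
  funext x
  exact ENNReal.ofReal_mul ha

/-- Finitely additive dual variables for the gain problem. -/
lemma exists_additive_dual [IsFiniteMeasure μ] [SFinite κ] {M : ℝ≥0∞} (hM : M ≠ ∞)
    (hg : ∀ p, g p ≤ M) :
    ∃ a b : Set X → ℝ,
      (∀ S, MeasurableSet S → 0 ≤ a S) ∧ (∀ S, MeasurableSet S → 0 ≤ b S) ∧
      (∀ S T, MeasurableSet S → MeasurableSet T → Disjoint S T → a (S ∪ T) = a S + a T) ∧
      (∀ S T, MeasurableSet S → MeasurableSet T → Disjoint S T → b (S ∪ T) = b S + b T) ∧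
      a univ + b univ ≤ (gain g μ κ).toReal ∧
      ∀ S T (r : ℝ), MeasurableSet S → MeasurableSet T → 0 < μ.real S → 0 < κ.real T →
        (∀ x ∈ S, ∀ y ∈ T, ENNReal.ofReal r ≤ g (x, y)) →
        r ≤ a S / μ.real S + b T / κ.real T := by
  classical
  set den : Measure X → SimpleFunc X ℝ → Measure X := fun ν s =>
    ν.withDensity fun x => ENNReal.ofReal (s x) with hden
  set P : SimpleFunc X ℝ × SimpleFunc X ℝ → Prop := fun z => (∀ x, 0 ≤ z.1 x) ∧ ∀ x, 0 ≤ z.2 x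
    with hP
  set W : SimpleFunc X ℝ × SimpleFunc X ℝ → ℝ := fun z =>
    (gain g (den μ z.1) (den κ z.2)).toReal with hW
  have hfin : ∀ z : SimpleFunc X ℝ × SimpleFunc X ℝ, gain g (den μ z.1) (den κ z.2) ≠ ∞ := by
    intro z
    refine ne_top_of_le_ne_top (ENNReal.mul_ne_top hM ?_) (gain_le hg)
    obtain ⟨B, hB⟩ := z.1.finite_range.bddAbove
    rw [hden]
    simp only
    rw [withDensity_apply _ MeasurableSet.univ, setLIntegral_univ]
    refine ne_top_of_le_ne_top (b := ∫⁻ _, ENNReal.ofReal B ∂μ) ?_ ?_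
    · rw [lintegral_const]; exact ENNReal.mul_ne_top ofReal_ne_top (measure_ne_top _ _)
    · exact lintegral_mono fun x => ENNReal.ofReal_le_ofReal (hB ⟨x, rfl⟩)
  have hdadd : ∀ (ν : Measure X) (s t : SimpleFunc X ℝ), (∀ x, 0 ≤ s x) → (∀ x, 0 ≤ t x) →
      den ν (s + t) = den ν s + den ν t := fun ν s t hs ht =>
    withDensity_ofReal_add hs ht s.measurable
  have hdsmul : ∀ (ν : Measure X) (c : ℝ) (s : SimpleFunc X ℝ), 0 ≤ c →
      den ν (c • s) = ENNReal.ofReal c • den ν s := fun ν c s hc =>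
    withDensity_ofReal_smul hc s.measurable
  have hd0 : ∀ (ν : Measure X), den ν 0 = 0 := fun ν => by
    simp [hden]
  obtain ⟨L, hL1, hL2⟩ := exists_linear_ge_superlinear (P := P) (W := W) (e := (1, 1))
    (fun z w hz hw => ⟨fun x => add_nonneg (hz.1 x) (hw.1 x), fun x => add_nonneg (hz.2 x) (hw.2 x)⟩)
    (fun a z ha hz => ⟨fun x => mul_nonneg ha (hz.1 x), fun x => mul_nonneg ha (hz.2 x)⟩)
    (fun z _ => ENNReal.toReal_nonneg)
    (fun z w hz hw => by
      simp only [hW]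
      rw [← ENNReal.toReal_add (hfin z) (hfin w), Prod.fst_add, Prod.snd_add,
        hdadd _ _ _ hz.1 hw.1, hdadd _ _ _ hz.2 hw.2]
      refine ENNReal.toReal_mono ?_ gain_add_le
      rw [← hdadd _ _ _ hz.1 hw.1, ← hdadd _ _ _ hz.2 hw.2]
      exact hfin (z + w))
    (fun c z hc hz => by
      simp only [hW]
      rw [Prod.smul_fst, Prod.smul_snd, hdsmul _ _ _ hc, hdsmul _ _ _ hc]
      rcases hc.eq_or_lt with h | h
      · rw [← h, zero_mul, ENNReal.ofReal_zero, zero_smul, zero_smul]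
        have := gain_le (μ := (0 : Measure X)) (κ := (0 : Measure X)) hg
        simp only [Measure.coe_zero, Pi.zero_apply, mul_zero, nonpos_iff_eq_zero] at this
        rw [this]; rfl
      · rw [gain_smul (ENNReal.ofReal_pos.2 h).ne' ofReal_ne_top, ENNReal.toReal_mul,
          ENNReal.toReal_ofReal hc])
    ⟨fun x => zero_le_one, fun x => zero_le_one⟩
    (fun h => by
      obtain ⟨B, hB⟩ := h.1.finite_range.bddAbove
      obtain ⟨B', hB'⟩ := h.2.finite_range.bddAbove
      refine ⟨max 0 (max B B'), le_max_left _ _, fun x => ?_, fun x => ?_⟩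
      · have h1 : h.1 x ≤ B := hB ⟨x, rfl⟩
        have h2 : B ≤ max 0 (max B B') := (le_max_left _ _).trans (le_max_right _ _)
        show 0 ≤ max 0 (max B B') * 1 - h.1 x
        linarith
      · have h1 : h.2 x ≤ B' := hB' ⟨x, rfl⟩
        have h2 : B' ≤ max 0 (max B B') := (le_max_right _ _).trans (le_max_right _ _)
        show 0 ≤ max 0 (max B B') * 1 - h.2 x
        linarith)
  set ch : Set X → SimpleFunc X ℝ := fun S =>
    if hS : MeasurableSet S then SimpleFunc.piecewise S hS 1 0 else 0 with hch
  have hch_apply : ∀ S, MeasurableSet S → ∀ x, ch S x = S.indicator (fun _ => (1 : ℝ)) x := by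
    intro S hS x
    simp only [hch, dif_pos hS]
    by_cases hx : x ∈ S <;> simp [hx]
  have hch0 : ∀ S, MeasurableSet S → ∀ x, 0 ≤ ch S x := fun S hS x => by
    rw [hch_apply S hS]; exact indicator_nonneg (fun _ _ => zero_le_one) x
  have hchadd : ∀ S T, MeasurableSet S → MeasurableSet T → Disjoint S T →
      ch (S ∪ T) = ch S + ch T := fun S T hS hT hST => by
    ext x
    rw [SimpleFunc.coe_add, Pi.add_apply, hch_apply _ (hS.union hT), hch_apply _ hS,
      hch_apply _ hT, indicator_union_of_disjoint hST]
  have hchden : ∀ (ν : Measure X) (S : Set X) (c : ℝ), 0 ≤ c → MeasurableSet S →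
      den ν (c • ch S) = ENNReal.ofReal c • ν.restrict S := fun ν S c hc hS => by
    rw [hdsmul _ _ _ hc]
    congr 1
    simp only [hden, hch_apply S hS]
    rw [← withDensity_indicator_one hS]
    congr 1
    funext x
    by_cases hx : x ∈ S <;> simp [hx]
  have hLsplit : ∀ s t, L (s, t) = L (s, 0) + L (0, t) := fun s t => by
    rw [← map_add]; simp
  refine ⟨fun S => L (ch S, 0), fun T => L (0, ch T), ?_, ?_, ?_, ?_, ?_, ?_⟩
  · intro S hS
    exact ENNReal.toReal_nonneg.trans (hL2 (ch S, 0) ⟨hch0 S hS, fun _ => le_rfl⟩)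
  · intro S hS
    exact ENNReal.toReal_nonneg.trans (hL2 (0, ch S) ⟨fun _ => le_rfl, hch0 S hS⟩)
  · intro S T hS hT hST
    show L (ch (S ∪ T), 0) = _
    rw [hchadd S T hS hT hST, ← map_add]; simp
  · intro S T hS hT hST
    show L (0, ch (S ∪ T)) = _
    rw [hchadd S T hS hT hST, ← map_add]; simp
  · have h1 : ch univ = 1 := by
      ext x; rw [hch_apply _ MeasurableSet.univ]; simp
    show L (ch univ, 0) + L (0, ch univ) ≤ _
    rw [← hLsplit, h1]
    refine hL1.trans (le_of_eq ?_)
    have hd1 : ∀ ν : Measure X, den ν 1 = ν := fun ν => by simp [hden]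
    simp only [hW, hd1]
  · intro S T r hS hT hμ hκ hr
    have hκT : κ T ≠ ∞ := fun h => by
      rw [measureReal_def, h, ENNReal.toReal_top] at hκ; exact lt_irrefl _ hκ
    have hz : P ((μ.real S)⁻¹ • ch S, (κ.real T)⁻¹ • ch T) :=
      ⟨fun x => mul_nonneg (inv_nonneg.2 hμ.le) (hch0 S hS x),
        fun x => mul_nonneg (inv_nonneg.2 hκ.le) (hch0 T hT x)⟩
    have h1 := hL2 _ hz
    have e1 : L ((μ.real S)⁻¹ • ch S, (κ.real T)⁻¹ • ch T) =
        L (ch S, 0) / μ.real S + L (0, ch T) / κ.real T := by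
      rw [hLsplit, div_eq_inv_mul, div_eq_inv_mul, ← smul_eq_mul, ← smul_eq_mul, ← map_smul,
        ← map_smul]
      simp
    rw [e1] at h1
    refine le_trans ?_ h1
    simp only [hW]
    rw [hchden _ _ _ (inv_nonneg.2 hμ.le) hS, hchden _ _ _ (inv_nonneg.2 hκ.le) hT]
    set α := μ.real S with hα
    set β := κ.real T with hβ
    set γ : Measure (X × X) :=
      (ENNReal.ofReal α⁻¹ * ENNReal.ofReal β⁻¹) • (μ.restrict S).prod (κ.restrict T) with hγ
    have eα : μ S = ENNReal.ofReal α := (ofReal_measureReal (measure_ne_top _ _)).symm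
    have eβ : κ T = ENNReal.ofReal β := (ofReal_measureReal hκT).symm
    have hα1 : ENNReal.ofReal α⁻¹ * ENNReal.ofReal α = 1 := by
      rw [← ENNReal.ofReal_mul (inv_nonneg.2 hμ.le), inv_mul_cancel₀ hμ.ne', ENNReal.ofReal_one]
    have hβ1 : ENNReal.ofReal β⁻¹ * ENNReal.ofReal β = 1 := by
      rw [← ENNReal.ofReal_mul (inv_nonneg.2 hκ.le), inv_mul_cancel₀ hκ.ne', ENNReal.ofReal_one]
    have hle : ∫⁻ p, g p ∂γ ≤ gain g (ENNReal.ofReal α⁻¹ • μ.restrict S)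
        (ENNReal.ofReal β⁻¹ • κ.restrict T) := by
      apply le_gain
      · rw [hγ, Measure.map_smul, Measure.map_fst_prod, Measure.restrict_apply_univ, eβ, smul_smul,
          mul_assoc, hβ1, mul_one]
      · rw [hγ, Measure.map_smul, Measure.map_snd_prod, Measure.restrict_apply_univ, eα, smul_smul,
          mul_right_comm, hα1, one_mul]
    have hlow : ENNReal.ofReal r ≤ ∫⁻ p, g p ∂γ := by
      have hm : ∀ᵐ p ∂((μ.restrict S).prod (κ.restrict T)), ENNReal.ofReal r ≤ g p := by
        rw [Measure.prod_restrict, ae_restrict_iff' (hS.prod hT)]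
        exact ae_of_all _ fun p hp => hr p.1 hp.1 p.2 hp.2
      calc ENNReal.ofReal r = ∫⁻ p, ENNReal.ofReal r ∂γ := by
            rw [lintegral_const, hγ, Measure.smul_apply, Measure.prod_restrict,
              Measure.restrict_apply_univ, Measure.prod_prod, eα, eβ, smul_eq_mul,
              mul_mul_mul_comm, hα1, hβ1, mul_one, mul_one]
        _ ≤ _ := lintegral_mono_ae (Measure.smul_absolutelyContinuous hm)
    have := hlow.trans hle
    rw [ENNReal.ofReal_le_iff_le_toReal] at this
    · exact this
    · have h3 := hfin ((μ.real S)⁻¹ • ch S, (κ.real T)⁻¹ • ch T)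
      rwa [hchden _ _ _ (inv_nonneg.2 hμ.le) hS, hchden _ _ _ (inv_nonneg.2 hκ.le) hT] at h3

end gain

/-- Partition of Euclidean space into congruent half-open cubes. -/
lemma exists_cube_partition (d : ℕ) {L : ℝ} (hL : 0 < L) :
    ∃ q : EuclideanSpace ℝ (Fin d) → (Fin d → ℤ), Measurable q ∧
      (∀ n, volume (q ⁻¹' {n}) = ENNReal.ofReal (L ^ d)) ∧
      ∀ x y, q x = q y → ‖y - x‖ ≤ √d * L := by
  refine ⟨fun x i => ⌊x i / L⌋, ?_, fun n => ?_, fun x y hxy => ?_⟩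
  · refine measurable_pi_lambda _ fun i => Int.measurable_floor.comp ?_
    fun_prop
  · have h1 : (fun (x : EuclideanSpace ℝ (Fin d)) i => ⌊x i / L⌋) ⁻¹' {n} =
        WithLp.ofLp ⁻¹' (pi univ fun i => Ico (n i * L) (n i * L + L)) := by
      ext x
      simp only [mem_preimage, mem_singleton_iff, funext_iff, Set.mem_pi, mem_univ, true_imp_iff,
        mem_Ico, Int.floor_eq_iff, le_div_iff₀ hL, div_lt_iff₀ hL, add_mul, one_mul]
    rw [h1, (PiLp.volume_preserving_ofLp (Fin d)).measure_preimage
      (MeasurableSet.univ_pi fun i => measurableSet_Ico).nullMeasurableSet, Real.volume_pi_Ico]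
    simp [ENNReal.ofReal_pow hL.le]
  · rw [EuclideanSpace.norm_eq, ← Real.sqrt_sq hL.le, ← Real.sqrt_mul (by positivity)]
    apply Real.sqrt_le_sqrt
    calc ∑ i, ‖(y - x) i‖ ^ 2 ≤ ∑ _i : Fin d, L ^ 2 := by
          refine Finset.sum_le_sum fun i _ => ?_
          have := congrFun hxy i
          have h2 := Int.abs_sub_lt_one_of_floor_eq_floor this
          rw [← sub_div, abs_div, abs_of_pos hL, div_lt_one hL] at h2
          rw [PiLp.sub_apply, Real.norm_eq_abs, abs_sub_comm]
          gcongr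
      _ = d * L ^ 2 := by simp

section nogap
variable {X : Type*} [MeasurableSpace X]

/-- Transport plans from `μ` to a measure dominated by `κ`. -/
def plansTo (μ κ : Measure X) : Set (Measure (X × X)) :=
  {γ | γ.map Prod.fst = μ ∧ γ.map Prod.snd ≤ κ}

/-- A cell-by-cell plan between measures with small mass comparison. -/
lemma exists_plan_of_cells {ι : Type*} [Countable ι] [MeasurableSpace ι]
    [MeasurableSingletonClass ι] {q : X → ι} (hq : Measurable q) {μ κ : Measure X}
    [SFinite μ] [SFinite κ]
    (hle : ∀ n, μ (q ⁻¹' {n}) ≤ κ (q ⁻¹' {n})) (hfin : ∀ n, κ (q ⁻¹' {n}) ≠ ∞)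
    (h0 : ∀ n, κ (q ⁻¹' {n}) ≠ 0) :
    ∃ η ∈ plansTo μ κ, ∀ᵐ p ∂η, q p.1 = q p.2 := by
  have hQ : ∀ n, MeasurableSet (q ⁻¹' {n}) := fun n => hq (measurableSet_singleton n)
  have hsum : ∀ ν : Measure X, Measure.sum (fun n => ν.restrict (q ⁻¹' {n})) = ν := fun ν => by
    rw [← Measure.restrict_iUnion (fun i j hij => ?_) hQ, ← preimage_iUnion, iUnion_of_singleton,
      preimage_univ, Measure.restrict_univ]
    exact Disjoint.preimage _ (by simpa using hij)
  refine ⟨Measure.sum fun n => (κ (q ⁻¹' {n}))⁻¹ •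
    (μ.restrict (q ⁻¹' {n})).prod (κ.restrict (q ⁻¹' {n})), ⟨?_, ?_⟩, ?_⟩
  · rw [Measure.map_sum measurable_fst.aemeasurable]
    conv_rhs => rw [← hsum μ]
    congr 1
    funext n
    rw [Measure.map_smul, Measure.map_fst_prod, Measure.restrict_apply_univ, smul_smul,
      ENNReal.inv_mul_cancel (h0 n) (hfin n), one_smul]
  · rw [Measure.map_sum measurable_snd.aemeasurable]
    conv_rhs => rw [← hsum κ]
    refine Measure.le_iff.2 fun S hS => ?_
    rw [Measure.sum_apply _ hS, Measure.sum_apply _ hS]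
    refine ENNReal.tsum_le_tsum fun n => ?_
    rw [Measure.map_smul, Measure.map_snd_prod, Measure.restrict_apply_univ, smul_smul,
      Measure.smul_apply, smul_eq_mul]
    calc _ ≤ 1 * (κ.restrict (q ⁻¹' {n})) S := by
          gcongr
          rw [← ENNReal.inv_mul_cancel (h0 n) (hfin n)]
          exact mul_le_mul_right (hle n) _
      _ = _ := one_mul _
  · rw [Measure.ae_sum_iff]
    intro n
    refine Measure.smul_absolutelyContinuous ?_
    rw [Measure.prod_restrict]
    filter_upwards [ae_restrict_mem ((hQ n).prod (hQ n))] with p hp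
    exact (mem_singleton_iff.1 hp.1).trans (mem_singleton_iff.1 hp.2).symm

/-- Minimal transport cost plus maximal gain is at most the total mass times the cost cap. -/
lemma minCost_add_gain_le {ι : Type*} [Countable ι] [MeasurableSpace ι]
    [MeasurableSingletonClass ι] {q : X → ι} (hq : Measurable q) {μ κ vol : Measure X}
    [IsFiniteMeasure μ] [SigmaFinite κ] (hμ0 : μ univ ≠ 0) (hvol : μ + κ = vol)
    (hq3 : ∀ n, 3 * μ univ ≤ vol (q ⁻¹' {n})) (hqfin : ∀ n, vol (q ⁻¹' {n}) ≠ ∞)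
    {c : X × X → ℝ} (hc : Measurable c) (hc0 : ∀ p, 0 ≤ c p) {C : ℝ}
    (hcC : ∀ p : X × X, q p.1 = q p.2 → c p ≤ C) :
    (⨅ γ ∈ plansTo μ κ, ∫⁻ p, ENNReal.ofReal (c p) ∂γ) +
      gain (fun p => ENNReal.ofReal (C - c p)) μ κ ≤ ENNReal.ofReal C * μ univ := by
  rw [gain, ENNReal.add_biSup ⟨0, by simp [subPlans, Measure.zero_le]⟩]
  refine iSup₂_le fun γ hγ => ?_
  set A : Set (X × X) := {p | c p ≤ C} with hA
  have hAm : MeasurableSet A := hc measurableSet_Iic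
  set γ' := γ.restrict A with hγ'
  have hγ'le : γ' ≤ γ := Measure.restrict_le_self
  set α := γ'.map Prod.fst with hα
  set β := γ'.map Prod.snd with hβ
  have hαμ : α ≤ μ := (Measure.map_mono hγ'le measurable_fst).trans hγ.1
  have hβκ : β ≤ κ := (Measure.map_mono hγ'le measurable_snd).trans hγ.2
  have hαu : α univ = γ' univ := by rw [hα, Measure.map_apply measurable_fst .univ, preimage_univ]
  have hβu : β univ = γ' univ := by rw [hβ, Measure.map_apply measurable_snd .univ, preimage_univ]
  have : IsFiniteMeasure α := isFiniteMeasure_of_le μ hαμ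
  have : IsFiniteMeasure β := ⟨by rw [hβu, ← hαu]; exact measure_lt_top _ _⟩
  have hμ'' : μ - α + α = μ := Measure.sub_add_cancel_of_le hαμ
  have hκ'' : κ - β + β = κ := Measure.sub_add_cancel_of_le hβκ
  have hkap : ∀ n, μ univ ≤ (κ - β) (q ⁻¹' {n}) := fun n => by
    have h1 : μ (q ⁻¹' {n}) + ((κ - β) (q ⁻¹' {n}) + β (q ⁻¹' {n})) = vol (q ⁻¹' {n}) := by
      rw [← Measure.add_apply, hκ'', ← Measure.add_apply, hvol]
    have h2 : β (q ⁻¹' {n}) ≤ μ univ := (measure_mono (subset_univ _)).trans (by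
      rw [hβu, ← hαu]; exact hαμ _)
    have h3 : μ (q ⁻¹' {n}) ≤ μ univ := measure_mono (subset_univ _)
    have h4 : μ univ + (μ univ + μ univ) ≤ μ univ + ((κ - β) (q ⁻¹' {n}) + μ univ) :=
      calc μ univ + (μ univ + μ univ) = 3 * μ univ := by ring
        _ ≤ _ := hq3 n
        _ = _ := h1.symm
        _ ≤ _ := by gcongr
    rwa [ENNReal.add_le_add_iff_left (measure_ne_top _ _),
      ENNReal.add_le_add_iff_right (measure_ne_top _ _)] at h4
  have hκle : κ - β ≤ vol := by
    rw [← hvol]; exact Measure.sub_le.trans (le_add_of_nonneg_left (Measure.zero_le _))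
  have : SigmaFinite (κ - β) := Measure.sigmaFinite_of_le κ Measure.sub_le
  obtain ⟨η, ⟨hη1, hη2⟩, hη⟩ := exists_plan_of_cells (μ := μ - α) (κ := κ - β) hq
    (fun n => ((Measure.sub_le _).trans (measure_mono (subset_univ _))).trans (hkap n))
    (fun n => ne_top_of_le_ne_top (hqfin n) (hκle _))
    (fun n h => hμ0 (le_antisymm ((hkap n).trans h.le) bot_le))
  have hηu : η univ = (μ - α) univ := by
    rw [← hη1, Measure.map_apply measurable_fst .univ, preimage_univ]
  have hplan : η + γ' ∈ plansTo μ κ := ⟨by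
    rw [Measure.map_add _ _ measurable_fst, hη1, ← hα, hμ''], by
    rw [Measure.map_add _ _ measurable_snd, ← hβ]
    calc _ ≤ κ - β + β := by gcongr
      _ = κ := hκ''⟩
  have hgain : ∫⁻ p, ENNReal.ofReal (C - c p) ∂γ = ∫⁻ p, ENNReal.ofReal (C - c p) ∂γ' := by
    rw [hγ', ← lintegral_indicator hAm]
    congr 1
    funext p
    by_cases hp : p ∈ A
    · rw [indicator_of_mem hp]
    · rw [indicator_of_notMem hp, ENNReal.ofReal_eq_zero]
      have : C < c p := not_le.1 hp
      linarith
  calc _ ≤ ∫⁻ p, ENNReal.ofReal (c p) ∂(η + γ') + ∫⁻ p, ENNReal.ofReal (C - c p) ∂γ := by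
        gcongr
        exact iInf₂_le _ hplan
    _ = ∫⁻ p, ENNReal.ofReal (c p) ∂η +
        ∫⁻ p, (ENNReal.ofReal (c p) + ENNReal.ofReal (C - c p)) ∂γ' := by
        rw [lintegral_add_measure, hgain, add_assoc, lintegral_add_left hc.ennreal_ofReal]
    _ ≤ ∫⁻ _, ENNReal.ofReal C ∂η + ∫⁻ _, ENNReal.ofReal C ∂γ' := by
        refine add_le_add (lintegral_mono_ae ?_) (lintegral_mono_ae ?_)
        · filter_upwards [hη] with p hp
          exact ENNReal.ofReal_le_ofReal (hcC p hp)
        · filter_upwards [ae_restrict_mem hAm] with p hp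
          rw [← ENNReal.ofReal_add (hc0 p) (sub_nonneg.2 hp)]
          simp
    _ = ENNReal.ofReal C * μ univ := by
        rw [lintegral_const, lintegral_const, ← mul_add, hηu, ← hαu, ← Measure.add_apply, hμ'']

end nogap

lemma sum_le_univ_of_additive {X ι : Type*} [MeasurableSpace X] {a : Set X → ℝ}
    (ha0 : ∀ S, MeasurableSet S → 0 ≤ a S)
    (hadd : ∀ S T, MeasurableSet S → MeasurableSet T → Disjoint S T → a (S ∪ T) = a S + a T)
    {S : ι → Set X} (hS : ∀ i, MeasurableSet (S i)) (hdis : Pairwise (Function.onFun Disjoint S))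
    (s : Finset ι) : ∑ i ∈ s, a (S i) ≤ a univ := by
  classical
  have h1 : ∑ i ∈ s, a (S i) = a (⋃ i ∈ s, S i) := by
    induction s using Finset.induction_on with
    | empty =>
      have := hadd ∅ ∅ .empty .empty (disjoint_empty _)
      rw [union_self] at this
      simp only [Finset.sum_empty, Finset.notMem_empty, iUnion_of_empty, iUnion_empty]
      linarith
    | insert i s hi ih =>
      rw [Finset.sum_insert hi, ih, Finset.set_biUnion_insert, hadd _ _ (hS i)
        (Finset.measurableSet_biUnion _ fun j _ => hS j)]
      rw [disjoint_iUnion₂_right]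
      intro j hj
      exact hdis fun h => hi (h ▸ hj)
  have hm : MeasurableSet (⋃ i ∈ s, S i) := Finset.measurableSet_biUnion _ fun j _ => hS j
  have h2 := hadd _ _ hm hm.compl disjoint_compl_right
  rw [union_compl_self] at h2
  rw [h1, h2]
  have := ha0 _ hm.compl
  linarith

/-- A function controlled on small sets by the averages of a finitely additive set function has
integral at most the total mass of the set function. -/
lemma lintegral_le_of_additive {d : ℕ} {ν : Measure (EuclideanSpace ℝ (Fin d))}
    [IsLocallyFiniteMeasure ν] {a : Set (EuclideanSpace ℝ (Fin d)) → ℝ}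
    (ha0 : ∀ S, MeasurableSet S → 0 ≤ a S)
    (hadd : ∀ S T, MeasurableSet S → MeasurableSet T → Disjoint S T → a (S ∪ T) = a S + a T)
    {F : EuclideanSpace ℝ (Fin d) → ℝ}
    (hF : ∀ ε > 0, ∃ δ > 0, ∀ S, MeasurableSet S → 0 < ν.real S →
      (∀ x ∈ S, ∀ y ∈ S, ‖y - x‖ ≤ δ) → ∀ x ∈ S, F x ≤ a S / ν.real S + ε) :
    ∫⁻ x, ENNReal.ofReal (F x) ∂ν ≤ ENNReal.ofReal (a univ) := by
  have key : ∀ n : ℕ, ∫⁻ x in Metric.ball 0 n, ENNReal.ofReal (F x) ∂ν ≤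
      ENNReal.ofReal (a univ) := by
    intro n
    set D : Set (EuclideanSpace ℝ (Fin d)) := Metric.ball 0 n with hD
    have hDfin : ν D ≠ ∞ := measure_ball_lt_top.ne
    have step : ∀ ε : ℝ, 0 < ε → ∫⁻ x in D, ENNReal.ofReal (F x) ∂ν ≤
        ENNReal.ofReal (a univ) + ENNReal.ofReal ε * ν D := by
      intro ε hε
      obtain ⟨δ, hδ, h⟩ := hF ε hε
      obtain ⟨q, hq, -, hqd⟩ := exists_cube_partition d (L := δ / (√d + 1)) (by positivity)
      have hqδ : ∀ x y, q x = q y → ‖y - x‖ ≤ δ := fun x y hxy => by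
        refine (hqd x y hxy).trans ?_
        rw [mul_div_assoc', div_le_iff₀ (by positivity)]
        nlinarith [Real.sqrt_nonneg (d : ℝ)]
      set S : (Fin d → ℤ) → Set (EuclideanSpace ℝ (Fin d)) := fun j => D ∩ q ⁻¹' {j} with hS
      have hSm : ∀ j, MeasurableSet (S j) := fun j =>
        measurableSet_ball.inter (hq (measurableSet_singleton j))
      have hSd : Pairwise (Function.onFun Disjoint S) := fun i j hij =>
        Disjoint.mono inter_subset_right inter_subset_right
          (Disjoint.preimage _ (by simpa using hij))
      have hSU : ⋃ j, S j = D := by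
        rw [hS, ← inter_iUnion, ← preimage_iUnion, iUnion_of_singleton, preimage_univ, inter_univ]
      have hone : ∀ j, ∫⁻ x in S j, ENNReal.ofReal (F x) ∂ν ≤
          ENNReal.ofReal (a (S j)) + ENNReal.ofReal ε * ν (S j) := by
        intro j
        have hjf : ν (S j) ≠ ∞ := ne_top_of_le_ne_top hDfin (measure_mono inter_subset_left)
        rcases eq_or_ne (ν (S j)) 0 with h0 | h0
        · rw [setLIntegral_measure_zero _ _ h0]; exact zero_le
        have hpos : 0 < ν.real (S j) := ENNReal.toReal_pos h0 hjf
        have hb := h (S j) (hSm j) hpos fun x hx y hy =>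
          hqδ x y ((mem_singleton_iff.1 hx.2).trans (mem_singleton_iff.1 hy.2).symm)
        calc ∫⁻ x in S j, ENNReal.ofReal (F x) ∂ν
            ≤ ∫⁻ x in S j, ENNReal.ofReal (a (S j) / ν.real (S j) + ε) ∂ν :=
              setLIntegral_mono' (hSm j) fun x hx => ENNReal.ofReal_le_ofReal (hb x hx)
          _ = ENNReal.ofReal (a (S j) / ν.real (S j) + ε) * ν (S j) := setLIntegral_const _ _
          _ = _ := by
            have ha := ha0 _ (hSm j)
            rw [ENNReal.ofReal_add (by positivity) hε.le, add_mul]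
            congr 1
            conv_lhs => rw [← ofReal_measureReal hjf]
            rw [← ENNReal.ofReal_mul (by positivity), div_mul_cancel₀ _ hpos.ne']
      calc ∫⁻ x in D, ENNReal.ofReal (F x) ∂ν = ∑' j, ∫⁻ x in S j, ENNReal.ofReal (F x) ∂ν := by
            rw [← hSU, lintegral_iUnion hSm hSd]
        _ ≤ ∑' j, (ENNReal.ofReal (a (S j)) + ENNReal.ofReal ε * ν (S j)) :=
            ENNReal.tsum_le_tsum hone
        _ = (∑' j, ENNReal.ofReal (a (S j))) + ENNReal.ofReal ε * ν D := by
            rw [ENNReal.tsum_add, ENNReal.tsum_mul_left, ← measure_iUnion hSd hSm, hSU]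
        _ ≤ _ := by
            gcongr
            refine ENNReal.summable.tsum_le_of_sum_le fun s => ?_
            rw [← ENNReal.ofReal_sum_of_nonneg fun j _ => ha0 _ (hSm j)]
            exact ENNReal.ofReal_le_ofReal (sum_le_univ_of_additive ha0 hadd hSm hSd s)
    have hlim : Tendsto (fun ε : ℝ => ENNReal.ofReal (a univ) + ENNReal.ofReal ε * ν D)
        (nhdsWithin 0 (Ioi 0)) (nhds (ENNReal.ofReal (a univ) + ENNReal.ofReal 0 * ν D)) := by
      refine Tendsto.const_add _ (ENNReal.Tendsto.mul_const ?_ (Or.inr hDfin))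
      exact (ENNReal.continuous_ofReal.tendsto 0).mono_left nhdsWithin_le_nhds
    rw [ENNReal.ofReal_zero, zero_mul, add_zero] at hlim
    exact ge_of_tendsto hlim (by filter_upwards [self_mem_nhdsWithin] with ε hε using step ε hε)
  have hU : ⋃ n : ℕ, Metric.ball (0 : EuclideanSpace ℝ (Fin d)) n = univ := Metric.iUnion_ball_nat 0
  rw [← setLIntegral_univ, ← hU, setLIntegral_iUnion_of_directed]
  · rw [hU]; exact iSup_le key
  · exact directed_of_isDirected_le fun i j hij => Metric.ball_subset_ball (by exact_mod_cast hij)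

/-- Existence of dual potentials for the exterior transport problem. -/
theorem exists_dual_potentials {d : ℕ} (hd : 1 ≤ d) {K : ℝ → ℝ} (hKc : Continuous K)
    (hKm : Monotone K) (hK0 : K 0 = 0) {μ κ : Measure (EuclideanSpace ℝ (Fin d))}
    [IsFiniteMeasure μ] (hμ0 : μ univ ≠ 0) (hμκ : μ + κ = volume) :
    ∃ u φ : EuclideanSpace ℝ (Fin d) → ℝ, Measurable u ∧ Measurable φ ∧
      (∀ x, 0 ≤ φ x) ∧ (∀ x, φ x ≤ u x) ∧ (∀ x y, φ x ≤ u y + K ‖y - x‖) ∧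
      (∃ C, ∀ x, u x ≤ C) ∧ ∫⁻ x, ENNReal.ofReal (u x) ≠ ∞ ∧
      (⨅ γ ∈ plansTo μ κ, ∫⁻ p, ENNReal.ofReal (K ‖p.2 - p.1‖) ∂γ) +
        ∫⁻ x, ENNReal.ofReal (u x) ∂κ ≤ ∫⁻ x, ENNReal.ofReal (φ x) ∂μ := by
  have hμle : μ ≤ volume := by rw [← hμκ]; exact le_add_of_nonneg_right (Measure.zero_le _)
  have hκle : κ ≤ volume := by rw [← hμκ]; exact le_add_of_nonneg_left (Measure.zero_le _)
  have : SigmaFinite κ := Measure.sigmaFinite_of_le volume hκle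
  have : IsLocallyFiniteMeasure κ := Measure.isLocallyFiniteMeasure_of_le hκle
  have hKpos : ∀ r, 0 ≤ r → 0 ≤ K r := fun r hr => hK0 ▸ hKm hr
  obtain ⟨L, hL0, hL3⟩ : ∃ L : ℝ, 0 < L ∧ 3 * μ univ ≤ ENNReal.ofReal (L ^ d) := by
    refine ⟨max 1 (3 * μ.real univ), by positivity, ?_⟩
    calc 3 * μ univ = ENNReal.ofReal (3 * μ.real univ) := by
          rw [ENNReal.ofReal_mul (by norm_num), ofReal_measureReal (measure_ne_top _ _)]; norm_num
      _ ≤ _ := ENNReal.ofReal_le_ofReal ((le_max_right _ _).trans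
          (le_self_pow₀ (le_max_left _ _) (by omega)))
  obtain ⟨q, hq, hqv, hqd⟩ := exists_cube_partition d hL0
  set R : ℝ := √d * L with hR
  have hR0 : 0 ≤ R := by positivity
  set C : ℝ := K R with hC
  have hC0 : 0 ≤ C := hKpos R hR0
  set g : EuclideanSpace ℝ (Fin d) × EuclideanSpace ℝ (Fin d) → ℝ≥0∞ :=
    fun p => ENNReal.ofReal (C - K ‖p.2 - p.1‖) with hg
  have hnogap := minCost_add_gain_le hq hμ0 hμκ (fun n => by rw [hqv]; exact hL3)
    (fun n => by rw [hqv]; exact ofReal_ne_top)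
    (c := fun p : EuclideanSpace ℝ (Fin d) × EuclideanSpace ℝ (Fin d) => K ‖p.2 - p.1‖)
    (by fun_prop) (fun p => hKpos _ (norm_nonneg _)) (C := C)
    (fun p hp => hKm (hqd _ _ hp))
  have hgainfin : gain g μ κ ≠ ∞ := ne_top_of_le_ne_top
    (ENNReal.mul_ne_top ofReal_ne_top (measure_ne_top μ univ)) (le_add_self.trans hnogap)
  obtain ⟨a, b, ha0, hb0, haadd, hbadd, hab, hdual⟩ :=
    exists_additive_dual (g := g) (μ := μ) (κ := κ) (M := ENNReal.ofReal C) ofReal_ne_top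
      (fun p => ENNReal.ofReal_le_ofReal (by
        have := hKpos _ (norm_nonneg (p.2 - p.1)); linarith))
  -- the indexing set of small sets with a centre and a radius
  set I : Set (Set (EuclideanSpace ℝ (Fin d)) × EuclideanSpace ℝ (Fin d) × ℝ) :=
    {i | MeasurableSet i.1 ∧ 0 < μ.real i.1 ∧ 0 ≤ i.2.2 ∧ ∀ x ∈ i.1, ‖x - i.2.1‖ ≤ i.2.2} with hI
  set val : Set (EuclideanSpace ℝ (Fin d)) × EuclideanSpace ℝ (Fin d) × ℝ →
    EuclideanSpace ℝ (Fin d) → ℝ :=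
    fun i y => C - a i.1 / μ.real i.1 - K (‖y - i.2.1‖ + i.2.2) with hval
  set u : EuclideanSpace ℝ (Fin d) → ℝ := fun y => sSup (insert 0 ((fun i => val i y) '' I)) with hu
  have hΦC : ∀ i ∈ I, C - a i.1 / μ.real i.1 ≤ C := fun i hi => by
    have : 0 ≤ a i.1 / μ.real i.1 := div_nonneg (ha0 _ hi.1) hi.2.1.le
    linarith
  have hvalC : ∀ i ∈ I, ∀ y, val i y ≤ C := fun i hi y => by
    have := hKpos (‖y - i.2.1‖ + i.2.2) (add_nonneg (norm_nonneg _) hi.2.2.1)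
    have := hΦC i hi
    simp only [hval]; linarith
  have hbdd : ∀ y, BddAbove (insert 0 ((fun i => val i y) '' I)) := fun y => by
    refine ⟨C, ?_⟩
    rintro _ (rfl | ⟨i, hi, rfl⟩)
    · exact hC0
    · exact hvalC i hi y
  have hu0 : ∀ y, 0 ≤ u y := fun y => le_csSup (hbdd y) (mem_insert _ _)
  have hule : ∀ y v, 0 ≤ v → (∀ i ∈ I, val i y ≤ v) → u y ≤ v := fun y v hv h => by
    refine csSup_le (insert_nonempty _ _) ?_
    rintro _ (rfl | ⟨i, hi, rfl⟩)
    · exact hv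
    · exact h i hi
  have hvalu : ∀ i ∈ I, ∀ y, val i y ≤ u y := fun i hi y =>
    le_csSup (hbdd y) (mem_insert_of_mem _ ⟨i, hi, rfl⟩)
  have huC : ∀ y, u y ≤ C := fun y => hule y C hC0 fun i hi => hvalC i hi y
  have hum : Measurable u := by
    refine measurable_of_Ioi fun t => ?_
    have : u ⁻¹' Ioi t = {_y | t < 0} ∪ ⋃ i ∈ I, {y | t < val i y} := by
      ext y
      simp only [mem_preimage, mem_Ioi, hu, lt_csSup_iff (hbdd y) (insert_nonempty _ _),
        mem_union, mem_iUnion, mem_insert_iff, mem_image, mem_ofPred_eq, exists_prop]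
      constructor
      · rintro ⟨_, rfl | ⟨i, hi, rfl⟩, h⟩
        · exact Or.inl h
        · exact Or.inr ⟨i, hi, h⟩
      · rintro (h | ⟨i, hi, h⟩)
        · exact ⟨0, Or.inl rfl, h⟩
        · exact ⟨_, Or.inr ⟨i, hi, rfl⟩, h⟩
    rw [this]
    refine (IsOpen.union isOpen_const (isOpen_biUnion fun i _ => ?_)).measurableSet
    exact isOpen_lt continuous_const (by simp only [hval]; fun_prop)
  set φ : EuclideanSpace ℝ (Fin d) → ℝ := fun x => ⨅ y, (u y + K ‖y - x‖) with hφ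
  have hterm0 : ∀ x y, 0 ≤ u y + K ‖y - x‖ := fun x y =>
    add_nonneg (hu0 y) (hKpos _ (norm_nonneg _))
  have hφbdd : ∀ x, BddBelow (range fun y => u y + K ‖y - x‖) := fun x =>
    ⟨0, by rintro _ ⟨y, rfl⟩; exact hterm0 x y⟩
  have hφle : ∀ x y, φ x ≤ u y + K ‖y - x‖ := fun x y => ciInf_le (hφbdd x) y
  have hφ0 : ∀ x, 0 ≤ φ x := fun x => le_ciInf (hterm0 x)
  have hφu : ∀ x, φ x ≤ u x := fun x => by simpa [hK0] using hφle x x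
  have hφm : Measurable φ := by
    refine measurable_of_Iio fun t => ?_
    have : φ ⁻¹' Iio t = ⋃ y, {x | u y + K ‖y - x‖ < t} := by
      ext x
      simp only [mem_preimage, mem_Iio, hφ, ciInf_lt_iff (hφbdd x), mem_iUnion, mem_ofPred_eq]
    rw [this]
    exact (isOpen_iUnion fun y => isOpen_lt (by fun_prop) continuous_const).measurableSet
  -- uniform continuity of the cost profile on bounded intervals
  have hunif : ∀ ε > 0, ∃ δ > 0, ∀ r, 0 ≤ r → r ≤ R → K (r + δ) ≤ K r + ε := by
    intro ε hε
    have huc := (isCompact_Icc (a := (0 : ℝ)) (b := R + 1)).uniformContinuousOn_of_continuous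
      hKc.continuousOn
    obtain ⟨δ, hδ, h⟩ := Metric.uniformContinuousOn_iff.1 huc ε hε
    refine ⟨min (δ / 2) 1, by positivity, fun r hr0 hr => ?_⟩
    have h1 : min (δ / 2) 1 ≤ 1 := min_le_right _ _
    have h2 : min (δ / 2) 1 ≤ δ / 2 := min_le_left _ _
    have h3 : 0 < min (δ / 2) 1 := by positivity
    have := h (r + min (δ / 2) 1) ⟨by linarith, by linarith⟩ r ⟨hr0, by linarith⟩ (by
      rw [Real.dist_eq, add_sub_cancel_left, abs_of_pos h3]; linarith)
    rw [Real.dist_eq] at this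
    have := le_abs_self (K (r + min (δ / 2) 1) - K r)
    linarith
  have hIu : ∫⁻ x, ENNReal.ofReal (u x) ∂κ ≤ ENNReal.ofReal (b univ) := by
    refine lintegral_le_of_additive hb0 hbadd fun ε hε => ?_
    obtain ⟨δ, hδ, hδK⟩ := hunif ε hε
    refine ⟨δ, hδ, fun T hT hTpos hTd y hy => ?_⟩
    have hbT : 0 ≤ b T / κ.real T := div_nonneg (hb0 T hT) hTpos.le
    refine hule y _ (by positivity) fun i hi => ?_
    set ρ := ‖y - i.2.1‖ + i.2.2 with hρ
    have hρ0 : 0 ≤ ρ := add_nonneg (norm_nonneg _) hi.2.2.1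
    rcases le_total R ρ with h | h
    · have := hKm h
      have := hΦC i hi
      simp only [hval]; linarith
    · have h1 := hdual i.1 T (C - K (ρ + δ)) hi.1 hT hi.2.1 hTpos fun x hx y' hy' => by
        refine ENNReal.ofReal_le_ofReal (sub_le_sub_left (hKm ?_) _)
        have e1 : y' - x = (y' - y) + (y - i.2.1) + (i.2.1 - x) := by abel
        have h2 := hi.2.2.2 x hx
        have h3 := hTd y hy y' hy'
        rw [norm_sub_rev] at h2
        show ‖y' - x‖ ≤ ρ + δ
        rw [e1]
        have := norm_add₃_le (a := y' - y) (b := y - i.2.1) (c := i.2.1 - x)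
        linarith
      have h2 := hδK ρ hρ0 h
      simp only [hval]; linarith
  have hIφ : ∫⁻ x, ENNReal.ofReal (C - φ x) ∂μ ≤ ENNReal.ofReal (a univ) := by
    refine lintegral_le_of_additive ha0 haadd fun ε hε => ?_
    obtain ⟨δ, hδ, hδK⟩ := hunif ε hε
    refine ⟨δ, hδ, fun S hS hSpos hSd x hx => ?_⟩
    have hi : (S, x, δ) ∈ I := ⟨hS, hSpos, hδ.le, fun y hy => hSd x hx y hy⟩
    have : C - a S / μ.real S - ε ≤ φ x := by
      refine le_ciInf fun y => ?_
      rcases le_total R ‖y - x‖ with h | h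
      · have h1 := hKm h
        have h2 := hΦC _ hi
        have h3 := hu0 y
        simp only at h2
        linarith
      · have h1 := hvalu _ hi y
        have h2 := hδK ‖y - x‖ (norm_nonneg _) h
        simp only [hval] at h1
        linarith
    linarith
  have hφC : ∀ x, φ x ≤ C := fun x => (hφu x).trans (huC x)
  have hCsplit : ENNReal.ofReal C * μ univ =
      ∫⁻ x, ENNReal.ofReal (C - φ x) ∂μ + ∫⁻ x, ENNReal.ofReal (φ x) ∂μ := by
    rw [← lintegral_add_left (by fun_prop), ← lintegral_const]
    congr 1
    funext x
    rw [← ENNReal.ofReal_add (by have := hφC x; linarith) (hφ0 x)]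
    simp
  have hmain : (⨅ γ ∈ plansTo μ κ, ∫⁻ p, ENNReal.ofReal (K ‖p.2 - p.1‖) ∂γ) +
      ∫⁻ x, ENNReal.ofReal (u x) ∂κ ≤ ∫⁻ x, ENNReal.ofReal (φ x) ∂μ := by
    have hfin : ∫⁻ x, ENNReal.ofReal (C - φ x) ∂μ ≠ ∞ := ne_top_of_le_ne_top ofReal_ne_top hIφ
    rw [← ENNReal.add_le_add_iff_left hfin, ← hCsplit]
    refine le_trans ?_ hnogap
    calc _ = (⨅ γ ∈ plansTo μ κ, ∫⁻ p, ENNReal.ofReal (K ‖p.2 - p.1‖) ∂γ) +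
          (∫⁻ x, ENNReal.ofReal (C - φ x) ∂μ + ∫⁻ x, ENNReal.ofReal (u x) ∂κ) := by ring
      _ ≤ (⨅ γ ∈ plansTo μ κ, ∫⁻ p, ENNReal.ofReal (K ‖p.2 - p.1‖) ∂γ) + gain g μ κ := by
        gcongr
        calc _ ≤ ENNReal.ofReal (a univ) + ENNReal.ofReal (b univ) := add_le_add hIφ hIu
          _ = ENNReal.ofReal (a univ + b univ) :=
            (ENNReal.ofReal_add (ha0 _ .univ) (hb0 _ .univ)).symm
          _ ≤ ENNReal.ofReal (gain g μ κ).toReal := ENNReal.ofReal_le_ofReal hab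
          _ = gain g μ κ := ENNReal.ofReal_toReal hgainfin
  refine ⟨u, φ, hum, hφm, hφ0, hφu, hφle, ⟨C, huC⟩, ?_, hmain⟩
  rw [← hμκ, lintegral_add_measure]
  refine ENNReal.add_ne_top.2 ⟨?_, ne_top_of_le_ne_top ofReal_ne_top hIu⟩
  refine ne_top_of_le_ne_top (b := ENNReal.ofReal C * μ univ)
    (ENNReal.mul_ne_top ofReal_ne_top (measure_ne_top _ _)) ?_
  rw [← lintegral_const]
  exact lintegral_mono fun x => ENNReal.ofReal_le_ofReal (huC x)

/-- The volume of a Euclidean ball of radius `r`. -/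
def ballVol (d : ℕ) (r : ℝ) : ℝ≥0∞ := volume (Metric.ball (0 : Rd d) r)

lemma volume_ball_eq_ballVol {d : ℕ} (z : Rd d) (r : ℝ) :
    volume (Metric.ball z r) = ballVol d r := Measure.addHaar_ball_center _ _ _

lemma ballVol_ne_top (d : ℕ) (r : ℝ) : ballVol d r ≠ ∞ := measure_ball_lt_top.ne

lemma ballVol_one_ne_zero (d : ℕ) : ballVol d 1 ≠ 0 :=
  (Metric.measure_ball_pos _ _ one_pos).ne'

lemma ballVol_eq {d : ℕ} (hd : 1 ≤ d) (r : ℝ) :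
    ballVol d r = ENNReal.ofReal ((max r 0) ^ d) * ballVol d 1 := by
  have : Nonempty (Fin d) := ⟨⟨0, hd⟩⟩
  rcases le_total 0 r with h | h
  · rw [max_eq_left h, ballVol, Measure.addHaar_ball _ _ h]
    simp [ballVol]
  · rw [max_eq_right h, ballVol, Metric.ball_eq_empty.2 h, zero_pow (by omega)]
    simp

lemma ballVol_mono (d : ℕ) : Monotone (ballVol d) := fun _ _ h =>
  measure_mono (Metric.ball_subset_ball h)

lemma ballVol_strictMonoOn {d : ℕ} (hd : 1 ≤ d) : StrictMonoOn (ballVol d) (Ici 0) := by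
  intro r hr s hs hrs
  rw [ballVol_eq hd r, ballVol_eq hd s, max_eq_left hr, max_eq_left hs]
  refine ENNReal.mul_lt_mul_left (ballVol_one_ne_zero d) (ballVol_ne_top d 1) ?_
  have hr' : (0 : ℝ) ≤ r := hr
  exact (ENNReal.ofReal_lt_ofReal_iff (pow_pos (hr'.trans_lt hrs) d)).2
    (pow_lt_pow_left₀ hrs hr (by omega))

lemma ballVol_lt_iff {d : ℕ} (hd : 1 ≤ d) {r s : ℝ} (hr : 0 ≤ r) :
    ballVol d r < ballVol d s ↔ r < s :=
  ⟨fun h => lt_of_not_ge fun h' => h.not_ge (ballVol_mono d h'),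
    fun h => ballVol_strictMonoOn hd hr (hr.trans h.le) h⟩

lemma continuous_ballVol {d : ℕ} (hd : 1 ≤ d) : Continuous (ballVol d) := by
  rw [funext (ballVol_eq hd)]
  exact ENNReal.continuous_mul_const (ballVol_ne_top d 1) |>.comp
    (ENNReal.continuous_ofReal.comp (by fun_prop))

lemma exists_ballVol_eq {d : ℕ} (hd : 1 ≤ d) {A : ℝ≥0∞} (hA : A ≠ ∞) :
    ∃ s, 0 ≤ s ∧ ballVol d s = A := by
  set x := (A / ballVol d 1).toReal with hx
  have hx0 : 0 ≤ x := ENNReal.toReal_nonneg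
  refine ⟨x ^ ((1 : ℝ) / d), by positivity, ?_⟩
  rw [ballVol_eq hd, max_eq_left (by positivity), ← Real.rpow_natCast, ← Real.rpow_mul hx0,
    one_div_mul_cancel (by positivity), Real.rpow_one, hx, ENNReal.ofReal_toReal
      (ENNReal.div_ne_top hA (ballVol_one_ne_zero d)),
    ENNReal.div_mul_cancel (ballVol_one_ne_zero d) (ballVol_ne_top d 1)]

lemma setOf_ballVol_lt {d : ℕ} (hd : 1 ≤ d) (z : Rd d) (s : ℝ) :
    {x | ballVol d ‖x - z‖ < ballVol d s} = Metric.ball z s := by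
  ext x
  rw [mem_ofPred_eq, ballVol_lt_iff hd (norm_nonneg _), mem_ball_iff_norm]

/-- Symmetric decreasing rearrangement, as a function of the radius. -/
def rearr {d : ℕ} (g : Rd d → ℝ) (r : ℝ) : ℝ :=
  sSup {t | 0 ≤ t ∧ (t = 0 ∨ ballVol d r < volume {x | t < g x})}

section rearr
variable {d : ℕ} {g : Rd d → ℝ}

lemma rearr_bddAbove (hg : ∃ C, ∀ x, g x ≤ C) (r : ℝ) :
    BddAbove {t | 0 ≤ t ∧ (t = 0 ∨ ballVol d r < volume {x | t < g x})} := by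
  obtain ⟨C, hC⟩ := hg
  refine ⟨max 0 C, ?_⟩
  rintro t ⟨-, rfl | h⟩
  · exact le_max_left _ _
  · refine le_of_not_gt fun h' => ?_
    have : {x | t < g x} = ∅ := eq_empty_iff_forall_notMem.2 fun x hx =>
      (((hC x).trans (le_max_right 0 C)).trans_lt (h'.trans hx)).false
    simp [this] at h

lemma rearr_nonneg (hg : ∃ C, ∀ x, g x ≤ C) (r : ℝ) : 0 ≤ rearr g r :=
  le_csSup (rearr_bddAbove hg r) ⟨le_rfl, Or.inl rfl⟩

lemma lt_rearr_iff (hg : ∃ C, ∀ x, g x ≤ C) {t r : ℝ} (ht : 0 ≤ t) :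
    t < rearr g r ↔ ballVol d r < volume {x | t < g x} := by
  rw [rearr, lt_csSup_iff (rearr_bddAbove hg r) ⟨0, le_rfl, Or.inl rfl⟩]
  constructor
  · rintro ⟨t', ⟨-, rfl | h⟩, h'⟩
    · exact absurd h' ht.not_gt
    · exact h.trans_le (measure_mono fun x hx => h'.trans hx)
  · intro h
    have hU : {x | t < g x} = ⋃ n : ℕ, {x | t + 1 / ((n : ℝ) + 1) < g x} := by
      ext x
      simp only [mem_ofPred_eq, mem_iUnion]
      constructor
      · intro hx
        obtain ⟨n, hn⟩ := exists_nat_one_div_lt (sub_pos.2 hx)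
        exact ⟨n, by linarith⟩
      · rintro ⟨n, hn⟩
        have : (0 : ℝ) < 1 / ((n : ℝ) + 1) := by positivity
        linarith
    have hmono : Monotone fun n : ℕ => {x | t + 1 / ((n : ℝ) + 1) < g x} := by
      intro n n' hn x hx
      refine lt_of_le_of_lt ?_ (show t + 1 / ((n : ℝ) + 1) < g x from hx)
      gcongr
    rw [hU, hmono.measure_iUnion, lt_iSup_iff] at h
    obtain ⟨n, hn⟩ := h
    have : (0 : ℝ) < 1 / ((n : ℝ) + 1) := by positivity
    exact ⟨_, ⟨by linarith, Or.inr hn⟩, by linarith⟩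

lemma rearr_antitone (hg : ∃ C, ∀ x, g x ≤ C) : Antitone (rearr g) := fun r _ hrs =>
  csSup_le_csSup (rearr_bddAbove hg r) ⟨0, le_rfl, Or.inl rfl⟩ fun _ ht =>
    ⟨ht.1, ht.2.imp id ((ballVol_mono d hrs).trans_lt)⟩

lemma rearr_lowerSemicontinuous (hd : 1 ≤ d) (hg : ∃ C, ∀ x, g x ≤ C) :
    LowerSemicontinuous (rearr g) := by
  rw [lowerSemicontinuous_iff_isOpen_preimage]
  intro t
  rcases lt_or_ge t 0 with ht | ht
  · have : rearr g ⁻¹' Ioi t = univ := eq_univ_of_forall fun r => ht.trans_le (rearr_nonneg hg r)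
    rw [this]; exact isOpen_univ
  · have : rearr g ⁻¹' Ioi t = {r | ballVol d r < volume {x | t < g x}} := by
      ext r
      rw [mem_preimage, mem_Ioi, lt_rearr_iff hg ht, mem_ofPred_eq]
    rw [this]
    exact isOpen_lt (continuous_ballVol hd) continuous_const

lemma rearr_mono {h : Rd d → ℝ} (hh : ∃ C, ∀ x, h x ≤ C) (hgh : ∀ x, g x ≤ h x) (r : ℝ) :
    rearr g r ≤ rearr h r :=
  csSup_le_csSup (rearr_bddAbove hh r) ⟨0, le_rfl, Or.inl rfl⟩ fun _ ht =>
    ⟨ht.1, ht.2.imp id fun h' => h'.trans_le (measure_mono fun x hx => lt_of_lt_of_le hx (hgh x))⟩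

lemma setOf_lt_rearr (hg : ∃ C, ∀ x, g x ≤ C) (z : Rd d) {t : ℝ} (ht : 0 ≤ t) :
    {x | t < rearr g ‖x - z‖} = {x | ballVol d ‖x - z‖ < volume {x | t < g x}} := by
  ext x
  rw [mem_ofPred_eq, lt_rearr_iff hg ht, mem_ofPred_eq]

lemma measurable_rearr_norm (hg : ∃ C, ∀ x, g x ≤ C) (z : Rd d) :
    Measurable fun x => rearr g ‖x - z‖ :=
  (rearr_antitone hg).measurable.comp (by fun_prop)

lemma ball_inter_superlevel (hd : 1 ≤ d) (z : Rd d) (R : ℝ) (A : ℝ≥0∞) :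
    volume (Metric.ball z R ∩ {x | ballVol d ‖x - z‖ < A}) = min (ballVol d R) A := by
  rcases le_total (ballVol d R) A with h | h
  · rw [min_eq_left h, inter_eq_left.2, volume_ball_eq_ballVol]
    rw [← setOf_ballVol_lt hd]
    exact fun x hx => lt_of_lt_of_le hx h
  · obtain ⟨s, hs, rfl⟩ := exists_ballVol_eq hd (ne_top_of_le_ne_top (ballVol_ne_top d R) h)
    rw [min_eq_right h, setOf_ballVol_lt hd, inter_eq_right.2, volume_ball_eq_ballVol]
    rw [← setOf_ballVol_lt hd, ← setOf_ballVol_lt hd]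
    exact fun x hx => lt_of_lt_of_le hx h

/-- Rearranging increases integrals against densities bounded by one. -/
lemma lintegral_le_rearr (hd : 1 ≤ d) (hg0 : ∀ x, 0 ≤ g x) (hgm : Measurable g)
    (hg : ∃ C, ∀ x, g x ≤ C) {μ : Measure (Rd d)} (hμ : μ ≤ volume) {R : ℝ}
    (hμR : μ univ = ballVol d R) (z : Rd d) :
    ∫⁻ x, ENNReal.ofReal (g x) ∂μ ≤
        ∫⁻ x in Metric.ball z R, ENNReal.ofReal (rearr g ‖x - z‖) ∧
    (∫⁻ x in Metric.ball z R, ENNReal.ofReal (rearr g ‖x - z‖) ≤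
        ∫⁻ x, ENNReal.ofReal (g x) ∂μ → ∫⁻ x, ENNReal.ofReal (g x) ∂μ ≠ ∞ →
      ∀ᵐ t ∂(volume.restrict (Ioi (0 : ℝ))),
        μ {x | t < g x} = min (ballVol d R) (volume {x | t < g x})) := by
  have e1 : ∫⁻ x, ENNReal.ofReal (g x) ∂μ = ∫⁻ t in Ioi (0 : ℝ), μ {x | t < g x} :=
    lintegral_eq_lintegral_meas_lt _ (ae_of_all _ hg0) hgm.aemeasurable
  have e2 : ∫⁻ x in Metric.ball z R, ENNReal.ofReal (rearr g ‖x - z‖) =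
      ∫⁻ t in Ioi (0 : ℝ), min (ballVol d R) (volume {x | t < g x}) := by
    rw [lintegral_eq_lintegral_meas_lt _ (ae_of_all _ fun x => rearr_nonneg hg _)
      (measurable_rearr_norm hg z).aemeasurable]
    refine setLIntegral_congr_fun measurableSet_Ioi fun t ht => ?_
    rw [Measure.restrict_apply (measurableSet_lt measurable_const (measurable_rearr_norm hg z)),
      inter_comm, setOf_lt_rearr hg z (le_of_lt ht), ball_inter_superlevel hd]
  have hle : ∀ t, μ {x | t < g x} ≤ min (ballVol d R) (volume {x | t < g x}) := fun t =>
    le_min (hμR ▸ measure_mono (subset_univ _)) (hμ _)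
  have hanti : ∀ ν : Measure (Rd d), Antitone fun t => ν {x | t < g x} := fun ν t t' htt' =>
    measure_mono fun x hx => lt_of_le_of_lt htt' hx
  refine ⟨by rw [e1, e2]; exact lintegral_mono hle, fun h hfin => ?_⟩
  rw [e1] at hfin
  rw [e1, e2] at h
  exact ae_eq_of_ae_le_of_lintegral_le (ae_of_all _ hle) hfin
    ((measurable_const.min (hanti _).measurable).aemeasurable) h

/-- Rearranging decreases integrals outside the ball. -/
lemma rearr_compl_le (hd : 1 ≤ d) (hg0 : ∀ x, 0 ≤ g x) (hgm : Measurable g)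
    (hg : ∃ C, ∀ x, g x ≤ C) (hgfin : ∀ t, 0 < t → volume {x | t < g x} ≠ ∞)
    {μ κ : Measure (Rd d)} (hμκ : μ + κ = volume) {R : ℝ}
    (hμR : μ univ = ballVol d R) (z : Rd d) :
    ∫⁻ x in (Metric.ball z R)ᶜ, ENNReal.ofReal (rearr g ‖x - z‖) ≤
      ∫⁻ x, ENNReal.ofReal (g x) ∂κ := by
  rw [lintegral_eq_lintegral_meas_lt _ (ae_of_all _ fun x => rearr_nonneg hg _)
      (measurable_rearr_norm hg z).aemeasurable,
    lintegral_eq_lintegral_meas_lt _ (ae_of_all _ hg0) hgm.aemeasurable]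
  refine setLIntegral_mono' measurableSet_Ioi fun t ht => ?_
  rw [Measure.restrict_apply (measurableSet_lt measurable_const (measurable_rearr_norm hg z)),
    setOf_lt_rearr hg z (le_of_lt ht)]
  obtain ⟨s, hs, hsA⟩ := exists_ballVol_eq hd (hgfin t ht)
  rw [← hsA, setOf_ballVol_lt hd, ← sdiff_eq]
  rcases le_total s R with h | h
  · rw [sdiff_eq_empty.2 (Metric.ball_subset_ball h)]
    simp
  · rw [measure_sdiff (Metric.ball_subset_ball h) measurableSet_ball.nullMeasurableSet
      measure_ball_lt_top.ne, volume_ball_eq_ballVol, volume_ball_eq_ballVol, hsA,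
      tsub_le_iff_left, ← hμκ, Measure.add_apply, ← hμR]
    gcongr
    exact subset_univ _

/-- The rearranged potentials are admissible for the radial problem. -/
lemma rearr_le_rearr_add (hd : 1 ≤ d) {K : ℝ → ℝ} (hKm : Monotone K) (hK0 : K 0 = 0)
    {u φ : Rd d → ℝ} (hum : Measurable u) (hφm : Measurable φ) (hu : ∃ C, ∀ x, u x ≤ C)
    (hφu : ∀ x, φ x ≤ u x) (hφ : ∀ x y, φ x ≤ u y + K ‖y - x‖) {r s : ℝ} (hr : 0 ≤ r)
    (hrs : r ≤ s) : rearr φ r ≤ rearr u s + K (s - r) := by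
  rcases hrs.eq_or_lt with rfl | hrs
  · rw [sub_self, hK0, add_zero]; exact rearr_mono hu hφu r
  have hφb : ∃ C, ∀ x, φ x ≤ C := hu.imp fun C hC x => (hφu x).trans (hC x)
  refine le_of_not_gt fun hlt => ?_
  obtain ⟨t, ht1, ht2⟩ := exists_between hlt
  have hKpos : 0 ≤ K (s - r) := hK0 ▸ hKm (sub_nonneg.2 hrs.le)
  have hu0 := rearr_nonneg hu s
  rw [lt_rearr_iff hφb (by linarith)] at ht2
  obtain ⟨r', hr'0, hr'⟩ := exists_ballVol_eq hd (A := min (volume {x | t < φ x})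
    (ballVol d (r + 1))) (ne_top_of_le_ne_top (ballVol_ne_top d _) (min_le_right _ _))
  have hrr' : r < r' := by
    rw [← ballVol_lt_iff hd hr, hr']
    exact lt_min ht2 ((ballVol_lt_iff hd hr).2 (by linarith))
  have h1 := volume_ball_add_le (E := {x | t < φ x}) (C := {x | t - K (s - r) < u x}) hr'0
    (sub_pos.2 hrs) (measurableSet_lt measurable_const hφm) (measurableSet_lt measurable_const hum)
    (nonempty_of_measure_ne_zero (bot_lt_of_lt ht2).ne') (hr'.le.trans (min_le_left _ _))
    (fun x hx y hy => by
      have h2 := hφ x y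
      have h3 := hKm hy.le
      have h4 : t < φ x := hx
      show t - K (s - r) < u y
      linarith)
  have h2 : rearr u s < t - K (s - r) := by linarith
  refine absurd ((lt_rearr_iff hu (by linarith)).2 (lt_of_lt_of_le ?_ h1)) h2.not_gt
  exact (ballVol_lt_iff hd (hr.trans hrs.le)).2 (by linarith)

end rearr

/-- The least radial transport cost from `μ` to a measure dominated by `κ`. -/
def minCost {d : ℕ} (K : ℝ → ℝ) (μ κ : Measure (Rd d)) : ℝ≥0∞ :=
  ⨅ γ ∈ plansTo μ κ, ∫⁻ p, ENNReal.ofReal (K ‖p.2 - p.1‖) ∂γ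

section
variable {d : ℕ} {K : ℝ → ℝ}

lemma plansTo_ball_ae {z : Rd d} {R : ℝ} {γ : Measure (Rd d × Rd d)}
    (hγ : γ ∈ plansTo (volume.restrict (Metric.ball z R)) (volume.restrict (Metric.ball z R)ᶜ)) :
    ∀ᵐ p ∂γ, ‖p.1 - z‖ < R ∧ R ≤ ‖p.2 - z‖ := by
  have h1 : ∀ᵐ x ∂(γ.map Prod.fst), x ∈ Metric.ball z R := by
    rw [hγ.1]; exact ae_restrict_mem measurableSet_ball
  have h2 : ∀ᵐ x ∂(γ.map Prod.snd), x ∈ (Metric.ball z R)ᶜ :=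
    (Measure.absolutelyContinuous_of_le hγ.2).ae_le (ae_restrict_mem measurableSet_ball.compl)
  filter_upwards [ae_of_ae_map measurable_fst.aemeasurable h1,
    ae_of_ae_map measurable_snd.aemeasurable h2] with p hp hp'
  exact ⟨mem_ball_iff_norm.1 hp, not_lt.1 fun h => hp' (mem_ball_iff_norm.2 h)⟩

lemma lintegral_ball_le_of_radial (hKm : Monotone K) {ψ w : ℝ → ℝ} (hψ : Measurable ψ)
    (hw : Measurable w) (hw0 : ∀ s, 0 ≤ w s) (hK0 : ∀ r, 0 ≤ r → 0 ≤ K r) {z : Rd d} {R : ℝ}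
    (h : ∀ r s, 0 ≤ r → r < R → R ≤ s → ψ r ≤ w s + K (s - r)) :
    ∫⁻ x in Metric.ball z R, ENNReal.ofReal (ψ ‖x - z‖) ≤
      minCost K (volume.restrict (Metric.ball z R)) (volume.restrict (Metric.ball z R)ᶜ) +
      ∫⁻ y in (Metric.ball z R)ᶜ, ENNReal.ofReal (w ‖y - z‖) := by
  rw [← tsub_le_iff_right, minCost]
  refine le_iInf₂ fun γ hγ => ?_
  rw [tsub_le_iff_right, ← hγ.1, lintegral_map (by fun_prop) measurable_fst]
  have hwm : Measurable fun y : Rd d => ENNReal.ofReal (w ‖y - z‖) :=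
    (hw.comp (by fun_prop : Measurable fun y : Rd d => ‖y - z‖)).ennreal_ofReal
  calc ∫⁻ p, ENNReal.ofReal (ψ ‖p.1 - z‖) ∂γ
      ≤ ∫⁻ p, (ENNReal.ofReal (K ‖p.2 - p.1‖) + ENNReal.ofReal (w ‖p.2 - z‖)) ∂γ := by
        refine lintegral_mono_ae ?_
        filter_upwards [plansTo_ball_ae hγ] with p hp
        rw [← ENNReal.ofReal_add (hK0 _ (norm_nonneg _)) (hw0 _)]
        refine ENNReal.ofReal_le_ofReal ?_
        have h1 := h _ _ (norm_nonneg _) hp.1 hp.2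
        have h2 : ‖p.2 - z‖ - ‖p.1 - z‖ ≤ ‖p.2 - p.1‖ := by
          have := norm_sub_norm_le (p.2 - z) (p.1 - z)
          rwa [sub_sub_sub_cancel_right] at this
        have := hKm h2
        linarith
    _ = ∫⁻ p, ENNReal.ofReal (K ‖p.2 - p.1‖) ∂γ + ∫⁻ y, ENNReal.ofReal (w ‖y - z‖) ∂(γ.map Prod.snd) := by
        have hwm' : Measurable fun p : Rd d × Rd d => ENNReal.ofReal (w ‖p.2 - z‖) :=
          hwm.comp measurable_snd
        rw [lintegral_add_right _ hwm', lintegral_map hwm measurable_snd]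
    _ ≤ _ := by
        gcongr
        exact hγ.2

lemma measure_lt_ne_top_of_lintegral {X : Type*} [MeasurableSpace X] {ν : Measure X} {u : X → ℝ}
    (hum : Measurable u) (h : ∫⁻ x, ENNReal.ofReal (u x) ∂ν ≠ ∞) {t : ℝ} (ht : 0 < t) :
    ν {x | t < u x} ≠ ∞ := by
  have h1 := meas_ge_le_lintegral_div (μ := ν) (f := fun x => ENNReal.ofReal (u x))
    hum.ennreal_ofReal.aemeasurable (ENNReal.ofReal_pos.2 ht).ne' ofReal_ne_top
  refine ne_top_of_le_ne_top (ENNReal.div_ne_top h (ENNReal.ofReal_pos.2 ht).ne')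
    ((measure_mono fun x hx => ?_).trans h1)
  exact ENNReal.ofReal_le_ofReal (le_of_lt hx)

/-- A superlevel set of the optimal potential at a contact radius is a ball on which all the mass
sits. -/
lemma exists_null_ball_of_contact (hd : 1 ≤ d) (hKc : Continuous K) (hKm : Monotone K)
    (hKs : StrictMonoOn K (Ici 0)) (hK0 : K 0 = 0) (hKt : Tendsto K atTop atTop)
    {μ κ : Measure (Rd d)} (hμκ : μ + κ = volume)
    {u φ : Rd d → ℝ} (hum : Measurable u) (hφm : Measurable φ)
    (hub : ∃ C, ∀ x, u x ≤ C) (hφu : ∀ x, φ x ≤ u x) (hφ : ∀ x y, φ x ≤ u y + K ‖y - x‖)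
    (hfin : ∀ t, 0 < t → volume {x | t < u x} ≠ ∞) {R : ℝ}
    (hmin : ∀ᵐ t ∂(volume.restrict (Ioi (0 : ℝ))),
        μ {x | t < φ x} = min (ballVol d R) (volume {x | t < φ x}))
    {r : ℝ} (hr : 0 < r) (hrR : r < R)
    (hcontact : ∀ v, (∀ s, R ≤ s → v ≤ rearr u s + K (s - r)) → v ≤ rearr φ r) :
    ∃ z, κ (Metric.ball z r) = 0 := by
  have hφb : ∃ C, ∀ x, φ x ≤ C := hub.imp fun C hC x => (hφu x).trans (hC x)
  set F : ℝ → ℝ := fun s => rearr u s + K (s - r) with hF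
  have hFlsc : LowerSemicontinuous F := (rearr_lowerSemicontinuous hd hub).add
    (by fun_prop : Continuous fun s => K (s - r)).lowerSemicontinuous
  obtain ⟨S, hRS, hS⟩ : ∃ S, R ≤ S ∧ F R ≤ K (S - r) := by
    have h1 : Tendsto (fun S => K (S - r)) atTop atTop :=
      hKt.comp (tendsto_atTop_add_const_right _ _ tendsto_id)
    exact ((eventually_ge_atTop R).and (h1.eventually_ge_atTop (F R))).exists
  obtain ⟨s, hs, hsmin⟩ := (hFlsc.lowerSemicontinuousOn (Icc R S)).exists_isMinOn
    ⟨R, left_mem_Icc.2 hRS⟩ isCompact_Icc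
  have hFs : ∀ s', R ≤ s' → F s ≤ F s' := fun s' hs' => by
    rcases le_total s' S with h | h
    · exact hsmin ⟨hs', h⟩
    · have h1 : F s ≤ F R := hsmin (left_mem_Icc.2 hRS)
      have h2 : K (S - r) ≤ K (s' - r) := hKm (by linarith)
      have h3 := rearr_nonneg hub s'
      simp only [hF] at *
      linarith
  set T := rearr φ r with hT
  have hTF : F s ≤ T := hcontact _ hFs
  have hrs : r < s := hrR.trans_le hs.1
  have hKrs : 0 < K (s - r) := hK0 ▸ hKs self_mem_Ici (sub_nonneg.2 hrs.le) (sub_pos.2 hrs)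
  have hus0 := rearr_nonneg hub s
  have hT0 : 0 < T := by simp only [hF] at hTF; linarith
  set E : Set (Rd d) := {x | T ≤ φ x} with hE
  have hEm : MeasurableSet E := measurableSet_le measurable_const hφm
  -- `E` as a decreasing intersection of superlevel sets of finite measure
  set t : ℕ → ℝ := fun n => T - T / (n + 2) with ht
  have htpos : ∀ n, 0 < t n := fun n => by
    have : T / (n + 2) < T := div_lt_self hT0 (by linarith [(Nat.cast_nonneg n : (0 : ℝ) ≤ n)])
    simp only [ht]; linarith
  have htlt : ∀ n, t n < T := fun n => by
    have : 0 < T / ((n : ℝ) + 2) := by positivity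
    simp only [ht]; linarith
  have htlim : Tendsto t atTop (nhds T) := by
    have : Tendsto (fun n : ℕ => T / ((n : ℝ) + 2)) atTop (nhds 0) :=
      tendsto_const_nhds.div_atTop (tendsto_atTop_add_const_right _ _ tendsto_natCast_atTop_atTop)
    simpa [ht] using tendsto_const_nhds (x := T) |>.sub this
  have hEI : E = ⋂ n, {x | t n < φ x} := by
    ext x
    simp only [hE, mem_ofPred_eq, mem_iInter]
    exact ⟨fun h n => (htlt n).trans_le h, fun h => le_of_tendsto' htlim fun n => (h n).le⟩
  have htmono : Monotone t := fun n n' hn => by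
    simp only [ht]
    gcongr
  have hanti : Antitone fun n => {x | t n < φ x} := fun n n' hn x hx =>
    lt_of_le_of_lt (htmono hn) hx
  have hfinφ : ∀ n, volume {x | t n < φ x} ≠ ∞ := fun n =>
    ne_top_of_le_ne_top (hfin _ (htpos n)) (measure_mono fun x hx => lt_of_lt_of_le hx (hφu x))
  have hmeas : ∀ n, MeasurableSet {x | t n < φ x} := fun n =>
    measurableSet_lt measurable_const hφm
  have hμle : μ ≤ volume := by rw [← hμκ]; exact le_add_of_nonneg_right (Measure.zero_le _)
  have hlow : ∀ ν : Measure (Rd d), ν ≤ volume → (∀ n, ballVol d r ≤ ν {x | t n < φ x}) →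
      ballVol d r ≤ ν E := fun ν hν h => by
    rw [hEI, hanti.measure_iInter (fun n => (hmeas n).nullMeasurableSet)
      ⟨0, ne_top_of_le_ne_top (hfinφ 0) (hν _)⟩]
    exact le_iInf h
  have hvol : ∀ n, ballVol d r < volume {x | t n < φ x} := fun n =>
    (lt_rearr_iff hφb (htpos n).le).1 (htlt n)
  have hEv : ballVol d r ≤ volume E := hlow _ le_rfl fun n => (hvol n).le
  have hEμ : ballVol d r ≤ μ E := by
    refine hlow _ hμle fun n => ?_
    obtain ⟨τ, ⟨hτ1, hτ2⟩, hτ⟩ : ∃ τ ∈ Ioo (t n) T,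
        μ {x | τ < φ x} = min (ballVol d R) (volume {x | τ < φ x}) := by
      by_contra! hcon
      rw [ae_iff, Measure.restrict_apply' measurableSet_Ioi] at hmin
      have h0 : volume (Ioo (t n) T) = 0 := measure_mono_null
        (fun τ hτ => mem_inter (hcon τ hτ) (mem_Ioi.2 ((htpos n).trans hτ.1))) hmin
      rw [Real.volume_Ioo, ENNReal.ofReal_eq_zero] at h0
      linarith [htlt n]
    calc ballVol d r ≤ min (ballVol d R) (volume {x | τ < φ x}) :=
          le_min (ballVol_mono d hrR.le)
            ((lt_rearr_iff hφb ((htpos n).trans hτ1).le).1 hτ2).le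
      _ = μ {x | τ < φ x} := hτ.symm
      _ ≤ _ := measure_mono fun x hx => hτ1.trans hx
  have hEfin : volume E ≠ ∞ := ne_top_of_le_ne_top (hfinφ 0)
    (measure_mono fun x hx => (htlt 0).trans_le hx)
  obtain ⟨z, hz⟩ := ae_eq_ball_of_volume_le (E := E) (C := {x | rearr u s < u x}) hd hr
    (sub_pos.2 hrs) hEm (measurableSet_lt measurable_const hum) hEfin hEv
    (fun x hx y hy => by
      have h1 := hφ x y
      have h2 : K ‖y - x‖ < K (s - r) := hKs (norm_nonneg _) (sub_nonneg.2 hrs.le) hy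
      have h3 : T ≤ φ x := hx
      simp only [hF] at hTF
      show rearr u s < u y
      linarith)
    (by
      rw [add_sub_cancel]
      exact not_lt.1 fun h => lt_irrefl _ ((lt_rearr_iff hub hus0).2 h))
  refine ⟨z, ?_⟩
  have hμz : μ (Metric.ball z r) = μ E := measure_congr
    ((Measure.absolutelyContinuous_of_le hμle).ae_le hz.symm)
  have h1 : μ (Metric.ball z r) + κ (Metric.ball z r) = ballVol d r := by
    rw [← Measure.add_apply, hμκ, volume_ball_eq_ballVol]
  have h2 : ballVol d r + κ (Metric.ball z r) ≤ ballVol d r + 0 := by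
    rw [add_zero]
    calc _ ≤ μ (Metric.ball z r) + κ (Metric.ball z r) := by gcongr; exact hμz ▸ hEμ
      _ = _ := h1
  exact le_antisymm ((ENNReal.add_le_add_iff_left (ballVol_ne_top d r)).1 h2) bot_le

/-- Null balls of radii increasing to the critical one accumulate to a null ball. -/
lemma exists_null_ball_of_forall_lt (hd : 1 ≤ d) {μ κ : Measure (Rd d)} (hμκ : μ + κ = volume)
    {R : ℝ} (hR : 0 < R) (hμR : μ univ = ballVol d R)
    (h : ∀ r, 0 < r → r < R → ∃ z, κ (Metric.ball z r) = 0) : ∃ z, κ (Metric.ball z R) = 0 := by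
  have hmass : ∀ z r, κ (Metric.ball z r) = 0 → μ (Metric.ball z r) = ballVol d r := fun z r hz => by
    rw [← volume_ball_eq_ballVol z r, ← hμκ, Measure.add_apply, hz, add_zero]
  obtain ⟨r₀, hr₀, hr₀R, hhalf⟩ : ∃ r₀, 0 < r₀ ∧ r₀ < R ∧ ballVol d R < 2 * ballVol d r₀ := by
    have h1 : Tendsto (fun r => 2 * ballVol d r) (nhdsWithin R (Iio R)) (nhds (2 * ballVol d R)) :=
      ENNReal.Tendsto.const_mul ((continuous_ballVol hd).tendsto R |>.mono_left nhdsWithin_le_nhds)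
        (Or.inr (by norm_num))
    have h2 : ballVol d R < 2 * ballVol d R := by
      rw [two_mul]
      refine ENNReal.lt_add_right (ballVol_ne_top d R) ?_
      exact (Metric.measure_ball_pos _ _ hR).ne'
    obtain ⟨r, hr3, hr1, hr2⟩ := ((h1.eventually (lt_mem_nhds h2)).and
      (Ioo_mem_nhdsLT hR)).exists
    exact ⟨r, hr1, hr2, hr3⟩
  set r : ℕ → ℝ := fun n => R - (R - r₀) / (n + 1) with hr
  have hrlt : ∀ n, r n < R := fun n => by
    have : 0 < (R - r₀) / ((n : ℝ) + 1) := div_pos (by linarith) (by positivity)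
    simp only [hr]; linarith
  have hrge : ∀ n, r₀ ≤ r n := fun n => by
    have : (R - r₀) / ((n : ℝ) + 1) ≤ R - r₀ := div_le_self (by linarith)
      (by linarith [(Nat.cast_nonneg n : (0 : ℝ) ≤ n)])
    simp only [hr]; linarith
  have hrlim : Tendsto r atTop (nhds R) := by
    have : Tendsto (fun n : ℕ => (R - r₀) / ((n : ℝ) + 1)) atTop (nhds 0) :=
      tendsto_const_nhds.div_atTop (tendsto_atTop_add_const_right _ _ tendsto_natCast_atTop_atTop)
    simpa [hr] using tendsto_const_nhds (x := R) |>.sub this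
  choose z hz using fun n => h (r n) (hr₀.trans_le (hrge n)) (hrlt n)
  have hzb : ∀ n, z n ∈ Metric.closedBall (z 0) (2 * R) := fun n => by
    rw [Metric.mem_closedBall]
    refine le_of_not_gt fun hcon => ?_
    have hdis : Disjoint (Metric.ball (z n) (r n)) (Metric.ball (z 0) (r 0)) :=
      Metric.ball_disjoint_ball (by linarith [hrlt n, hrlt 0])
    have h1 : μ (Metric.ball (z n) (r n)) + μ (Metric.ball (z 0) (r 0)) ≤ ballVol d R := by
      rw [← measure_union hdis measurableSet_ball, ← hμR]
      exact measure_mono (subset_univ _)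
    rw [hmass _ _ (hz n), hmass _ _ (hz 0)] at h1
    refine absurd (hhalf.trans_le ?_) h1.not_gt
    rw [two_mul]
    exact add_le_add (ballVol_mono d (hrge n)) (ballVol_mono d (hrge 0))
  obtain ⟨w, -, σ, hσ, hw⟩ := (isCompact_closedBall (z 0) (2 * R)).tendsto_subseq hzb
  refine ⟨w, measure_mono_null (t := ⋃ n, Metric.ball (z n) (r n)) (fun x hx => ?_)
    (measure_iUnion_null hz)⟩
  have h1 : Tendsto (fun n => r (σ n) - dist x (z (σ n))) atTop (nhds (R - dist x w)) :=
    (hrlim.comp hσ.tendsto_atTop).sub (tendsto_const_nhds.dist hw)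
  obtain ⟨n, hn⟩ := (h1.eventually (lt_mem_nhds (sub_pos.2 (Metric.mem_ball.1 hx)))).exists
  exact mem_iUnion.2 ⟨σ n, Metric.mem_ball.2 (sub_pos.1 hn)⟩

/-- Balls maximise the transport cost, and are the only maximisers. -/
theorem minCost_le_ball (hd : 1 ≤ d) (hKc : Continuous K) (hKm : Monotone K)
    (hKs : StrictMonoOn K (Ici 0)) (hK0 : K 0 = 0) (hKt : Tendsto K atTop atTop)
    {μ κ : Measure (Rd d)} (hμκ : μ + κ = volume)
    {R : ℝ} (hR : 0 < R) (hμR : μ univ = ballVol d R) :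
    (∀ z : Rd d, minCost K μ κ ≤
      minCost K (volume.restrict (Metric.ball z R)) (volume.restrict (Metric.ball z R)ᶜ)) ∧
    (minCost K (volume.restrict (Metric.ball (0 : Rd d) R))
        (volume.restrict (Metric.ball (0 : Rd d) R)ᶜ) ≤ minCost K μ κ →
      ∃ z, κ (Metric.ball z R) = 0) := by
  have : IsFiniteMeasure μ := ⟨by rw [hμR]; exact (ballVol_ne_top d R).lt_top⟩
  have hμ0 : μ univ ≠ 0 := by rw [hμR]; exact (Metric.measure_ball_pos _ _ hR).ne'
  have hμle : μ ≤ volume := by rw [← hμκ]; exact le_add_of_nonneg_right (Measure.zero_le _)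
  have hκle : κ ≤ volume := by rw [← hμκ]; exact le_add_of_nonneg_left (Measure.zero_le _)
  have hKpos : ∀ r, 0 ≤ r → 0 ≤ K r := fun r hr => hK0 ▸ hKm hr
  obtain ⟨u, φ, hum, hφm, hφ0, hφu, hφ, hub, hufin, hdual⟩ :=
    exists_dual_potentials hd hKc hKm hK0 hμ0 hμκ
  change minCost K μ κ + _ ≤ _ at hdual
  have hu0 : ∀ x, 0 ≤ u x := fun x => (hφ0 x).trans (hφu x)
  have hφb : ∃ C, ∀ x, φ x ≤ C := hub.imp fun C hC x => (hφu x).trans (hC x)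
  have hlev : ∀ t, 0 < t → volume {x | t < u x} ≠ ∞ := fun t ht =>
    measure_lt_ne_top_of_lintegral hum hufin ht
  have hIfin : ∫⁻ x, ENNReal.ofReal (u x) ∂κ ≠ ∞ :=
    ne_top_of_le_ne_top hufin (lintegral_mono' hκle le_rfl)
  have hJfin : ∫⁻ x, ENNReal.ofReal (φ x) ∂μ ≠ ∞ :=
    ne_top_of_le_ne_top hufin (lintegral_mono' hμle fun x => ENNReal.ofReal_le_ofReal (hφu x))
  have hrad : ∀ r s, 0 ≤ r → r < R → R ≤ s → rearr φ r ≤ rearr u s + K (s - r) :=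
    fun r s hr h1 h2 => rearr_le_rearr_add hd hKm hK0 hum hφm hub hφu hφ hr (h1.le.trans h2)
  have hcompl := rearr_compl_le hd hu0 hum hub hlev hμκ hμR
  refine ⟨fun z => ?_, fun hge => ?_⟩
  · rw [← ENNReal.add_le_add_iff_right hIfin]
    calc _ ≤ _ := hdual
      _ ≤ _ := (lintegral_le_rearr hd hφ0 hφm hφb hμle hμR z).1
      _ ≤ _ := lintegral_ball_le_of_radial hKm (rearr_antitone hφb).measurable
        (rearr_antitone hub).measurable (rearr_nonneg hub) hKpos hrad
      _ ≤ _ := add_le_add le_rfl (hcompl z)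
  set ψ : ℝ → ℝ := fun r => ⨅ s : Ici R, (rearr u s + K (s - min r R)) with hψ
  have hψbdd : ∀ r, BddBelow (range fun s : Ici R => rearr u s + K (s - min r R)) := fun r =>
    ⟨0, by
      rintro _ ⟨s, rfl⟩
      exact add_nonneg (rearr_nonneg hub _) (hKpos _ (by
        have := min_le_right r R; have : R ≤ (s : ℝ) := s.2; linarith))⟩
  have hψanti : Antitone ψ := fun r r' hrr' => by
    refine ciInf_mono (hψbdd r') fun s => ?_
    have : min r R ≤ min r' R := min_le_min_right _ hrr'
    have := hKm (sub_le_sub_left this (s : ℝ))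
    linarith
  have hψle : ∀ r s, 0 ≤ r → r < R → R ≤ s → ψ r ≤ rearr u s + K (s - r) := fun r s _ hr hs => by
    have h1 : ψ r ≤ rearr u s + K (s - min r R) := ciInf_le (hψbdd r) ⟨s, hs⟩
    rwa [min_eq_left hr.le] at h1
  have hφψ : ∀ r, 0 ≤ r → r < R → rearr φ r ≤ ψ r := fun r hr hrR =>
    le_ciInf fun s => by rw [min_eq_left hrR.le]; exact hrad r s hr hrR s.2
  have hJ := lintegral_le_rearr hd hφ0 hφm hφb hμle hμR (0 : Rd d)
  have hψJ : ∫⁻ x in Metric.ball (0 : Rd d) R, ENNReal.ofReal (ψ ‖x - 0‖) ≤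
      ∫⁻ x, ENNReal.ofReal (φ x) ∂μ :=
    calc _ ≤ _ := lintegral_ball_le_of_radial hKm hψanti.measurable
          (rearr_antitone hub).measurable (rearr_nonneg hub) hKpos hψle
      _ ≤ minCost K μ κ + ∫⁻ x, ENNReal.ofReal (u x) ∂κ := add_le_add hge (hcompl 0)
      _ ≤ _ := hdual
  have hle : ∀ᵐ x ∂(volume.restrict (Metric.ball (0 : Rd d) R)),
      ENNReal.ofReal (rearr φ ‖x - 0‖) ≤ ENNReal.ofReal (ψ ‖x - 0‖) := by
    filter_upwards [ae_restrict_mem measurableSet_ball] with x hx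
    exact ENNReal.ofReal_le_ofReal (hφψ _ (norm_nonneg _) (mem_ball_iff_norm.1 hx))
  have hmin := hJ.2 ((lintegral_mono_ae hle).trans hψJ) hJfin
  have heq := ae_eq_of_ae_le_of_lintegral_le hle
    (ne_top_of_le_ne_top hJfin ((lintegral_mono_ae hle).trans hψJ))
    (hψanti.measurable.comp (by fun_prop : Measurable fun x : Rd d => ‖x - 0‖)).ennreal_ofReal.aemeasurable
    (hψJ.trans hJ.1)
  have hgood : ∀ᵐ x ∂(volume.restrict (Metric.ball (0 : Rd d) R)),
      0 < ‖x‖ → ‖x‖ < R → ∃ z, κ (Metric.ball z ‖x‖) = 0 := by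
    filter_upwards [heq] with x hx h1 h2
    refine exists_null_ball_of_contact hd hKc hKm hKs hK0 hKt hμκ hum hφm hub hφu hφ hlev
      hmin h1 h2 fun v hv => ?_
    rw [sub_zero] at hx
    have hv' : v ≤ ψ ‖x‖ := le_ciInf fun s => by rw [min_eq_left h2.le]; exact hv s s.2
    rcases le_or_gt v 0 with hv0 | hv0
    · exact hv0.trans (rearr_nonneg hφb _)
    · have h3 : ENNReal.ofReal v ≤ ENNReal.ofReal (rearr φ ‖x‖) := by
        rw [hx]; exact ENNReal.ofReal_le_ofReal hv'
      exact (ENNReal.ofReal_le_ofReal_iff (rearr_nonneg hφb _)).1 h3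
  refine exists_null_ball_of_forall_lt hd hμκ hR hμR fun r hr hrR => ?_
  by_contra! hcon
  rw [ae_restrict_iff' measurableSet_ball] at hgood
  have hnull : volume (Metric.ball (0 : Rd d) R \ Metric.ball 0 r) = 0 := by
    refine measure_mono_null (fun x hx => ?_) (ae_iff.1 hgood)
    simp only [mem_ofPred_eq, not_forall]
    have hxR := mem_ball_zero_iff.1 hx.1
    have hxr : r ≤ ‖x‖ := not_lt.1 fun h => hx.2 (mem_ball_zero_iff.2 h)
    refine ⟨hx.1, hr.trans_le hxr, hxR, ?_⟩
    rintro ⟨z, hz⟩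
    exact hcon z (measure_mono_null (Metric.ball_subset_ball hxr) hz)
  rw [measure_sdiff (Metric.ball_subset_ball hrR.le) measurableSet_ball.nullMeasurableSet
    measure_ball_lt_top.ne, tsub_eq_zero_iff_le] at hnull
  exact absurd ((ballVol_lt_iff hd hr.le).2 hrR) hnull.not_gt

end

section
variable {d : ℕ} {K : ℝ → ℝ}

lemma ballVol_two_rpow (hd : 1 ≤ d) : ballVol d (2 ^ ((1 : ℝ) / d)) = 2 * ballVol d 1 := by
  rw [ballVol_eq hd, max_eq_left (by positivity), ← Real.rpow_natCast, ← Real.rpow_mul (by norm_num),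
    one_div_mul_cancel (by positivity), Real.rpow_one, ENNReal.ofReal_ofNat]

/-- Optimal exterior plans of the unit ball fill the surrounding annulus. -/
theorem map_snd_eq_of_optimal (hd : 1 ≤ d) (hKc : Continuous K) (hKm : Monotone K)
    (hKs : StrictMonoOn K (Ici 0)) (hK0 : K 0 = 0) {γ : Measure (Rd d × Rd d)}
    (hγ : γ ∈ plansTo (volume.restrict (Metric.ball (0 : Rd d) 1))
      (volume.restrict (Metric.ball (0 : Rd d) 1)ᶜ))
    (hopt : ∫⁻ p, ENNReal.ofReal (K ‖p.2 - p.1‖) ∂γ =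
      minCost K (volume.restrict (Metric.ball (0 : Rd d) 1))
        (volume.restrict (Metric.ball (0 : Rd d) 1)ᶜ)) :
    γ.map Prod.snd =
      volume.restrict (Metric.ball (0 : Rd d) (2 ^ ((1 : ℝ) / d)) \ Metric.ball 0 1) := by
  set B := Metric.ball (0 : Rd d) 1 with hB
  set κ : Measure (Rd d) := volume.restrict Bᶜ with hκ
  have hμκ : volume.restrict B + κ = volume := Measure.restrict_add_restrict_compl measurableSet_ball
  have hμR : volume.restrict B univ = ballVol d 1 := by
    rw [Measure.restrict_apply_univ, volume_ball_eq_ballVol]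
  have : IsFiniteMeasure (volume.restrict B) := ⟨by rw [hμR]; exact (ballVol_ne_top d 1).lt_top⟩
  have hKpos : ∀ r, 0 ≤ r → 0 ≤ K r := fun r hr => hK0 ▸ hKm hr
  obtain ⟨u, φ, hum, hφm, hφ0, hφu, hφ, hub, hufin, hdual⟩ :=
    exists_dual_potentials hd hKc hKm hK0 (hμR ▸ ballVol_one_ne_zero d) hμκ
  change minCost K _ κ + _ ≤ _ at hdual
  have hφb : ∃ C, ∀ x, φ x ≤ C := hub.imp fun C hC x => (hφu x).trans (hC x)
  have hlev : ∀ t, 0 < t → volume {x | t < u x} ≠ ∞ := fun t ht =>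
    measure_lt_ne_top_of_lintegral hum hufin ht
  have hJfin : ∫⁻ x in B, ENNReal.ofReal (φ x) ≠ ∞ :=
    ne_top_of_le_ne_top hufin (lintegral_mono' Measure.restrict_le_self
      fun x => ENNReal.ofReal_le_ofReal (hφu x))
  have hcompl := rearr_compl_le hd (fun x => (hφ0 x).trans (hφu x)) hum hub hlev hμκ hμR 0
  have hJ := (lintegral_le_rearr hd hφ0 hφm hφb Measure.restrict_le_self hμR (0 : Rd d)).1
  set a : Rd d → ℝ≥0∞ := fun x => ENNReal.ofReal (rearr φ ‖x - 0‖) with ha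
  set b : Rd d → ℝ≥0∞ := fun y => ENNReal.ofReal (rearr u ‖y - 0‖) with hb
  have ham : Measurable a := (measurable_rearr_norm hφb 0).ennreal_ofReal
  have hbm : Measurable b := (measurable_rearr_norm hub 0).ennreal_ofReal
  have hbm' : Measurable fun p : Rd d × Rd d => b p.2 := hbm.comp measurable_snd
  set ν := γ.map Prod.snd with hν
  have hνκ : ν ≤ κ := hγ.2
  have hνuniv : ν univ = ballVol d 1 := by
    rw [hν, Measure.map_apply measurable_snd .univ, ← hμR, ← hγ.1,
      Measure.map_apply measurable_fst .univ, preimage_univ, preimage_univ]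
  have : IsFiniteMeasure ν := ⟨by rw [hνuniv]; exact (ballVol_ne_top d 1).lt_top⟩
  have hrad : ∀ r s, 0 ≤ r → r ≤ s → rearr φ r ≤ rearr u s + K (s - r) :=
    fun r s hr h1 => rearr_le_rearr_add hd hKm hK0 hum hφm hub hφu hφ hr h1
  have hptw : ∀ᵐ p ∂γ, a p.1 ≤ ENNReal.ofReal (K ‖p.2 - p.1‖) + b p.2 := by
    filter_upwards [plansTo_ball_ae hγ] with p hp
    rw [← ENNReal.ofReal_add (hKpos _ (norm_nonneg _)) (rearr_nonneg hub _)]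
    refine ENNReal.ofReal_le_ofReal ?_
    have h1 := hrad _ _ (norm_nonneg (p.1 - 0)) (hp.1.le.trans hp.2)
    have h2 : ‖p.2 - 0‖ - ‖p.1 - 0‖ ≤ ‖p.2 - p.1‖ := by
      simpa using norm_sub_norm_le p.2 p.1
    linarith [hKm h2]
  have hsum : ∫⁻ p, (ENNReal.ofReal (K ‖p.2 - p.1‖) + b p.2) ∂γ =
      minCost K (volume.restrict B) κ + ∫⁻ y, b y ∂ν := by
    rw [lintegral_add_right _ hbm', hopt, hν, lintegral_map hbm measurable_snd]
  have hfst : ∫⁻ p, a p.1 ∂γ = ∫⁻ x in B, a x := by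
    rw [← hγ.1, lintegral_map ham measurable_fst]
  have hchain : minCost K (volume.restrict B) κ + ∫⁻ y, b y ∂κ ≤ ∫⁻ x in B, a x :=
    (add_le_add le_rfl hcompl).trans (hdual.trans hJ)
  have hminfin : minCost K (volume.restrict B) κ ≠ ∞ :=
    ne_top_of_le_ne_top hJfin (le_self_add.trans hdual)
  have hbκ : ∫⁻ y, b y ∂κ ≤ ∫⁻ y, b y ∂ν := by
    rw [← ENNReal.add_le_add_iff_left hminfin, ← hsum]
    exact hchain.trans (hfst ▸ lintegral_mono_ae hptw)
  have hbκfin : ∫⁻ y, b y ∂κ ≠ ∞ := by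
    refine ne_top_of_le_ne_top hJfin ((hcompl.trans ?_).trans hdual)
    exact le_add_self
  have hbνfin : ∫⁻ y, b y ∂ν ≠ ∞ := ne_top_of_le_ne_top hbκfin (lintegral_mono' hνκ le_rfl)
  have hle2 : ∫⁻ p, (ENNReal.ofReal (K ‖p.2 - p.1‖) + b p.2) ∂γ ≤ ∫⁻ p, a p.1 ∂γ := by
    rw [hsum, hfst]
    exact (add_le_add le_rfl (lintegral_mono' hνκ le_rfl)).trans hchain
  have heq := ae_eq_of_ae_le_of_lintegral_le hptw
    (ne_top_of_le_ne_top (ENNReal.add_ne_top.2 ⟨hminfin, hbνfin⟩)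
      (hsum ▸ lintegral_mono_ae hptw)) (by fun_prop) hle2
  -- the part of the exterior left unused
  set ρ := κ - ν with hρ
  have hνρ : ρ + ν = κ := Measure.sub_add_cancel_of_le hνκ
  have hρU : ρ {y | 0 < rearr u ‖y - 0‖} = 0 := by
    have h1 : ∫⁻ y, b y ∂ρ = 0 := by
      have h2 : ∫⁻ y, b y ∂ρ + ∫⁻ y, b y ∂ν ≤ 0 + ∫⁻ y, b y ∂ν := by
        rw [← lintegral_add_measure, hνρ, zero_add]; exact hbκ
      exact le_antisymm ((ENNReal.add_le_add_iff_right hbνfin).1 h2) bot_le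
    rw [lintegral_eq_zero_iff hbm] at h1
    refine measure_mono_null (fun y hy => ?_) (ae_iff.1 h1)
    exact (ENNReal.ofReal_pos.2 hy).ne'
  rw [setOf_lt_rearr hub 0 le_rfl] at hρU
  have hA : volume {x | 0 < u x} ≠ ∞ := fun hA => by
    have h1 : {x : Rd d | ballVol d ‖x - 0‖ < volume {x | 0 < u x}} = univ :=
      eq_univ_of_forall fun x => by
        rw [mem_ofPred_eq, hA]; exact (ballVol_ne_top d _).lt_top
    rw [h1] at hρU
    have h2 : volume (univ : Set (Rd d)) ≠ ∞ := by
      rw [← hμκ, Measure.add_apply, hμR, ← hνρ, Measure.add_apply, hρU, hνuniv]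
      exact ENNReal.add_ne_top.2 ⟨ballVol_ne_top d 1, by simp [ballVol_ne_top]⟩
    obtain ⟨s, -, hs⟩ := exists_ballVol_eq hd (A := volume (univ : Set (Rd d)) + 1)
      (ENNReal.add_ne_top.2 ⟨h2, one_ne_top⟩)
    have h3 : ballVol d s ≤ volume (univ : Set (Rd d)) := measure_mono (subset_univ _)
    rw [hs] at h3
    exact (ENNReal.lt_add_right h2 one_ne_zero).not_ge h3
  obtain ⟨S, hS0, hSA⟩ := exists_ballVol_eq hd hA
  rw [← hSA, setOf_ballVol_lt hd] at hρU
  set S' := max S 1 with hS'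
  have huS' : rearr u S' ≤ 0 := by
    refine not_lt.1 fun h => ?_
    rw [lt_rearr_iff hub le_rfl, ← hSA, ballVol_lt_iff hd (by positivity)] at h
    exact h.not_ge (le_max_left _ _)
  have hρS' : ρ (Metric.ball 0 S') = 0 := by
    rcases le_total 1 S with h | h
    · rwa [hS', max_eq_left h]
    · rw [hS', max_eq_right h]
      have h1 : κ B = 0 := by
        rw [hκ, Measure.restrict_apply measurableSet_ball, inter_compl_self, measure_empty]
      exact le_antisymm ((Measure.sub_le _).trans h1.le) bot_le
  have hsupp : ∀ᵐ y ∂ν, y ∈ Metric.closedBall (0 : Rd d) S' := by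
    refine (ae_map_iff (p := (· ∈ Metric.closedBall (0 : Rd d) S')) measurable_snd.aemeasurable
      Metric.isClosed_closedBall.measurableSet).2 ?_
    filter_upwards [plansTo_ball_ae hγ, heq] with p hp hpe
    rw [sub_zero, sub_zero] at hp
    rw [mem_closedBall_zero_iff]
    refine not_lt.1 fun hlt => ?_
    have h1S : (1 : ℝ) ≤ S' := le_max_right _ _
    have h1 := hrad ‖p.1‖ S' (norm_nonneg _) (hp.1.le.trans h1S)
    have h2 : K (S' - ‖p.1‖) < K ‖p.2 - p.1‖ := by
      have h3 := norm_sub_norm_le p.2 p.1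
      exact hKs (mem_Ici.2 (by linarith [hp.1])) (norm_nonneg _) (by linarith)
    have h4 : a p.1 < ENNReal.ofReal (K ‖p.2 - p.1‖) := by
      simp only [ha, sub_zero]
      exact (ENNReal.ofReal_lt_ofReal_iff_of_nonneg (rearr_nonneg hφb _)).2 (by linarith)
    exact (h4.trans_le le_self_add).ne hpe
  have hsupp' : ∀ᵐ y ∂ν, y ∈ Metric.ball (0 : Rd d) S' := by
    have hne : (S' : ℝ) ≠ 0 := (one_pos.trans_le (le_max_right S 1)).ne'
    have h1 : ν (Metric.sphere 0 S') = 0 := le_antisymm ((hνκ _).trans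
      ((Measure.restrict_le_self _).trans (Measure.addHaar_sphere_of_ne_zero _ _ hne).le)) bot_le
    filter_upwards [hsupp, measure_eq_zero_iff_ae_notMem.1 h1] with y hy hy'
    exact lt_of_le_of_ne hy hy'
  have hνeq : ν = volume.restrict (Metric.ball 0 S' \ B) := by
    calc ν = ν.restrict (Metric.ball 0 S') := (Measure.restrict_eq_self_of_ae_mem hsupp').symm
      _ = ρ.restrict (Metric.ball 0 S') + ν.restrict (Metric.ball 0 S') := by
          rw [Measure.restrict_eq_zero.2 hρS', zero_add]
      _ = κ.restrict (Metric.ball 0 S') := by rw [← Measure.restrict_add, hνρ]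
      _ = _ := by rw [hκ, Measure.restrict_restrict measurableSet_ball, Set.sdiff_eq]
  have hmass : ballVol d S' = ballVol d (2 ^ ((1 : ℝ) / d)) := by
    have h1 : ν univ + volume B = ballVol d S' := by
      rw [hνeq, Measure.restrict_apply_univ, ← volume_ball_eq_ballVol (0 : Rd d) S']
      have h2 := measure_sdiff_add_inter (μ := volume) (Metric.ball 0 S')
        (measurableSet_ball : MeasurableSet B)
      rwa [inter_eq_right.2 (Metric.ball_subset_ball (le_max_right S 1))] at h2
    rw [← h1, hνuniv, volume_ball_eq_ballVol, ballVol_two_rpow hd, two_mul]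
  rw [hνeq, (ballVol_strictMonoOn hd).injOn (mem_Ici.2 (by positivity)) (mem_Ici.2 (by positivity))
    hmass]

end

section
variable {d : ℕ} {f : Rd d → ℝ}

lemma fMeas_add_fMeas_one_sub (hf : InUnit f) : fMeas f + fMeas (fun x => 1 - f x) = volume := by
  obtain ⟨g, hgm, hg⟩ := hf.1.aestronglyMeasurable.aemeasurable
  have h1 : fMeas f = fMeas g := withDensity_congr_ae (hg.mono fun x hx => by simp only [hx])
  have h2 : fMeas (fun x => 1 - f x) = fMeas (fun x => 1 - g x) :=
    withDensity_congr_ae (hg.mono fun x hx => by simp only [hx])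
  rw [h1, h2, fMeas, fMeas, ← withDensity_add_left hgm.ennreal_ofReal]
  conv_rhs => rw [← withDensity_one (μ := (volume : Measure (Rd d)))]
  refine withDensity_congr_ae (hg.mono fun x hx => ?_)
  have h3 := hf.2 x
  rw [hx] at h3
  rw [Pi.add_apply, ← ENNReal.ofReal_add h3.1 (sub_nonneg.2 h3.2), add_sub_cancel, ofReal_one,
    Pi.one_apply]

lemma fMeas_univ (hf : InUnit f) : fMeas f univ = ENNReal.ofReal (∫ x, f x) := by
  rw [fMeas, withDensity_apply _ .univ, setLIntegral_univ,
    ofReal_integral_eq_lintegral_ofReal hf.1 (ae_of_all _ fun x => (hf.2 x).1)]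

lemma fMeas_of_ae_eq_indicator {A : Set (Rd d)} (hA : MeasurableSet A)
    (hf : f =ᵐ[volume] A.indicator fun _ => (1 : ℝ)) :
    fMeas f = volume.restrict A ∧ fMeas (fun x => 1 - f x) = volume.restrict Aᶜ := by
  rw [← withDensity_indicator_one hA, ← withDensity_indicator_one hA.compl]
  constructor <;> refine withDensity_congr_ae (hf.mono fun x hx => ?_) <;>
    by_cases h : x ∈ A <;> simp [hx, h]

lemma ae_eq_indicator_of_fMeas (hf : InUnit f) {A : Set (Rd d)}
    (h1 : fMeas f Aᶜ = 0) (h2 : fMeas (fun x => 1 - f x) A = 0) :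
    f =ᵐ[volume] A.indicator fun _ => (1 : ℝ) := by
  have hm := hf.1.aestronglyMeasurable.aemeasurable
  rw [fMeas, withDensity_apply_eq_zero' hm.ennreal_ofReal] at h1
  rw [fMeas, withDensity_apply_eq_zero' (hm.const_sub 1).ennreal_ofReal] at h2
  filter_upwards [measure_eq_zero_iff_ae_notMem.1 h1, measure_eq_zero_iff_ae_notMem.1 h2]
    with x hx1 hx2
  by_cases h : x ∈ A
  · rw [indicator_of_mem h]
    refine le_antisymm (hf.2 x).2 (le_of_not_gt fun hlt => hx2 ⟨?_, h⟩)
    exact (ENNReal.ofReal_pos.2 (sub_pos.2 hlt)).ne'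
  · rw [indicator_of_notMem h]
    refine le_antisymm (le_of_not_gt fun hlt => hx1 ⟨?_, h⟩) (hf.2 x).1
    exact (ENNReal.ofReal_pos.2 hlt).ne'

lemma inUnit_indicator_ball (z : Rd d) (r : ℝ) :
    InUnit ((Metric.ball z r).indicator fun _ => (1 : ℝ)) :=
  ⟨(integrable_indicator_iff measurableSet_ball).2 (integrableOn_const measure_ball_lt_top.ne),
    fun x => ⟨indicator_nonneg (fun _ _ => zero_le_one) x,
      indicator_le_self' (fun _ _ => zero_le_one) x⟩⟩

/-- A radial cost only depends on the values of its profile on the half-line. -/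
lemma planCost_radCost (k : ℝ → ℝ) (γ : Measure (Rd d × Rd d)) :
    planCost (radCost k) γ = ∫⁻ p, ENNReal.ofReal (k (max ‖p.2 - p.1‖ 0)) ∂γ := by
  simp only [planCost, radCost, max_eq_left (norm_nonneg _)]

lemma Ups_radCost (k : ℝ → ℝ) (f : Rd d → ℝ) :
    Ups (radCost k) f = minCost (fun r => k (max r 0)) (fMeas f) (fMeas fun x => 1 - f x) := by
  simp only [Ups, minCost, planCost_radCost]
  rfl

end

/-- for a radial cost `c(x,y) = k(|y-x|)` with `k : [0,∞) → [0,∞)` continuous,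
increasing, `k(0)=0` and coercive, the maximisers of `ℰ(m)` are exactly the characteristic
functions of balls of volume `m`; moreover every minimiser `γ` of `Υ(χ_{B_1})` has second
marginal `χ_A · Leb` where `A = B_{2^{1/d}} ∖ B_1`. -/
theorem stmt_2 {d : ℕ} (hd : 1 ≤ d) (k : ℝ → ℝ)
    (hpos : ∀ r, 0 ≤ r → 0 ≤ k r)
    (hcont : ContinuousOn k (Set.Ici 0))
    (hmono : StrictMonoOn k (Set.Ici 0))
    (h0 : k 0 = 0)
    (hcoer : Tendsto k atTop atTop)
    (m : ℝ) (hm : 0 < m) :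
    (∀ f : Rd d → ℝ, InUnit f → (∫ x, f x) = m →
      (Ups (radCost k) f = Energy (radCost (d := d) k) m ↔
        ∃ (z : Rd d) (r : ℝ), 0 < r ∧
          MeasureTheory.volume (Metric.ball z r) = ENNReal.ofReal m ∧
          f =ᵐ[MeasureTheory.volume] (Metric.ball z r).indicator (fun _ => (1 : ℝ)))) ∧
    (∀ γ ∈ ExtPlans ((Metric.ball (0 : Rd d) 1).indicator (fun _ => (1 : ℝ))),
      planCost (radCost k) γ =
        Ups (radCost k) ((Metric.ball (0 : Rd d) 1).indicator (fun _ => (1 : ℝ))) →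
      γ.map Prod.snd = MeasureTheory.volume.restrict
        (Metric.ball (0 : Rd d) ((2 : ℝ) ^ ((1 : ℝ) / (d : ℝ))) \ Metric.ball (0 : Rd d) 1)) := by
  set K : ℝ → ℝ := fun r => k (max r 0) with hK
  have hKc : Continuous K := hcont.comp_continuous (by fun_prop) fun r => le_max_right r 0
  have hKm : Monotone K := fun r s hrs =>
    hmono.monotoneOn (le_max_right r 0) (le_max_right s 0) (max_le_max_right 0 hrs)
  have hKs : StrictMonoOn K (Ici 0) := fun r hr s hs hrs => by
    simp only [hK, max_eq_left (mem_Ici.1 hr), max_eq_left (mem_Ici.1 hs)]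
    exact hmono hr hs hrs
  have hK0 : K 0 = 0 := by simp only [hK, max_self, h0]
  have hKt : Tendsto K atTop atTop := by
    refine hcoer.congr' ?_
    filter_upwards [eventually_ge_atTop 0] with r hr
    simp only [hK, max_eq_left hr]
  refine ⟨fun f hf hfm => ?_, fun γ hγ hopt => ?_⟩
  · obtain ⟨R, hR0, hRm⟩ := exists_ballVol_eq hd (A := ENNReal.ofReal m) ofReal_ne_top
    have hR : 0 < R := by
      refine hR0.lt_of_ne fun h => ?_
      rw [← h, ballVol, Metric.ball_zero, measure_empty] at hRm
      exact (ENNReal.ofReal_pos.2 hm).ne hRm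
    have hmass : ∀ g : Rd d → ℝ, InUnit g → ∫ x, g x = m → fMeas g univ = ballVol d R :=
      fun g hg hgm => by rw [fMeas_univ hg, hgm, hRm]
    have hmin := fun (g : Rd d → ℝ) (hg : InUnit g) (hgm : ∫ x, g x = m) =>
      minCost_le_ball hd hKc hKm hKs hK0 hKt (fMeas_add_fMeas_one_sub hg) hR (hmass g hg hgm)
    constructor
    · intro hE
      have hint : ∫ x, (Metric.ball (0 : Rd d) R).indicator (fun _ => (1 : ℝ)) x = m := by
        rw [integral_indicator measurableSet_ball, setIntegral_const, smul_eq_mul, mul_one,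
          Measure.real, volume_ball_eq_ballVol, hRm, toReal_ofReal hm.le]
      have hge : Ups (radCost k) ((Metric.ball (0 : Rd d) R).indicator fun _ => (1 : ℝ)) ≤
          Ups (radCost k) f := by
        rw [hE]
        exact le_iSup₂_of_le _ ⟨inUnit_indicator_ball 0 R, hint⟩ le_rfl
      obtain ⟨e1, e2⟩ := fMeas_of_ae_eq_indicator (measurableSet_ball (x := (0 : Rd d)) (ε := R))
        (ae_eq_refl _)
      rw [Ups_radCost, Ups_radCost, e1, e2] at hge
      obtain ⟨z, hz⟩ := (hmin f hf hfm).2 hge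
      refine ⟨z, R, hR, by rw [volume_ball_eq_ballVol, hRm],
        ae_eq_indicator_of_fMeas hf ?_ hz⟩
      have h1 : fMeas f (Metric.ball z R) = ballVol d R := by
        rw [← volume_ball_eq_ballVol z R]
        conv_rhs => rw [← fMeas_add_fMeas_one_sub hf]
        rw [Measure.add_apply, hz, add_zero]
      rw [measure_compl measurableSet_ball (h1 ▸ ballVol_ne_top d R), hmass f hf hfm, h1, tsub_self]
    · rintro ⟨z, r, hr, hvol, hfz⟩
      refine le_antisymm (le_iSup₂_of_le f ⟨hf, hfm⟩ le_rfl) (iSup₂_le fun g hg => ?_)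
      have hrR : r = R := (ballVol_strictMonoOn hd).injOn (mem_Ici.2 hr.le) (mem_Ici.2 hR.le) (by
        rw [← volume_ball_eq_ballVol z, hvol, hRm])
      subst hrR
      obtain ⟨e1, e2⟩ := fMeas_of_ae_eq_indicator measurableSet_ball hfz
      rw [Ups_radCost, Ups_radCost, e1, e2]
      exact (hmin g hg.1 hg.2).1 z
  · obtain ⟨e1, e2⟩ := fMeas_of_ae_eq_indicator
      (measurableSet_ball (x := (0 : Rd d)) (ε := 1)) (ae_eq_refl _)
    rw [planCost_radCost, Ups_radCost, e1, e2] at hopt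
    refine map_snd_eq_of_optimal hd hKc hKm hKs hK0 ?_ hopt
    rwa [← e1, ← e2]
end
end

section
/- Let (X,d_X) be a compact metric space, λ a positive Radon measure on X with λ(X) > 0, c ∈ C(X×X,ℝ), 0 < m ≤ λ(X)/2 and f ∈ L^1_m. Then the set Φ' is a compact subset of (C(X), ‖·‖_∞), and the supremum defining Υ*(f) is attained; more precisely it is attained by a pair of the form (ψ^{c̄}, ψ) with ψ = (φ^c)_− for some φ ∈ Φ'. -/
open MeasureTheory ENNReal Filter Set

noncomputable section

/-- The set `Π_f` of admissible exterior transport plans in a measured space `(X, λ)`: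
first marginal `f · λ`, second marginal `≤ (1 - f) · λ`. -/
def PlansC {X : Type*} [MeasurableSpace X] (lam : Measure X) (f : X → ℝ) :
    Set (Measure (X × X)) :=
  {γ | γ.map Prod.fst = lam.withDensity (fun x => ENNReal.ofReal (f x)) ∧
       γ.map Prod.snd ≤ lam.withDensity (fun x => ENNReal.ofReal (1 - f x))}

/-- The primal functional `Υ(f) = inf { ∫ c dγ : γ ∈ Π_f }`. -/
def UpsC {X : Type*} [MeasurableSpace X] (c : X × X → ℝ) (lam : Measure X) (f : X → ℝ) : ℝ :=
  sInf ((fun γ : Measure (X × X) => ∫ p, c p ∂γ) '' PlansC lam f)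

/-- `f ∈ L¹_m`: measurable, `0 ≤ f ≤ 1` and `∫ f dλ ≤ m`. -/
def MemL1mC {X : Type*} [MeasurableSpace X] (lam : Measure X) (m : ℝ) (f : X → ℝ) : Prop :=
  Measurable f ∧ (∀ x, 0 ≤ f x ∧ f x ≤ 1) ∧ (∫ x, f x ∂lam) ≤ m

/-- The `c`-transform `ξ^c (y) = inf_x (c(x,y) - ξ(x))`. -/
def ctr {X : Type*} (c : X × X → ℝ) (ξ : X → ℝ) : X → ℝ := fun y => ⨅ x, (c (x, y) - ξ x)

/-- The `c̄`-transform `ζ^{c̄} (x) = inf_y (c(x,y) - ζ(y))`. -/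
def cbtr {X : Type*} (c : X × X → ℝ) (ζ : X → ℝ) : X → ℝ := fun x => ⨅ y, (c (x, y) - ζ y)

/-- The negative part `ψ_- = min(ψ, 0)`. -/
def negp {X : Type*} (ψ : X → ℝ) : X → ℝ := fun x => min (ψ x) 0

/-- The set `Φ' = { φ ∈ C(X) : φ = ((φ^c)_-)^{c̄}, max φ^c ≥ 0 }`. -/
def PhiP {X : Type*} [TopologicalSpace X] (c : X × X → ℝ) : Set C(X, ℝ) :=
  {φ | ⇑φ = cbtr c (negp (ctr c ⇑φ)) ∧ ∃ y, 0 ≤ ctr c ⇑φ y}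

/-- The dual functional `K_f(φ, ψ) = ∫ (f φ + (1 - f) ψ) dλ`. -/
def Kfun {X : Type*} [MeasurableSpace X] (lam : Measure X) (f φ ψ : X → ℝ) : ℝ :=
  ∫ x, (f x * φ x + (1 - f x) * ψ x) ∂lam

/-- The dual problem `Υ*(f)`: supremum of `K_f(φ,ψ)` over continuous pairs with `ψ ≤ 0` and
`φ ⊕ ψ ≤ c`. -/
def UpsStarC {X : Type*} [MeasurableSpace X] [TopologicalSpace X] (c : X × X → ℝ)
    (lam : Measure X) (f : X → ℝ) : ℝ :=
  sSup ((fun p : (X → ℝ) × (X → ℝ) => Kfun lam f p.1 p.2) ''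
    {p | Continuous p.1 ∧ Continuous p.2 ∧ (∀ y, p.2 y ≤ 0) ∧
      ∀ x y, p.1 x + p.2 y ≤ c (x, y)})

section InfTransform

lemma le_ctr {X : Type*} [Nonempty X] {c : X × X → ℝ} {ξ : X → ℝ} {a : ℝ} {y : X}
    (h : ∀ x, a ≤ c (x, y) - ξ x) : a ≤ ctr c ξ y :=
  le_ciInf h

lemma le_cbtr {X : Type*} [Nonempty X] {c : X × X → ℝ} {ζ : X → ℝ} {a : ℝ} {x : X}
    (h : ∀ y, a ≤ c (x, y) - ζ y) : a ≤ cbtr c ζ x :=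
  le_ciInf h

variable {X : Type*} [TopologicalSpace X] [CompactSpace X] {c : X × X → ℝ}

lemma ctr_le (hc : Continuous c) {ξ : X → ℝ} (hξ : Continuous ξ) (x y : X) :
    ctr c ξ y ≤ c (x, y) - ξ x :=
  ciInf_le (isCompact_range (f := fun x => c (x, y) - ξ x) (by fun_prop)).bddBelow x

lemma cbtr_le (hc : Continuous c) {ζ : X → ℝ} (hζ : Continuous ζ) (x y : X) :
    cbtr c ζ x ≤ c (x, y) - ζ y :=
  ctr_le (hc.comp continuous_swap) hζ y x

lemma continuous_ctr_uncurry (hc : Continuous c) :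
    Continuous fun p : C(X, ℝ) × X => ctr c p.1 p.2 := by
  have h := (isCompact_univ (X := X)).continuous_sInf
    (f := fun (p : C(X, ℝ) × X) x => c (x, p.2) - p.1 x) (by
      change Continuous fun q : (C(X, ℝ) × X) × X => c (q.2, q.1.2) - q.1.1 q.2
      fun_prop)
  simp only [image_univ] at h
  exact h

/-- The `c`-transform as a continuous self-map of `C(X)`. -/
def ctrMap (hc : Continuous c) : C(C(X, ℝ), C(X, ℝ)) :=
  ContinuousMap.curry ⟨_, continuous_ctr_uncurry hc⟩

@[simp] lemma coe_ctrMap (hc : Continuous c) (φ : C(X, ℝ)) : ⇑(ctrMap hc φ) = ctr c φ := rfl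

/-- The `c̄`-transform as a continuous self-map of `C(X)`. -/
def cbtrMap (hc : Continuous c) : C(C(X, ℝ), C(X, ℝ)) :=
  ctrMap (hc.comp continuous_swap)

@[simp] lemma coe_cbtrMap (hc : Continuous c) (φ : C(X, ℝ)) : ⇑(cbtrMap hc φ) = cbtr c φ := rfl

/-- The negative part of the `c`-transform, `φ ↦ (φ^c)_-`, as a map `C(X) → C(X)`. -/
def negCtr (hc : Continuous c) (φ : C(X, ℝ)) : C(X, ℝ) :=
  (⟨fun r => min r 0, by fun_prop⟩ : C(ℝ, ℝ)).comp (ctrMap hc φ)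

@[simp] lemma coe_negCtr (hc : Continuous c) (φ : C(X, ℝ)) :
    ⇑(negCtr hc φ) = negp (ctr c φ) := rfl

lemma continuous_negCtr (hc : Continuous c) : Continuous (negCtr hc) :=
  (ContinuousMap.continuous_postcomp _).comp (ctrMap hc).continuous

lemma mem_PhiP_iff (hc : Continuous c) {φ : C(X, ℝ)} :
    φ ∈ PhiP c ↔ φ = cbtrMap hc (negCtr hc φ) ∧ ∃ y, 0 ≤ ctr c φ y := by
  simp [PhiP, DFunLike.ext'_iff]

lemma isClosed_PhiP (hc : Continuous c) : IsClosed (PhiP c) := by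
  have h₁ : IsClosed {φ : C(X, ℝ) | φ = cbtrMap hc (negCtr hc φ)} :=
    isClosed_eq continuous_id ((cbtrMap hc).continuous.comp (continuous_negCtr hc))
  have h₂ : IsClosed {φ : C(X, ℝ) | ∃ y, 0 ≤ ctr c φ y} := by
    have h : IsClosed {p : C(X, ℝ) × X | 0 ≤ ctr c p.1 p.2} :=
      isClosed_le continuous_const (continuous_ctr_uncurry hc)
    convert isClosedMap_fst_of_compactSpace _ h using 1
    ext φ
    simp
  convert h₁.inter h₂ using 1
  ext φ
  exact mem_PhiP_iff hc

end InfTransform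

section Compactness

variable {X : Type*} [PseudoMetricSpace X] [CompactSpace X] {c : X × X → ℝ}

lemma cbtr_sub_le [Nonempty X] (hc : Continuous c) {ζ : X → ℝ} (hζ : Continuous ζ) {x x' : X}
    {ε : ℝ} (h : ∀ y, c (x, y) ≤ c (x', y) + ε) : cbtr c ζ x - ε ≤ cbtr c ζ x' :=
  le_cbtr fun y => by linarith [cbtr_le hc hζ x y, h y]

lemma equicontinuous_PhiP [Nonempty X] (hc : Continuous c) :
    Equicontinuous fun (φ : PhiP c) (x : X) => (φ : C(X, ℝ)) x := by
  refine UniformEquicontinuous.equicontinuous ?_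
  rw [Metric.uniformEquicontinuous_iff]
  intro ε hε
  obtain ⟨δ, hδ, H⟩ := Metric.uniformContinuous_iff.1
    (CompactSpace.uniformContinuous_of_continuous hc) (ε / 2) (half_pos hε)
  refine ⟨δ, hδ, fun x x' hxx' ⟨φ, hφ⟩ => ?_⟩
  have key : ∀ y, |c (x, y) - c (x', y)| < ε / 2 := fun y =>
    H (by simpa [Prod.dist_eq] using hxx')
  have hζ : Continuous (negp (ctr c φ)) := (negCtr hc φ).continuous
  have h₁ := cbtr_sub_le hc hζ (x := x) (x' := x') (ε := ε / 2)
    fun y => by linarith [(abs_lt.1 (key y)).2]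
  have h₂ := cbtr_sub_le hc hζ (x := x') (x' := x) (ε := ε / 2)
    fun y => by linarith [(abs_lt.1 (key y)).1]
  rw [← hφ.1] at h₁ h₂
  change dist (φ x) (φ x') < ε
  rw [Real.dist_eq, abs_lt]
  constructor <;> linarith

lemma exists_bounds_PhiP [Nonempty X] (hc : Continuous c) :
    ∃ a b : ℝ, ∀ φ ∈ PhiP c, ∀ x, φ x ∈ Icc a b := by
  obtain ⟨a, ha⟩ := (isCompact_range hc).bddBelow
  obtain ⟨b, hb⟩ := (isCompact_range hc).bddAbove
  refine ⟨a, b, fun φ ⟨hφ, y₀, hy₀⟩ x => ?_⟩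
  rw [hφ]
  refine ⟨le_cbtr fun y => ?_, ?_⟩
  · have : negp (ctr c φ) y ≤ 0 := min_le_right _ _
    linarith [ha (mem_range_self (x, y))]
  · have h := cbtr_le hc (negCtr hc φ).continuous x y₀
    rw [coe_negCtr] at h
    have : negp (ctr c φ) y₀ = 0 := min_eq_right hy₀
    linarith [hb (mem_range_self (x, y₀))]

lemma isCompact_PhiP [Nonempty X] (hc : Continuous c) : IsCompact (PhiP c) := by
  obtain ⟨a, b, hab⟩ := exists_bounds_PhiP hc
  let e := (ContinuousMap.isometryEquivBoundedOfCompact X ℝ).toHomeomorph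
  have hcomp : IsCompact (e.symm ⁻¹' PhiP c) := by
    refine BoundedContinuousFunction.arzela_ascoli₂ (Icc a b) isCompact_Icc _
      ((isClosed_PhiP hc).preimage e.symm.continuous) (fun g x hg => hab _ hg x) ?_
    exact (equicontinuous_PhiP hc).comp fun g : e.symm ⁻¹' PhiP c => ⟨e.symm g, g.2⟩
  exact e.symm.isCompact_preimage.1 hcomp

end Compactness

section DualFunctional

lemma norm_Kfun_integrand_le {X : Type*} [TopologicalSpace X] [CompactSpace X] {f : X → ℝ}
    (hf01 : ∀ x, 0 ≤ f x ∧ f x ≤ 1) (p : C(X, ℝ) × C(X, ℝ)) (x : X) :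
    ‖f x * p.1 x + (1 - f x) * p.2 x‖ ≤ ‖p‖ := by
  have h₁ := abs_le.1 ((p.1.norm_coe_le_norm x).trans (norm_fst_le p))
  have h₂ := abs_le.1 ((p.2.norm_coe_le_norm x).trans (norm_snd_le p))
  obtain ⟨h0, h1⟩ := hf01 x
  rw [Real.norm_eq_abs, abs_le]
  constructor <;> nlinarith

lemma aestronglyMeasurable_Kfun_integrand {X : Type*} [TopologicalSpace X] [MeasurableSpace X]
    [OpensMeasurableSpace X] {lam : Measure X} {f : X → ℝ} (hf : Measurable f) (φ ψ : C(X, ℝ)) :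
    AEStronglyMeasurable (fun x => f x * φ x + (1 - f x) * ψ x) lam := by
  have := φ.continuous.measurable
  have := ψ.continuous.measurable
  exact Measurable.aestronglyMeasurable (by fun_prop)

variable {X : Type*} [TopologicalSpace X] [CompactSpace X] [MeasurableSpace X]
  [OpensMeasurableSpace X] {lam : Measure X} {f : X → ℝ} [IsFiniteMeasure lam]

lemma integrable_Kfun_integrand (hf : Measurable f) (hf01 : ∀ x, 0 ≤ f x ∧ f x ≤ 1)
    (φ ψ : C(X, ℝ)) : Integrable (fun x => f x * φ x + (1 - f x) * ψ x) lam :=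
  Integrable.of_bound (aestronglyMeasurable_Kfun_integrand hf φ ψ) ‖(φ, ψ)‖
    (ae_of_all _ (norm_Kfun_integrand_le hf01 (φ, ψ)))

lemma continuous_Kfun (hf : Measurable f) (hf01 : ∀ x, 0 ≤ f x ∧ f x ≤ 1) :
    Continuous fun p : C(X, ℝ) × C(X, ℝ) => Kfun lam f p.1 p.2 := by
  refine continuous_iff_continuousAt.2 fun p₀ => ?_
  refine continuousAt_of_dominated (bound := fun _ => ‖p₀‖ + 1)
    (Eventually.of_forall fun p => aestronglyMeasurable_Kfun_integrand hf p.1 p.2) ?_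
    (integrable_const _) (ae_of_all _ fun x => by fun_prop)
  filter_upwards [continuous_norm.continuousAt.eventually (gt_mem_nhds (lt_add_one ‖p₀‖))]
    with p hp
  exact ae_of_all _ fun x => (norm_Kfun_integrand_le hf01 p x).trans hp.le

lemma Kfun_mono (hf : Measurable f) (hf01 : ∀ x, 0 ≤ f x ∧ f x ≤ 1) {φ φ' ψ ψ' : C(X, ℝ)}
    (hφ : φ ≤ φ') (hψ : ψ ≤ ψ') : Kfun lam f φ ψ ≤ Kfun lam f φ' ψ' := by
  refine integral_mono (integrable_Kfun_integrand hf hf01 φ ψ)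
    (integrable_Kfun_integrand hf hf01 φ' ψ') fun x => ?_
  have h0 := (hf01 x).1
  have h1 := sub_nonneg.2 (hf01 x).2
  exact add_le_add (mul_le_mul_of_nonneg_left (hφ x) h0) (mul_le_mul_of_nonneg_left (hψ x) h1)

/-- Shifting `(φ, ψ)` to `(φ - t, ψ + t)` with `t ≥ 0` does not decrease the dual functional when
`f` carries at most half of the total mass. -/
lemma Kfun_le_shift (hf : Measurable f) (hf01 : ∀ x, 0 ≤ f x ∧ f x ≤ 1)
    (hmass : 2 * ∫ x, f x ∂lam ≤ lam.real univ) (φ ψ : C(X, ℝ)) {t : ℝ} (ht : 0 ≤ t) :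
    Kfun lam f φ ψ ≤
      Kfun lam f (φ - ContinuousMap.const X t : C(X, ℝ))
        (ψ + ContinuousMap.const X t : C(X, ℝ)) := by
  have hfi : Integrable f lam := Integrable.of_bound hf.aestronglyMeasurable 1
    (ae_of_all _ fun x => abs_le.2 ⟨by linarith [(hf01 x).1], (hf01 x).2⟩)
  have hshift : ∫ x, (t - 2 * t * f x) ∂lam = t * (lam.real univ - 2 * ∫ x, f x ∂lam) := by
    rw [integral_sub (integrable_const _) (hfi.const_mul _), integral_const, integral_const_mul,
      smul_eq_mul]
    ring
  have heq : Kfun lam f (φ - ContinuousMap.const X t : C(X, ℝ))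
      (ψ + ContinuousMap.const X t : C(X, ℝ)) =
      Kfun lam f φ ψ + ∫ x, (t - 2 * t * f x) ∂lam := by
    unfold Kfun
    have hi : Integrable (fun x => t - 2 * t * f x) lam :=
      (integrable_const _).sub (hfi.const_mul _)
    rw [← integral_add (integrable_Kfun_integrand hf hf01 φ ψ) hi]
    refine integral_congr_ae (ae_of_all _ fun x => ?_)
    simp only [ContinuousMap.sub_apply, ContinuousMap.add_apply, ContinuousMap.const_apply]
    ring
  rw [heq, hshift]
  have := mul_nonneg ht (sub_nonneg.2 hmass)
  linarith

end DualFunctional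

section Improvement

variable {X : Type*} [TopologicalSpace X] [CompactSpace X] [Nonempty X] {c : X × X → ℝ}

lemma ctr_sub_const (hc : Continuous c) (φ : C(X, ℝ)) (t : ℝ) (y : X) :
    ctr c (φ - ContinuousMap.const X t : C(X, ℝ)) y = ctr c φ y + t := by
  refine le_antisymm ?_ (le_ctr fun x => ?_)
  · rw [← sub_le_iff_le_add]
    refine le_ctr fun x => ?_
    have := ctr_le hc (φ - ContinuousMap.const X t : C(X, ℝ)).continuous x y
    simp only [ContinuousMap.sub_apply, ContinuousMap.const_apply] at this
    linarith
  · have := ctr_le hc φ.continuous x y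
    simp only [ContinuousMap.sub_apply, ContinuousMap.const_apply]
    linarith

lemma cbtr_add_const (hc : Continuous c) (ψ : C(X, ℝ)) (t : ℝ) (x : X) :
    cbtr c (ψ + ContinuousMap.const X t : C(X, ℝ)) x = cbtr c ψ x - t := by
  have h := ctr_sub_const (hc.comp continuous_swap) ψ (-t) x
  have : (ψ - ContinuousMap.const X (-t) : C(X, ℝ)) = ψ + ContinuousMap.const X t := by
    ext; simp
  rw [this] at h
  exact h

/-- The `c̄`-transform of a nonpositive `ψ` is a fixed point of `φ ↦ ((φ^c)_-)^{c̄}`. -/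
lemma cbtrMap_negCtr_cbtrMap (hc : Continuous c) {ψ : C(X, ℝ)} (hψ : ψ ≤ 0) :
    cbtrMap hc (negCtr hc (cbtrMap hc ψ)) = cbtrMap hc ψ ∧ ψ ≤ negCtr hc (cbtrMap hc ψ) := by
  have hle : ψ ≤ negCtr hc (cbtrMap hc ψ) := by
    refine ContinuousMap.le_def.2 fun y => le_min (le_ctr fun x => ?_) (hψ y)
    have := cbtr_le hc ψ.continuous x y
    rw [coe_cbtrMap]
    linarith
  refine ⟨le_antisymm ?_ ?_, hle⟩ <;>
    refine ContinuousMap.le_def.2 fun x => le_cbtr (c := c) fun y => ?_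
  · have := cbtr_le hc (negCtr hc (cbtrMap hc ψ)).continuous x y
    rw [coe_cbtrMap]
    linarith [ContinuousMap.le_def.1 hle y]
  · have := ctr_le hc (cbtrMap hc ψ).continuous x y
    have : negCtr hc (cbtrMap hc ψ) y ≤ ctr c (cbtrMap hc ψ) y := min_le_left _ _
    linarith

variable [MeasurableSpace X] [OpensMeasurableSpace X] {lam : Measure X} [IsFiniteMeasure lam]
  {f : X → ℝ}

/-- Every admissible pair is dominated, for the dual functional, by a pair
`(φ, (φ^c)_-)` with `φ ∈ Φ'`. -/
lemma exists_mem_PhiP_Kfun_le (hc : Continuous c) (hf : Measurable f)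
    (hf01 : ∀ x, 0 ≤ f x ∧ f x ≤ 1) (hmass : 2 * ∫ x, f x ∂lam ≤ lam.real univ)
    {φ ψ : C(X, ℝ)} (hψ : ψ ≤ 0) (hadm : ∀ x y, φ x + ψ y ≤ c (x, y)) :
    ∃ χ ∈ PhiP c, Kfun lam f φ ψ ≤ Kfun lam f χ (negCtr hc χ) := by
  obtain ⟨hfix, hle⟩ := cbtrMap_negCtr_cbtrMap hc hψ
  have hφ : φ ≤ cbtrMap hc ψ := ContinuousMap.le_def.2 fun x =>
    le_cbtr (c := c) fun y => by linarith [hadm x y]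
  set φ₁ := cbtrMap hc ψ
  have hK : Kfun lam f φ ψ ≤ Kfun lam f φ₁ (negCtr hc φ₁) := Kfun_mono hf hf01 hφ hle
  by_cases hpos : ∃ y, 0 ≤ ctr c φ₁ y
  · exact ⟨φ₁, (mem_PhiP_iff hc).2 ⟨hfix.symm, hpos⟩, hK⟩
  push Not at hpos
  obtain ⟨y₀, -, hy₀⟩ := isCompact_univ.exists_isMaxOn univ_nonempty
    (ctrMap hc φ₁).continuous.continuousOn
  have hmax : ∀ y, ctr c φ₁ y ≤ ctr c φ₁ y₀ := fun y => hy₀ (mem_univ y)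
  set t := -ctr c φ₁ y₀ with ht
  have ht0 : 0 ≤ t := by linarith [hpos y₀]
  set φ₂ : C(X, ℝ) := φ₁ - ContinuousMap.const X t with hφ₂
  have hneg : negCtr hc φ₂ = negCtr hc φ₁ + ContinuousMap.const X t := by
    ext y
    change min (ctr c φ₂ y) 0 = min (ctr c φ₁ y) 0 + t
    rw [hφ₂, ctr_sub_const hc, min_eq_left (hpos y).le, min_eq_left]
    linarith [hmax y]
  refine ⟨φ₂, (mem_PhiP_iff hc).2 ⟨?_, y₀, ?_⟩, hK.trans ?_⟩
  · ext x
    rw [hneg, coe_cbtrMap, cbtr_add_const hc, ← coe_cbtrMap hc, hfix]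
    rfl
  · rw [hφ₂, ctr_sub_const hc]
    linarith
  · rw [hneg]
    exact Kfun_le_shift hf hf01 hmass _ _ ht0

end Improvement

/-- `Φ'` is a compact subset of `(C(X), ‖·‖_∞)` and the supremum defining `Υ*(f)`
is attained by a pair of the form `(ψ^{c̄}, ψ)` with `ψ = (φ^c)_-` for some `φ ∈ Φ'`. -/
theorem stmt_4 {X : Type*} [MetricSpace X] [CompactSpace X] [MeasurableSpace X] [BorelSpace X]
    (lam : Measure X) [IsFiniteMeasure lam] [lam.Regular] (hlam : lam Set.univ ≠ 0)
    (c : X × X → ℝ) (hc : Continuous c)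
    (m : ℝ) (hm : 0 < m) (hm2 : 2 * m ≤ (lam Set.univ).toReal)
    (f : X → ℝ) (hf : MemL1mC lam m f) :
    IsCompact (PhiP c) ∧
    ∃ φ ∈ PhiP c,
      Kfun lam f (cbtr c (negp (ctr c ⇑φ))) (negp (ctr c ⇑φ)) = UpsStarC c lam f := by
  have : Nonempty X := by
    by_contra h
    rw [not_nonempty_iff] at h
    exact hlam (by simp [univ_eq_empty_iff.2 h])
  obtain ⟨hfm, hf01, hfint⟩ := hf
  have hmass : 2 * ∫ x, f x ∂lam ≤ lam.real univ :=
    (mul_le_mul_of_nonneg_left hfint zero_le_two).trans hm2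
  refine ⟨isCompact_PhiP hc, ?_⟩
  obtain ⟨a, ha⟩ := (isCompact_range hc).bddBelow
  obtain ⟨χ₀, hχ₀, -⟩ := exists_mem_PhiP_Kfun_le (lam := lam) (f := f) (φ := .const X a) (ψ := 0)
    hc hfm hf01 hmass le_rfl fun x y => by simpa using ha (mem_range_self (x, y))
  obtain ⟨φ, hφ, hmax⟩ := (isCompact_PhiP hc).exists_isMaxOn ⟨χ₀, hχ₀⟩
    ((continuous_Kfun (lam := lam) hfm hf01).comp
      (continuous_id.prodMk (continuous_negCtr hc))).continuousOn
  refine ⟨φ, hφ, Eq.symm <| IsGreatest.csSup_eq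
    ⟨⟨(φ, negCtr hc φ), ?_, ?_⟩, ?_⟩⟩
  · refine ⟨φ.continuous, (negCtr hc φ).continuous, fun y => min_le_right _ _, fun x y => ?_⟩
    have h := ctr_le hc φ.continuous x y
    have : negCtr hc φ y ≤ ctr c φ y := min_le_left _ _
    change φ x + negCtr hc φ y ≤ c (x, y)
    linarith
  · rw [← hφ.1]
    rfl
  · rintro _ ⟨⟨φ', ψ'⟩, ⟨hφ', hψ', hneg, hadm⟩, rfl⟩
    obtain ⟨χ, hχ, hle⟩ := exists_mem_PhiP_Kfun_le (lam := lam) (φ := ⟨φ', hφ'⟩) (ψ := ⟨ψ', hψ'⟩)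
      hc hfm hf01 hmass hneg hadm
    rw [← hφ.1]
    exact hle.trans (hmax hχ)
end
end
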